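/- Let ν > n/2 − 1 and 1 < p < ∞, with conjugate exponent p' = p/(p−1). Then the Bergman projection P_ν admits a bounded extension to L^p_ν (i.e. there is C with ‖P_ν f‖_{L^p_ν} ≤ C‖f‖_{L^p_ν} for all f ∈ L²_ν ∩ L^p_ν) if and only if the natural map Φ, sending F ∈ A^{p'}_ν to the continuous linear functional G ↦ ∫_{T_Λ} G(z) \overline{F(z)} dV_ν(z) on A^p_ν (with the L^p_ν norm), is a bijection from A^{p'}_ν onto the space of all continuous linear functionals on A^p_ν. -/

import Mathlib

open MeasureTheory Complex Set
open scoped ENNReal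

noncomputable section

/-- The Lorentz form `Δ(y) = y₁² − y₂² − ⋯ − yₙ²` on `ℝⁿ`
(written as `2 y₀² − ∑ yᵢ²` with 0-based indexing). -/
def lor {n : ℕ} [NeZero n] (y : Fin n → ℝ) : ℝ := 2 * y 0 ^ 2 - ∑ i, y i ^ 2

/-- The holomorphic extension of the Lorentz form to `ℂⁿ`. -/
def lorC {n : ℕ} [NeZero n] (z : Fin n → ℂ) : ℂ := 2 * z 0 ^ 2 - ∑ i, z i ^ 2

/-- Componentwise imaginary part. -/
def imP {n : ℕ} (z : Fin n → ℂ) : Fin n → ℝ := fun i => (z i).im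

/-- The forward light cone `Λ`. -/
def cone (n : ℕ) [NeZero n] : Set (Fin n → ℝ) := {y | 0 < lor y ∧ 0 < y 0}

/-- The tube domain `T_Λ` over the forward light cone. -/
def tube (n : ℕ) [NeZero n] : Set (Fin n → ℂ) := {z | imP z ∈ cone n}

/-- The weighted measure `dV_ν = Δ(Im z)^{ν − n/2} dz` on `T_Λ`. -/
def dV (n : ℕ) [NeZero n] (ν : ℝ) : Measure (Fin n → ℂ) :=
  ((volume : Measure (Fin n → ℂ)).restrict (tube n)).withDensity
    (fun z => ENNReal.ofReal (lor (imP z) ^ (ν - (n : ℝ) / 2)))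

/-- `∫ |F|^p dV_ν` (as an extended nonnegative real). -/
def lpInt (n : ℕ) [NeZero n] (p ν : ℝ) (F : (Fin n → ℂ) → ℂ) : ℝ≥0∞ :=
  ∫⁻ z, ENNReal.ofReal (‖F z‖ ^ p) ∂(dV n ν)

/-- The `L^p_ν` norm `(∫ |F|^p dV_ν)^{1/p}`. -/
def lpNorm (n : ℕ) [NeZero n] (p ν : ℝ) (F : (Fin n → ℂ) → ℂ) : ℝ≥0∞ :=
  (lpInt n p ν F) ^ (1 / p)

/-- The Bergman space `A^p_ν`: holomorphic on `T_Λ` and in `L^p_ν`. -/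
def memA (n : ℕ) [NeZero n] (p ν : ℝ) (F : (Fin n → ℂ) → ℂ) : Prop :=
  DifferentiableOn ℂ F (tube n) ∧ lpInt n p ν F < ⊤

/-- Partial derivative `∂/∂zᵢ`. -/
def pd {n : ℕ} (i : Fin n) (F : (Fin n → ℂ) → ℂ) : (Fin n → ℂ) → ℂ :=
  fun z => fderiv ℂ F z (Pi.single i 1)

/-- The wave (Box) operator `□ = −(∂₁² − ∂₂² − ⋯ − ∂ₙ²)`, so that
`□ e^{i z·ξ} = Δ(ξ) e^{i z·ξ}`. -/
def BoxOp {n : ℕ} [NeZero n] (F : (Fin n → ℂ) → ℂ) : (Fin n → ℂ) → ℂ :=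
  fun z => -(2 * pd 0 (pd 0 F) z - ∑ i, pd i (pd i F) z)

/-- The (unnormalized) Bergman kernel `B_β(z,w) = Δ((z − w̄)/i)^{−(β+n)}`. -/
def berg (n : ℕ) [NeZero n] (β : ℝ) (z w : Fin n → ℂ) : ℂ :=
  lorC (fun i => (z i - (starRingEnd ℂ) (w i)) / Complex.I) ^ (-(β + (n : ℝ)) : ℂ)

/-- The Hardy inequality holds for `(p, ν)`:
`∫ |F|^p dV_ν ≤ C ∫ |Δ(Im z) □F(z)|^p dV_ν(z)` for all `F ∈ A^p_ν`. -/
def hardy (n : ℕ) [NeZero n] (p ν : ℝ) : Prop :=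
  ∃ C > (0 : ℝ), ∀ F, memA n p ν F →
    lpInt n p ν F ≤ ENNReal.ofReal C *
      lpInt n p ν (fun z => (lor (imP z) : ℂ) * BoxOp F z)

/-- `g` is the orthogonal projection of `f ∈ L²_ν` onto the closed subspace `A²_ν`:
`g ∈ A²_ν` and `f − g ⊥ A²_ν`. -/
def isProj (n : ℕ) [NeZero n] (ν : ℝ) (f g : (Fin n → ℂ) → ℂ) : Prop :=
  memA n 2 ν g ∧ ∀ h, memA n 2 ν h →
    ∫ z, f z * (starRingEnd ℂ) (h z) ∂(dV n ν) =
      ∫ z, g z * (starRingEnd ℂ) (h z) ∂(dV n ν)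

/-- The Bergman projection `P_ν` admits a bounded extension to `L^p_ν`:
`‖P_ν f‖_{L^p_ν} ≤ C ‖f‖_{L^p_ν}` for all `f ∈ L²_ν ∩ L^p_ν`. -/
def projBounded (n : ℕ) [NeZero n] (p ν : ℝ) : Prop :=
  ∃ C > (0 : ℝ), ∀ f g : (Fin n → ℂ) → ℂ,
    AEStronglyMeasurable f (dV n ν) → lpInt n 2 ν f < ⊤ → lpInt n p ν f < ⊤ →
    isProj n ν f g → lpNorm n p ν g ≤ ENNReal.ofReal C * lpNorm n p ν f

/-- A bounded (continuous) linear functional on `A^p_ν`. -/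
def isBddFunc (n : ℕ) [NeZero n] (p ν : ℝ) (γ : ((Fin n → ℂ) → ℂ) → ℂ) : Prop :=
  (∀ F G, memA n p ν F → memA n p ν G → γ (F + G) = γ F + γ G) ∧
  (∀ (c : ℂ) (F), memA n p ν F → γ (fun z => c * F z) = c * γ F) ∧
  ∃ C : ℝ, ∀ F, memA n p ν F → ‖γ F‖ ≤ C * (lpNorm n p ν F).toReal

/-- The polarization of the Lorentz form. -/
def lorBil {n : ℕ} [NeZero n] (x y : Fin n → ℝ) : ℝ := 2 * x 0 * y 0 - ∑ i, x i * y i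

section Cone

variable {n : ℕ} [NeZero n]

lemma lor_add (x y : Fin n → ℝ) : lor (x + y) = lor x + lor y + 2 * lorBil x y := by
  simp only [lor, lorBil, Pi.add_apply]
  have : ∑ i, (x i + y i) ^ 2 = ∑ i, x i ^ 2 + ∑ i, y i ^ 2 + 2 * ∑ i, x i * y i := by
    rw [Finset.mul_sum, ← Finset.sum_add_distrib, ← Finset.sum_add_distrib]
    exact Finset.sum_congr rfl fun i _ => by ring
  rw [this]; ring

lemma lor_smul (r : ℝ) (y : Fin n → ℝ) : lor (r • y) = r ^ 2 * lor y := by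
  simp only [lor, Pi.smul_apply, smul_eq_mul, mul_pow, ← Finset.mul_sum]; ring

lemma lorBil_smul_left (r : ℝ) (x y : Fin n → ℝ) : lorBil (r • x) y = r * lorBil x y := by
  simp only [lorBil, Pi.smul_apply, smul_eq_mul, mul_assoc, ← Finset.mul_sum]; ring

lemma lorBil_pos {x y : Fin n → ℝ} (hx : 0 ≤ lor x) (hx0 : 0 < x 0) (hy : y ∈ cone n) :
    0 < lorBil x y := by
  obtain ⟨hy, hy0⟩ := hy
  have hCS := Finset.sum_mul_sq_le_sq_mul_sq Finset.univ x y
  simp only [lor, lorBil] at *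
  have hlt : (∑ i, x i * y i) ^ 2 < (2 * x 0 * y 0) ^ 2 := by
    refine hCS.trans_lt ?_
    calc (∑ i, x i ^ 2) * ∑ i, y i ^ 2 ≤ (2 * x 0 ^ 2) * ∑ i, y i ^ 2 := by
          gcongr; linarith
      _ < (2 * x 0 ^ 2) * (2 * y 0 ^ 2) := by
          gcongr; linarith
      _ = _ := by ring
  have := abs_lt_of_sq_lt_sq hlt (by positivity)
  linarith [(abs_lt.1 this).2]

lemma lorBil_nonneg {x y : Fin n → ℝ} (hx : 0 ≤ lor x) (hx0 : 0 ≤ x 0) (hy : y ∈ cone n) :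
    0 ≤ lorBil x y := by
  rcases hx0.lt_or_eq with h | h
  · exact (lorBil_pos hx h hy).le
  · have h2 : ∑ i, x i ^ 2 ≤ 0 := by simp only [lor, ← h] at hx; linarith
    have h3 : ∀ i, x i = 0 := by
      intro i
      have := (Finset.sum_eq_zero_iff_of_nonneg (fun i _ => sq_nonneg (x i))).1
        (le_antisymm h2 (Finset.sum_nonneg fun i _ => sq_nonneg (x i))) i (Finset.mem_univ i)
      simpa using this
    simp [lorBil, h3]

lemma le_lor_add {x y : Fin n → ℝ} (hx : 0 ≤ lor x) (hx0 : 0 ≤ x 0) (hy : y ∈ cone n) :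
    lor x + lor y ≤ lor (x + y) := by
  rw [lor_add]; linarith [lorBil_nonneg hx hx0 hy]

lemma add_mem_cone {x y : Fin n → ℝ} (hx : 0 ≤ lor x) (hx0 : 0 ≤ x 0) (hy : y ∈ cone n) :
    x + y ∈ cone n :=
  ⟨by linarith [le_lor_add hx hx0 hy, hy.1], by simpa using add_pos_of_nonneg_of_pos hx0 hy.2⟩

lemma smul_mem_cone {r : ℝ} (hr : 0 < r) {y : Fin n → ℝ} (hy : y ∈ cone n) : r • y ∈ cone n :=
  ⟨by rw [lor_smul]; have := hy.1; positivity, by simpa using mul_pos hr hy.2⟩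

@[fun_prop]
lemma continuous_lor : Continuous (lor : (Fin n → ℝ) → ℝ) := by
  unfold lor; fun_prop

@[fun_prop]
lemma continuous_imP : Continuous (imP : (Fin n → ℂ) → Fin n → ℝ) := by
  unfold imP; fun_prop

lemma isOpen_cone : IsOpen (cone n) :=
  (isOpen_lt continuous_const continuous_lor).inter
    (isOpen_lt continuous_const (continuous_apply 0))

lemma isOpen_tube : IsOpen (tube n) := isOpen_cone.preimage continuous_imP

lemma measurableSet_tube : MeasurableSet (tube n) := isOpen_tube.measurableSet

lemma abs_le_of_mem_cone {y : Fin n → ℝ} (hy : y ∈ cone n) (i : Fin n) : |y i| ≤ y 0 := by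
  by_cases h : i = 0
  · rw [h, abs_of_pos hy.2]
  have h1 : y i ^ 2 + y 0 ^ 2 ≤ ∑ j, y j ^ 2 := by
    have := Finset.sum_le_sum_of_subset_of_nonneg (Finset.subset_univ ({i, 0} : Finset (Fin n)))
      (fun j _ _ => sq_nonneg (y j))
    rwa [Finset.sum_pair h] at this
  have h2 := hy.1
  simp only [lor] at h2
  exact abs_le_of_sq_le_sq (by linarith) hy.2.le

lemma lor_le_sq (y : Fin n → ℝ) : lor y ≤ y 0 ^ 2 := by
  have : y 0 ^ 2 ≤ ∑ j, y j ^ 2 :=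
    Finset.single_le_sum (fun j _ => sq_nonneg (y j)) (Finset.mem_univ 0)
  simp only [lor]; linarith

/-- The base point `e = (1, 0, …, 0)` of the cone. -/
def coneE (n : ℕ) [NeZero n] : Fin n → ℝ := Pi.single 0 1

lemma lor_coneE : lor (coneE n) = 1 := by
  simp [lor, coneE, Pi.single_apply]; norm_num

lemma coneE_mem : coneE n ∈ cone n := ⟨by simp [lor_coneE], by simp [coneE]⟩

/-- The null vectors `(1, ±1, 0, …, 0)`. -/
def nullVec (n : ℕ) [NeZero n] (hn : 3 ≤ n) (σ : ℝ) : Fin n → ℝ :=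
  Pi.single 0 1 + Pi.single ⟨1, by omega⟩ σ

lemma one_ne (hn : 3 ≤ n) : (⟨1, by omega⟩ : Fin n) ≠ 0 := by
  intro h
  have := congrArg Fin.val h
  simp at this

lemma nullVec_zero (hn : 3 ≤ n) (σ : ℝ) : nullVec n hn σ 0 = 1 := by
  simp [nullVec, Pi.single_apply, (one_ne hn).symm]

lemma lor_nullVec (hn : 3 ≤ n) {σ : ℝ} (hσ : σ ^ 2 = 1) : lor (nullVec n hn σ) = 0 := by
  have h : ∀ i, nullVec n hn σ i ^ 2 =
      (if i = 0 then 1 else 0) + (if i = ⟨1, by omega⟩ then 1 else 0) := by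
    intro i
    by_cases h0 : i = 0
    · subst h0; simp [nullVec_zero, (one_ne hn).symm]
    · by_cases h1 : i = ⟨1, by omega⟩
      · subst h1; simp [nullVec, Pi.single_apply, one_ne hn, hσ]
      · simp [nullVec, Pi.single_apply, h0, h1]
  simp only [lor, nullVec_zero, h, Finset.sum_add_distrib]
  simp; norm_num

lemma nullVec_add (hn : 3 ≤ n) : nullVec n hn 1 + nullVec n hn (-1) = (2 : ℝ) • coneE n := by
  ext i
  simp only [nullVec, coneE, Pi.add_apply, Pi.smul_apply, Pi.single_apply, smul_eq_mul]
  split_ifs <;> norm_num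

lemma cone_of_sub {y u : Fin n → ℝ} (hu : 0 ≤ lor u) (hu0 : 0 ≤ u 0) (h : y - u ∈ cone n) :
    y ∈ cone n := by
  have := add_mem_cone hu hu0 h
  rwa [add_sub_cancel] at this

end Cone

lemma lintegral_sub_rpow_le {L b R s : ℝ} (hL : 0 < L) (hb : 0 < b) (hR : 0 ≤ R) (hs : -1 < s) :
    ∫⁻ r in Icc 0 R, (if 0 < L - b * r then ENNReal.ofReal ((L - b * r) ^ s) else 0) ≤
      ENNReal.ofReal (max 1 (1 / (s + 1)) * R * L ^ s) := by
  have hLs : 0 < L ^ s := Real.rpow_pos_of_pos hL s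
  rcases le_or_gt 0 s with h0 | h0
  · calc _ ≤ ∫⁻ r in Icc 0 R, ENNReal.ofReal (L ^ s) := by
          refine setLIntegral_mono measurable_const fun r hr => ?_
          split_ifs with h
          · exact ENNReal.ofReal_le_ofReal (Real.rpow_le_rpow h.le
              (by linarith [mul_nonneg hb.le hr.1]) h0)
          · exact zero_le
      _ = ENNReal.ofReal (1 * R * L ^ s) := by
          rw [setLIntegral_const, Real.volume_Icc, ← ENNReal.ofReal_mul hLs.le]
          congr 1; ring
      _ ≤ _ := by
          refine ENNReal.ofReal_le_ofReal ?_
          gcongr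
          exact le_max_left _ _
  · have hs1 : 0 < s + 1 := by linarith
    set ρ := min R (L / b) with hρ
    have hρ0 : 0 ≤ ρ := le_min hR (by positivity)
    have hρL : b * ρ ≤ L := by
      have := min_le_right R (L / b)
      rw [le_div_iff₀ hb] at this
      linarith
    calc _ ≤ ∫⁻ r in Icc 0 ρ, ENNReal.ofReal ((L - b * r) ^ s) := by
          rw [← lintegral_indicator measurableSet_Icc, ← lintegral_indicator measurableSet_Icc]
          refine lintegral_mono fun r => ?_
          by_cases hr : r ∈ Icc 0 R
          · rw [indicator_of_mem hr]
            split_ifs with h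
            · rw [indicator_of_mem]
              refine ⟨hr.1, le_min hr.2 ?_⟩
              rw [le_div_iff₀ hb]; linarith
            · exact zero_le
          · rw [indicator_of_notMem hr]; exact zero_le
      _ = ∫⁻ r in Ioc 0 ρ, ENNReal.ofReal ((L - b * r) ^ s) := by
          rw [setLIntegral_congr Ioc_ae_eq_Icc]
      _ = ENNReal.ofReal (∫ r in (0 : ℝ)..ρ, (L - b * r) ^ s) := by
          rw [intervalIntegral.integral_of_le hρ0]
          refine (ofReal_integral_eq_lintegral_ofReal ?_ ?_).symm
          · have h1 : IntervalIntegrable (fun x : ℝ => x ^ s) volume (L - b * 0) (L - b * ρ) :=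
              intervalIntegral.intervalIntegrable_rpow' hs
            have h2 : IntervalIntegrable (fun x : ℝ => (L - b * x) ^ s) volume 0 ρ := by
              have h3 := (h1.comp_sub_left L).comp_mul_left (c := b)
              simpa [hb.ne'] using h3
            exact (intervalIntegrable_iff_integrableOn_Ioc_of_le hρ0).1 h2
          · refine (ae_restrict_iff' measurableSet_Ioc).2 (ae_of_all _ fun r hr => ?_)
            exact Real.rpow_nonneg (by nlinarith [hr.2]) _
      _ ≤ _ := by
          refine ENNReal.ofReal_le_ofReal ?_
          rw [intervalIntegral.integral_comp_sub_mul (fun x : ℝ => x ^ s) hb.ne' L,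
            integral_rpow (Or.inl hs)]
          have hlam : 1 - b * ρ / L ≤ (1 - b * ρ / L) ^ (s + 1) := by
            have h1 : 0 ≤ 1 - b * ρ / L := by
              rw [sub_nonneg, div_le_one hL]; exact hρL
            have h2 : 1 - b * ρ / L ≤ 1 := by
              have : 0 ≤ b * ρ / L := by positivity
              linarith
            calc 1 - b * ρ / L = (1 - b * ρ / L) ^ (1 : ℝ) := (Real.rpow_one _).symm
              _ ≤ _ := Real.rpow_le_rpow_of_exponent_ge' h1 h2 hs1.le (by linarith)
          have hfac : (L - b * ρ) ^ (s + 1) = L ^ (s + 1) * (1 - b * ρ / L) ^ (s + 1) := by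
            rw [← Real.mul_rpow hL.le (by rw [sub_nonneg, div_le_one hL]; exact hρL)]
            congr 1; field_simp
          have hL1 : L ^ (s + 1) = L ^ s * L := by rw [Real.rpow_add hL, Real.rpow_one]
          rw [mul_zero, sub_zero, hfac, smul_eq_mul]
          calc b⁻¹ * ((L ^ (s + 1) - L ^ (s + 1) * (1 - b * ρ / L) ^ (s + 1)) / (s + 1))
              ≤ b⁻¹ * ((L ^ (s + 1) - L ^ (s + 1) * (1 - b * ρ / L)) / (s + 1)) := by gcongr
            _ = 1 / (s + 1) * ρ * L ^ s := by rw [hL1]; field_simp; ring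
            _ ≤ max 1 (1 / (s + 1)) * R * L ^ s := by
                gcongr
                · exact le_max_right _ _
                · exact min_le_left _ _

section Weight

variable {n : ℕ} [NeZero n]

/-- The weight `Δ^s` on the cone, extended by zero. -/
def wt (s : ℝ) (y : Fin n → ℝ) : ℝ≥0∞ :=
  (cone n).indicator (fun y => ENNReal.ofReal (lor y ^ s)) y

lemma measurable_wt (s : ℝ) : Measurable (wt s : (Fin n → ℝ) → ℝ≥0∞) := by
  unfold wt
  refine Measurable.indicator ?_ isOpen_cone.measurableSet
  exact ((continuous_lor.measurable).pow_const s).ennreal_ofReal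

lemma wt_of_mem (s : ℝ) {y : Fin n → ℝ} (hy : y ∈ cone n) :
    wt s y = ENNReal.ofReal (lor y ^ s) := indicator_of_mem hy _

lemma wt_of_notMem (s : ℝ) {y : Fin n → ℝ} (hy : y ∉ cone n) : wt s y = 0 :=
  indicator_of_notMem hy _

lemma wt_ne_top (s : ℝ) (y : Fin n → ℝ) : wt s y ≠ ⊤ := by
  classical unfold wt; rw [indicator_apply]; split_ifs <;> simp

lemma continuousAt_wt (s : ℝ) {y : Fin n → ℝ} (hy : y ∈ cone n) : ContinuousAt (wt s) y := by
  have h : ContinuousAt (fun y : Fin n → ℝ => ENNReal.ofReal (lor y ^ s)) y :=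
    ENNReal.continuous_ofReal.continuousAt.comp
      (continuous_lor.continuousAt.rpow_const (Or.inl hy.1.ne'))
  refine h.congr ?_
  filter_upwards [isOpen_cone.mem_nhds hy] with x hx using (wt_of_mem s hx).symm

lemma dV_eq (ν : ℝ) : dV n ν =
    (volume : Measure (Fin n → ℂ)).withDensity (fun z => wt (ν - (n : ℝ) / 2) (imP z)) := by
  unfold dV
  rw [← withDensity_indicator measurableSet_tube]
  rfl

/-- Constant in the averaged translation bound along null directions. -/
def wtC (s : ℝ) : ℝ≥0∞ := ENNReal.ofReal (2 * max 1 (1 / (s + 1)))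

lemma lintegral_wt_sub_le {s : ℝ} (hs : -1 < s) {u : Fin n → ℝ} (hu : lor u = 0) (hu0 : 0 < u 0)
    (y : Fin n → ℝ) : ∫⁻ r in Icc (0 : ℝ) 2, wt s (y - r • u) ≤ wtC s * wt s y := by
  by_cases hy : y ∈ cone n
  · have hB : 0 < lorBil u y := lorBil_pos hu.ge hu0 hy
    have key : ∀ r : ℝ, lor (y - r • u) = lor y - (2 * lorBil u y) * r := by
      intro r
      rw [show y - r • u = (-r) • u + y by rw [neg_smul]; abel, lor_add, lor_smul, hu,
        lorBil_smul_left]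
      ring
    calc _ ≤ ∫⁻ r in Icc (0 : ℝ) 2, (if 0 < lor y - (2 * lorBil u y) * r then
            ENNReal.ofReal ((lor y - (2 * lorBil u y) * r) ^ s) else 0) := by
          refine lintegral_mono fun r => ?_
          by_cases h : y - r • u ∈ cone n
          · rw [wt_of_mem s h, key, if_pos]
            rw [← key]; exact h.1
          · rw [wt_of_notMem s h]; exact zero_le
      _ ≤ _ := lintegral_sub_rpow_le hy.1 (by positivity) zero_le_two hs
      _ = _ := by
          rw [wtC, wt_of_mem s hy, ← ENNReal.ofReal_mul (by positivity)]
          congr 1; ring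
  · have : ∀ r ∈ Icc (0 : ℝ) 2, wt s (y - r • u) = 0 := by
      intro r hr
      refine wt_of_notMem s fun h => hy (cone_of_sub (u := r • u) ?_ ?_ h)
      · rw [lor_smul, hu, mul_zero]
      · simpa using mul_nonneg hr.1 hu0.le
    rw [setLIntegral_congr_fun measurableSet_Icc this]
    simp

lemma lintegral_ball_add_im_le (h : ℝ → ℝ≥0∞) (hh : Measurable h) :
    ∫⁻ ζ in Metric.ball (0 : ℂ) 1, h (1 + ζ.im) ≤ 2 * ∫⁻ r in Icc (0 : ℝ) 2, h r := by
  have hsub : Metric.ball (0 : ℂ) 1 ⊆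
      Complex.measurableEquivRealProd ⁻¹' (Icc (-1) 1 ×ˢ Icc (-1) 1) := by
    intro ζ hζ
    rw [Metric.mem_ball, dist_zero_right] at hζ
    have h1 := (abs_re_le_norm ζ).trans hζ.le
    have h2 := (abs_im_le_norm ζ).trans hζ.le
    rw [abs_le] at h1 h2
    exact ⟨h1, h2⟩
  have hshift : ∫⁻ r in Icc (-1 : ℝ) 1, h (1 + r) = ∫⁻ r in Icc (0 : ℝ) 2, h r := by
    have hpre : Icc (-1 : ℝ) 1 = (fun r : ℝ => 1 + r) ⁻¹' Icc (0 : ℝ) 2 := by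
      ext r; simp only [mem_Icc, mem_preimage]
      constructor <;> rintro ⟨h1, h2⟩ <;> constructor <;> linarith
    rw [hpre]
    exact (measurePreserving_add_left volume (1 : ℝ)).setLIntegral_comp_preimage
      measurableSet_Icc hh
  calc _ ≤ ∫⁻ ζ in Complex.measurableEquivRealProd ⁻¹' (Icc (-1) 1 ×ˢ Icc (-1) 1),
        (fun q : ℝ × ℝ => h (1 + q.2)) (Complex.measurableEquivRealProd ζ) :=
          lintegral_mono_set hsub
    _ = ∫⁻ q in Icc (-1 : ℝ) 1 ×ˢ Icc (-1 : ℝ) 1, h (1 + q.2) := by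
        rw [MeasurePreserving.setLIntegral_comp_preimage_emb Complex.volume_preserving_equiv_real_prod
          (MeasurableEquiv.measurableEmbedding _) (fun q : ℝ × ℝ => h (1 + q.2))]
    _ = 2 * ∫⁻ r in Icc (0 : ℝ) 2, h r := by
        rw [Measure.volume_eq_prod, ← Measure.prod_restrict, lintegral_prod _ (by fun_prop)]
        simp only [lintegral_const]
        rw [Measure.restrict_apply_univ, Real.volume_Icc, mul_comm, hshift]
        norm_num

lemma lintegral_ball_wt_sub_le {s : ℝ} (hs : -1 < s) {u : Fin n → ℝ} (hu : lor u = 0)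
    (hu0 : 0 < u 0) (y : Fin n → ℝ) :
    ∫⁻ ζ in Metric.ball (0 : ℂ) 1, wt s (y - (1 + ζ.im) • u) ≤ 2 * wtC s * wt s y := by
  have hm : Measurable fun r : ℝ => wt s (y - r • u) :=
    (measurable_wt s).comp (by fun_prop)
  rw [mul_assoc]
  exact (lintegral_ball_add_im_le _ hm).trans (by gcongr; exact lintegral_wt_sub_le hs hu hu0 y)

end Weight

section MeanValue

variable {n : ℕ} [NeZero n]

lemma diffContOnCl_slice {F : (Fin n → ℂ) → ℂ} (hF : DifferentiableOn ℂ F (tube n))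
    {z v : Fin n → ℂ} (hv : ∀ ζ : ℂ, ‖ζ‖ ≤ 1 → z + ζ • v ∈ tube n) :
    DiffContOnCl ℂ (fun ζ : ℂ => F (z + ζ • v)) (Metric.ball 0 |1|) := by
  refine DifferentiableOn.diffContOnCl ?_
  rw [abs_one, closure_ball _ one_ne_zero]
  intro ζ hζ
  have h1 : DifferentiableAt ℂ F (z + ζ • v) :=
    hF.differentiableAt (isOpen_tube.mem_nhds (hv ζ (by simpa using hζ)))
  exact (h1.comp (f := fun ζ : ℂ => z + ζ • v) ζ (by fun_prop)).differentiableWithinAt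

lemma circle_mean {F : (Fin n → ℂ) → ℂ} (hF : DifferentiableOn ℂ F (tube n))
    {z v : Fin n → ℂ} (hv : ∀ ζ : ℂ, ‖ζ‖ ≤ 1 → z + ζ • v ∈ tube n) :
    (2 * Real.pi)⁻¹ • ∫ θ in (0)..(2 * Real.pi), F (z + exp (θ * I) • v) = F z := by
  have h := DiffContOnCl.circleAverage (diffContOnCl_slice hF hv)
  simp only [zero_smul, add_zero] at h
  rw [← h, Real.circleAverage]
  simp [circleMap]

lemma circle_sub_mean {F : (Fin n → ℂ) → ℂ} (hF : DifferentiableOn ℂ F (tube n))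
    (hm : Measurable F) {p : ℝ} (hp : 1 ≤ p)
    {z v : Fin n → ℂ} (hv : ∀ ζ : ℂ, ‖ζ‖ ≤ 1 → z + ζ • v ∈ tube n) :
    ENNReal.ofReal (2 * Real.pi) * ‖F z‖ₑ ^ p ≤
      ∫⁻ θ in Ioc 0 (2 * Real.pi), ‖F (z + exp (θ * I) • v)‖ₑ ^ p := by
  have h2π : (0 : ℝ) < 2 * Real.pi := by positivity
  set c : ℝ≥0∞ := ENNReal.ofReal (2 * Real.pi) with hc
  have hc0 : c ≠ 0 := by simpa [hc] using Real.pi_pos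
  have hct : c ≠ ⊤ := ENNReal.ofReal_ne_top
  let κ : Measure ℝ := c⁻¹ • volume.restrict (Ioc 0 (2 * Real.pi))
  have hκ : IsProbabilityMeasure κ := ⟨by
    simp only [κ, Measure.smul_apply, Measure.restrict_apply_univ, Real.volume_Ioc, sub_zero,
      smul_eq_mul]
    exact ENNReal.inv_mul_cancel hc0 hct⟩
  let f : ℝ → ℂ := fun θ => F (z + exp (θ * I) • v)
  have hf : Measurable f := hm.comp (by fun_prop)
  have h1 : ‖F z‖ₑ ≤ ∫⁻ θ, ‖f θ‖ₑ ∂κ := by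
    rw [← circle_mean hF hv, enorm_smul, intervalIntegral.integral_of_le h2π.le,
      lintegral_smul_measure, smul_eq_mul]
    have : ‖(2 * Real.pi)⁻¹‖ₑ = c⁻¹ := by
      rw [Real.enorm_of_nonneg (by positivity), ENNReal.ofReal_inv_of_pos h2π]
    rw [this]
    gcongr
    exact enorm_integral_le_lintegral_enorm _
  have h2 : ‖F z‖ₑ ^ p ≤ ∫⁻ θ, ‖f θ‖ₑ ^ p ∂κ := by
    have h3 := eLpNorm_le_eLpNorm_of_exponent_le (p := 1) (q := ENNReal.ofReal p) (μ := κ)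
      (by simpa using hp) hf.aestronglyMeasurable
    rw [eLpNorm_one_eq_lintegral_enorm, eLpNorm_eq_lintegral_rpow_enorm_toReal
      (by simp; linarith) ENNReal.ofReal_ne_top, ENNReal.toReal_ofReal (by linarith)] at h3
    have h4 := ENNReal.rpow_le_rpow (h1.trans h3) (show 0 ≤ p by linarith)
    rwa [← ENNReal.rpow_mul, one_div_mul_cancel (by linarith), ENNReal.rpow_one] at h4
  calc c * ‖F z‖ₑ ^ p ≤ c * ∫⁻ θ, ‖f θ‖ₑ ^ p ∂κ := by gcongr
    _ = _ := by
      rw [lintegral_smul_measure, smul_eq_mul, ← mul_assoc, ENNReal.mul_inv_cancel hc0 hct,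
        one_mul]

/-- Sub-mean value inequality for `|F|^p` with respect to a rotation-invariant measure. -/
lemma sub_mean {V : Type*} [AddCommGroup V] [Module ℂ V] [MeasurableSpace V]
    [MeasurableSMul₂ ℂ V] {κ : Measure V} [SFinite κ]
    (hκ : ∀ c : ℂ, ‖c‖ = 1 → MeasurePreserving (fun v : V => c • v) κ κ)
    (Φ : V →ₗ[ℂ] (Fin n → ℂ)) (hΦ : Measurable Φ)
    {F : (Fin n → ℂ) → ℂ} (hF : DifferentiableOn ℂ F (tube n)) (hm : Measurable F)
    {p : ℝ} (hp : 1 ≤ p) {z : Fin n → ℂ}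
    (hz : ∀ᵐ v ∂κ, ∀ ζ : ℂ, ‖ζ‖ ≤ 1 → z + ζ • Φ v ∈ tube n) :
    κ univ * ‖F z‖ₑ ^ p ≤ ∫⁻ v, ‖F (z + Φ v)‖ₑ ^ p ∂κ := by
  set c : ℝ≥0∞ := ENNReal.ofReal (2 * Real.pi) with hc
  have hc0 : c ≠ 0 := by simpa [hc] using Real.pi_pos
  have hct : c ≠ ⊤ := ENNReal.ofReal_ne_top
  have hmeas : Measurable fun v : V => ‖F (z + Φ v)‖ₑ ^ p :=
    ((hm.comp (hΦ.const_add z)).enorm).pow_const p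
  have hmeas2 : Measurable fun q : V × ℝ => ‖F (z + exp (q.2 * I) • Φ q.1)‖ₑ ^ p := by
    have h1 : Measurable fun q : V × ℝ => Φ (exp (q.2 * I) • q.1) :=
      hΦ.comp (Measurable.smul (by fun_prop) measurable_fst)
    simp only [map_smul] at h1
    exact ((hm.comp (h1.const_add z)).enorm).pow_const p
  have h1 : c * (κ univ * ‖F z‖ₑ ^ p) ≤ c * ∫⁻ v, ‖F (z + Φ v)‖ₑ ^ p ∂κ := by
    calc c * (κ univ * ‖F z‖ₑ ^ p) = ∫⁻ v, c * ‖F z‖ₑ ^ p ∂κ := by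
          rw [lintegral_const]; ring
      _ ≤ ∫⁻ v, (∫⁻ θ in Ioc 0 (2 * Real.pi), ‖F (z + exp (θ * I) • Φ v)‖ₑ ^ p) ∂κ := by
          refine lintegral_mono_ae ?_
          filter_upwards [hz] with v hv using circle_sub_mean hF hm hp hv
      _ = ∫⁻ θ in Ioc 0 (2 * Real.pi), ∫⁻ v, ‖F (z + exp (θ * I) • Φ v)‖ₑ ^ p ∂κ := by
          exact lintegral_lintegral_swap hmeas2.aemeasurable
      _ = ∫⁻ θ in Ioc 0 (2 * Real.pi), ∫⁻ v, ‖F (z + Φ v)‖ₑ ^ p ∂κ := by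
          refine lintegral_congr fun θ => ?_
          have := (hκ (exp (θ * I)) (norm_exp_ofReal_mul_I θ)).lintegral_comp hmeas
          simpa only [map_smul] using this
      _ = _ := by
          rw [setLIntegral_const, Real.volume_Ioc, sub_zero, mul_comm]
  exact (ENNReal.mul_le_mul_iff_right hc0 hct).1 h1

end MeanValue

lemma measurePreserving_smul_complex {c : ℂ} (hc : ‖c‖ = 1) :
    MeasurePreserving (fun v : ℂ => c • v) volume volume := by
  let a : Circle := ⟨c, by simpa [Submonoid.unitSphere] using hc⟩
  exact (rotation a).measurePreserving

lemma measurePreserving_smul_pi {n : ℕ} {c : ℂ} (hc : ‖c‖ = 1) :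
    MeasurePreserving (fun v : Fin n → ℂ => c • v) volume volume :=
  volume_preserving_pi fun _ => measurePreserving_smul_complex hc

lemma MeasureTheory.MeasurePreserving.restrict_ball {V : Type*} [SeminormedAddCommGroup V]
    [NormedSpace ℂ V] [MeasurableSpace V] [OpensMeasurableSpace V] {μ : Measure V} {c : ℂ}
    (hc : ‖c‖ = 1) (h : MeasurePreserving (fun v : V => c • v) μ μ) (r : ℝ) :
    MeasurePreserving (fun v : V => c • v) (μ.restrict (Metric.ball 0 r))
      (μ.restrict (Metric.ball 0 r)) := by
  have := h.restrict_preimage (s := Metric.ball 0 r) Metric.isOpen_ball.measurableSet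
  have h2 : (fun v : V => c • v) ⁻¹' Metric.ball 0 r = Metric.ball 0 r := by
    ext v; simp [norm_smul, hc]
  rwa [h2] at this

section Translation

variable {n : ℕ} [NeZero n]

/-- The vector `e = (1, 0, …, 0)` in `ℂⁿ`. -/
def eC (n : ℕ) [NeZero n] : Fin n → ℂ := Pi.single 0 1

/-- Translation of a function by `t e`. -/
def tr (t : ℂ) (F : (Fin n → ℂ) → ℂ) : (Fin n → ℂ) → ℂ := fun z => F (z + t • eC n)

lemma imP_add (z w : Fin n → ℂ) : imP (z + w) = imP z + imP w := by
  ext i; simp [imP]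

lemma imP_smul_eC (t : ℂ) : imP (t • eC n) = t.im • coneE n := by
  ext i; by_cases h : i = 0
  · subst h; simp [imP, eC, coneE]
  · simp [imP, eC, coneE, h]

lemma add_smul_eC_mem {z : Fin n → ℂ} (hz : z ∈ tube n) {t : ℂ} (ht : 0 ≤ t.im) :
    z + t • eC n ∈ tube n := by
  simp only [tube, mem_ofPred_eq, imP_add, imP_smul_eC]
  rw [add_comm]
  refine add_mem_cone ?_ ?_ hz
  · rw [lor_smul, lor_coneE]; positivity
  · simpa [coneE] using ht

lemma tr_differentiableOn {F : (Fin n → ℂ) → ℂ} (hF : DifferentiableOn ℂ F (tube n)) {t : ℂ}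
    (ht : 0 ≤ t.im) : DifferentiableOn ℂ (tr t F) (tube n) :=
  hF.comp (f := fun z => z + t • eC n) (by fun_prop) fun _ hz => add_smul_eC_mem hz ht

/-- The embedding of real vectors in complex vectors. -/
def toC (y : Fin n → ℝ) : Fin n → ℂ := fun i => (y i : ℂ)

lemma imP_smul_toC (t : ℂ) (y : Fin n → ℝ) : imP (t • toC y) = t.im • y := by
  ext i; simp [imP, toC]

/-- The linear map `(ζ₁, ζ₂) ↦ ζ₁ u₊ + ζ₂ u₋`, with `u₊ + u₋ = ε e`. -/
def nullMap (n : ℕ) [NeZero n] (hn : 3 ≤ n) (ε : ℝ) : ℂ × ℂ →ₗ[ℂ] (Fin n → ℂ) :=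
  (LinearMap.fst ℂ ℂ ℂ).smulRight (toC ((ε / 2) • nullVec n hn 1)) +
    (LinearMap.snd ℂ ℂ ℂ).smulRight (toC ((ε / 2) • nullVec n hn (-1)))

lemma nullMap_apply (hn : 3 ≤ n) (ε : ℝ) (v : ℂ × ℂ) : nullMap n hn ε v =
    v.1 • toC ((ε / 2) • nullVec n hn 1) + v.2 • toC ((ε / 2) • nullVec n hn (-1)) := rfl

lemma imP_nullMap (hn : 3 ≤ n) (ε : ℝ) (v : ℂ × ℂ) : imP (nullMap n hn ε v) =
    v.1.im • (ε / 2) • nullVec n hn 1 + v.2.im • (ε / 2) • nullVec n hn (-1) := by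
  rw [nullMap_apply, imP_add, imP_smul_toC, imP_smul_toC]

lemma smul_coneE_eq (hn : 3 ≤ n) (ε : ℝ) : ε • coneE n =
    (ε / 2) • nullVec n hn 1 + (ε / 2) • nullVec n hn (-1) := by
  rw [← smul_add, nullVec_add, smul_smul]; congr 1; ring

/-- The uniform measure on the product of two unit discs. -/
def bidisc : Measure (ℂ × ℂ) :=
  (volume.restrict (Metric.ball (0 : ℂ) 1)).prod (volume.restrict (Metric.ball (0 : ℂ) 1))

instance : IsFiniteMeasure (volume.restrict (Metric.ball (0 : ℂ) 1)) :=
  ⟨by simpa using measure_ball_lt_top⟩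

instance : IsFiniteMeasure bidisc := by unfold bidisc; infer_instance

lemma bidisc_univ_ne_zero : bidisc univ ≠ 0 := by
  rw [bidisc, ← univ_prod_univ, Measure.prod_prod]
  simp only [Measure.restrict_apply_univ]
  have := (Metric.measure_ball_pos (volume : Measure ℂ) 0 one_pos).ne'
  exact mul_ne_zero this this

lemma bidisc_smul {c : ℂ} (hc : ‖c‖ = 1) :
    MeasurePreserving (fun v : ℂ × ℂ => c • v) bidisc bidisc :=
  ((measurePreserving_smul_complex hc).restrict_ball hc 1).prod
    ((measurePreserving_smul_complex hc).restrict_ball hc 1)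

lemma ae_bidisc : ∀ᵐ v ∂bidisc, ‖v.1‖ < 1 ∧ ‖v.2‖ < 1 := by
  have h : bidisc = volume.restrict (Metric.ball (0 : ℂ) 1 ×ˢ Metric.ball (0 : ℂ) 1) := by
    rw [bidisc, Measure.prod_restrict, Measure.volume_eq_prod]
  rw [h]
  filter_upwards [ae_restrict_mem (Metric.isOpen_ball.prod Metric.isOpen_ball).measurableSet]
    with v hv
  simpa using hv

/-- The bidisc average of translates of the weight. -/
def wtAvg (hn : 3 ≤ n) (s ε : ℝ) (y : Fin n → ℝ) : ℝ≥0∞ :=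
  ∫⁻ v, wt s (y - imP ((ε * I) • eC n + nullMap n hn ε v)) ∂bidisc

lemma imP_shift (hn : 3 ≤ n) (ε : ℝ) (v : ℂ × ℂ) :
    imP ((ε * I) • eC n + nullMap n hn ε v) =
      (1 + v.1.im) • (ε / 2) • nullVec n hn 1 + (1 + v.2.im) • (ε / 2) • nullVec n hn (-1) := by
  rw [imP_add, imP_smul_eC, imP_nullMap]
  simp only [mul_im, ofReal_re, I_im, mul_one, ofReal_im, I_re, mul_zero, add_zero]
  rw [smul_coneE_eq hn]
  simp only [add_smul, one_smul]; abel

lemma measurable_nullMap (hn : 3 ≤ n) (ε : ℝ) : Measurable (nullMap n hn ε) :=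
  (nullMap n hn ε).continuous_of_finiteDimensional.measurable

lemma measurable_imP : Measurable (imP : (Fin n → ℂ) → Fin n → ℝ) := continuous_imP.measurable

lemma wtAvg_le (hn : 3 ≤ n) {s ε : ℝ} (hs : -1 < s) (hε : 0 < ε) (y : Fin n → ℝ) :
    wtAvg hn s ε y ≤ (2 * wtC s) * (2 * wtC s) * wt s y := by
  have hl : ∀ σ : ℝ, σ ^ 2 = 1 → lor ((ε / 2) • nullVec n hn σ) = 0 := fun σ hσ => by
    rw [lor_smul, lor_nullVec hn hσ, mul_zero]
  have h0 : ∀ σ : ℝ, 0 < ((ε / 2) • nullVec n hn σ) 0 := fun σ => by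
    simp [nullVec_zero, hε]
  unfold wtAvg bidisc
  simp only [imP_shift]
  rw [lintegral_prod _ (by
    refine ((measurable_wt s).comp ?_).aemeasurable
    fun_prop)]
  calc _ ≤ ∫⁻ ζ in Metric.ball (0 : ℂ) 1,
        2 * wtC s * wt s (y - (1 + ζ.im) • (ε / 2) • nullVec n hn 1) := by
        refine lintegral_mono fun ζ => ?_
        simp only [← sub_sub]
        exact lintegral_ball_wt_sub_le hs (hl _ (by norm_num)) (h0 _) _
    _ = 2 * wtC s * ∫⁻ ζ in Metric.ball (0 : ℂ) 1,
        wt s (y - (1 + ζ.im) • (ε / 2) • nullVec n hn 1) := by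
        rw [lintegral_const_mul]
        exact (measurable_wt s).comp (by fun_prop)
    _ ≤ _ := by
        rw [mul_assoc (2 * wtC s)]
        gcongr
        exact lintegral_ball_wt_sub_le hs (hl _ (by norm_num)) (h0 _) _

lemma measurable_wtAvg (hn : 3 ≤ n) (s ε : ℝ) :
    Measurable (wtAvg hn s ε : (Fin n → ℝ) → ℝ≥0∞) := by
  unfold wtAvg
  simp only [imP_shift]
  refine Measurable.lintegral_prod_right' (f := fun q : (Fin n → ℝ) × (ℂ × ℂ) =>
    wt s (q.1 - ((1 + q.2.1.im) • (ε / 2) • nullVec n hn 1 +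
      (1 + q.2.2.im) • (ε / 2) • nullVec n hn (-1)))) ?_
  exact (measurable_wt s).comp (by fun_prop)

lemma tendsto_wtAvg (hn : 3 ≤ n) (s : ℝ) {y : Fin n → ℝ} (hy : y ∈ cone n) {ε : ℕ → ℝ}
    (hε : Filter.Tendsto ε Filter.atTop (nhds 0)) :
    Filter.Tendsto (fun k => wtAvg hn s (ε k) y) Filter.atTop
      (nhds (bidisc univ * wt s y)) := by
  have hlim : ∫⁻ _, wt s y ∂bidisc = bidisc univ * wt s y := by
    rw [lintegral_const, mul_comm]
  rw [← hlim]
  unfold wtAvg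
  simp only [imP_shift]
  let g : ℝ → ℂ × ℂ → Fin n → ℝ := fun ε v => y - ((1 + v.1.im) • (ε / 2) • nullVec n hn 1 +
      (1 + v.2.im) • (ε / 2) • nullVec n hn (-1))
  have hcont : Continuous (fun q : ℝ × (ℂ × ℂ) => g q.1 q.2) := by fun_prop
  have hg0 : ∀ v, g 0 v = y := fun v => by simp [g]
  let K : Set (ℂ × ℂ) := Metric.closedBall 0 1 ×ˢ Metric.closedBall 0 1
  have hK : IsCompact K := (isCompact_closedBall _ _).prod (isCompact_closedBall _ _)
  have hev : ∀ᶠ x in nhds y, wt s x < wt s y + 1 :=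
    (continuousAt_wt s hy).eventually_lt continuousAt_const
      (ENNReal.lt_add_right (wt_ne_top s y) one_ne_zero)
  have hunif : ∀ᶠ e in nhds (0 : ℝ), ∀ v ∈ K, wt s (g e v) < wt s y + 1 := by
    refine hK.eventually_forall_of_forall_eventually fun v _ => ?_
    have h1 : Filter.Tendsto (fun q : ℝ × (ℂ × ℂ) => g q.1 q.2) (nhds (0, v)) (nhds y) := by
      have := hcont.tendsto (0, v)
      rwa [show g (0, v).1 (0, v).2 = y from hg0 v] at this
    exact h1.eventually hev
  refine tendsto_lintegral_filter_of_dominated_convergence (fun _ => wt s y + 1) ?_ ?_ ?_ ?_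
  · exact Filter.Eventually.of_forall fun k => (measurable_wt s).comp (by fun_prop)
  · filter_upwards [hε.eventually hunif] with k hk
    filter_upwards [ae_bidisc] with v hv
    exact (hk v ⟨by simpa using hv.1.le, by simpa using hv.2.le⟩).le
  · rw [lintegral_const]
    exact ENNReal.mul_ne_top (by simp [wt_ne_top]) (measure_ne_top _ _)
  · refine ae_of_all _ fun v => ?_
    refine (continuousAt_wt s hy).tendsto.comp ?_
    have h1 : Filter.Tendsto (fun e => g e v) (nhds 0) (nhds (g 0 v)) :=
      (hcont.comp (by fun_prop : Continuous fun e : ℝ => (e, v))).tendsto 0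
    rw [hg0] at h1
    exact h1.comp hε

lemma lintegral_dV {ν : ℝ} {f : (Fin n → ℂ) → ℝ≥0∞} (hf : Measurable f) :
    ∫⁻ z, f z ∂(dV n ν) = ∫⁻ z, f z * wt (ν - (n : ℝ) / 2) (imP z) := by
  have hw : Measurable fun z : Fin n → ℂ => wt (ν - (n : ℝ) / 2) (imP z) :=
    (measurable_wt _).comp measurable_imP
  rw [dV_eq, lintegral_withDensity_eq_lintegral_mul _ hw hf]
  simp only [Pi.mul_apply, mul_comm]

lemma lintegral_shift_mul_wt (hn : 3 ≤ n) (s ε : ℝ) {f : (Fin n → ℂ) → ℝ≥0∞} (hf : Measurable f) :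
    ∫⁻ z, (∫⁻ v, f (z + ((ε * I) • eC n + nullMap n hn ε v)) * wt s (imP z) ∂bidisc) =
      ∫⁻ z, f z * wtAvg hn s ε (imP z) := by
  have hmN := measurable_nullMap (n := n) hn ε
  have hmw : Measurable fun z : Fin n → ℂ => wt s (imP z) := (measurable_wt _).comp measurable_imP
  calc _ = ∫⁻ v, (∫⁻ z, f (z + ((ε * I) • eC n + nullMap n hn ε v)) * wt s (imP z))
          ∂bidisc := by
        refine lintegral_lintegral_swap (Measurable.aemeasurable ?_)
        exact (hf.comp (by fun_prop)).mul (hmw.comp measurable_fst)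
    _ = ∫⁻ v, (∫⁻ z, f z * wt s (imP z - imP ((ε * I) • eC n + nullMap n hn ε v)))
          ∂bidisc := by
        refine lintegral_congr fun v => ?_
        rw [← lintegral_add_right_eq_self (μ := (volume : Measure (Fin n → ℂ)))
          (fun z => f z * wt s (imP z - imP ((ε * I) • eC n + nullMap n hn ε v)))
          ((ε * I) • eC n + nullMap n hn ε v)]
        simp only [imP_add _ ((ε * I) • eC n + nullMap n hn ε v), add_sub_cancel_right]
    _ = ∫⁻ z, (∫⁻ v, f z * wt s (imP z - imP ((ε * I) • eC n + nullMap n hn ε v))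
          ∂bidisc) := by
        refine lintegral_lintegral_swap (Measurable.aemeasurable ?_)
        refine (hf.comp measurable_snd).mul ((measurable_wt s).comp ?_)
        exact (measurable_imP.comp measurable_snd).sub (measurable_imP.comp (by fun_prop))
    _ = _ := by
        refine lintegral_congr fun z => ?_
        rw [lintegral_const_mul]; · rfl
        exact (measurable_wt s).comp ((measurable_imP.comp (by fun_prop)).const_sub _)

/-- Averaging estimate for the translate of a holomorphic function. -/
lemma lintegral_tr_le (hn : 3 ≤ n) (ν : ℝ) {p : ℝ} (hp : 1 ≤ p)
    {F : (Fin n → ℂ) → ℂ} (hF : DifferentiableOn ℂ F (tube n)) (hm : Measurable F)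
    {ε : ℝ} (hε : 0 < ε) :
    bidisc univ * ∫⁻ z, ‖tr (ε * I) F z‖ₑ ^ p ∂(dV n ν) ≤
      ∫⁻ z, ‖F z‖ₑ ^ p * wtAvg hn (ν - (n : ℝ) / 2) ε (imP z) := by
  have hmp : Measurable fun z => ‖F z‖ₑ ^ p := hm.enorm.pow_const p
  have hmt : Measurable fun z => ‖tr (ε * I) F z‖ₑ ^ p := by
    unfold tr; exact (hm.comp (by fun_prop)).enorm.pow_const p
  have hmN := measurable_nullMap (n := n) hn ε
  have hmw : Measurable fun z : Fin n → ℂ => wt (ν - (n : ℝ) / 2) (imP z) :=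
    (measurable_wt _).comp measurable_imP
  rw [lintegral_dV hmt]
  generalize ν - (n : ℝ) / 2 = s at *
  have hprod : Measurable fun z => ‖tr (ε * I) F z‖ₑ ^ p * wt s (imP z) := hmt.mul hmw
  rw [← lintegral_const_mul _ hprod]
  calc _ ≤ ∫⁻ z, (∫⁻ v, ‖F (z + ((ε * I) • eC n + nullMap n hn ε v))‖ₑ ^ p * wt s (imP z)
          ∂bidisc) := by
        refine lintegral_mono fun z => ?_
        by_cases hz : z ∈ tube n
        · simp only [← mul_assoc]
          rw [lintegral_mul_const]
          swap
          · exact hmp.comp (by fun_prop)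
          gcongr
          have h := sub_mean (κ := bidisc) (fun c hc => bidisc_smul hc) (nullMap n hn ε) hmN
            hF hm hp (z := z + (ε * I) • eC n) ?_
          · simpa only [tr, add_assoc] using h
          filter_upwards [ae_bidisc] with v hv ζ hζ
          rw [← map_smul, add_assoc]
          simp only [tube, mem_ofPred_eq]
          rw [imP_add, imP_shift]
          have hpos : ∀ ξ : ℂ, ‖ξ‖ < 1 → 0 ≤ 1 + (ζ * ξ).im := by
            intro ξ hξ
            have h1 := abs_im_le_norm (ζ * ξ)
            rw [norm_mul] at h1
            have h2 : ‖ζ‖ * ‖ξ‖ ≤ 1 := mul_le_one₀ hζ (norm_nonneg _) hξ.le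
            linarith [(abs_le.1 (h1.trans h2)).1]
          have hadd : ∀ (r σ : ℝ) (y : Fin n → ℝ), σ ^ 2 = 1 → 0 ≤ r → y ∈ cone n →
              r • (ε / 2) • nullVec n hn σ + y ∈ cone n := by
            intro r σ y hσ hr hy
            refine add_mem_cone ?_ ?_ hy
            · rw [lor_smul, lor_smul, lor_nullVec hn hσ]; simp
            · simp only [Pi.smul_apply, nullVec_zero, smul_eq_mul]; positivity
          rw [add_comm, add_assoc]
          exact hadd _ _ _ (by norm_num) (hpos _ hv.1)
            (hadd _ _ _ (by norm_num) (hpos _ hv.2) hz)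
        · rw [wt_of_notMem s (show imP z ∉ cone n from hz)]; simp
    _ = _ := lintegral_shift_mul_wt hn s ε hmp

end Translation

section Pairing

variable {α : Type*} [MeasurableSpace α] {μ : Measure α}

/-- The sesquilinear pairing `⟨f, g⟩ = ∫ f \bar g dμ`. -/
def pairing (μ : Measure α) (f g : α → ℂ) : ℂ := ∫ z, f z * (starRingEnd ℂ) (g z) ∂μ

lemma memLp_conj {g : α → ℂ} {q : ℝ≥0∞} (hg : MemLp g q μ) :
    MemLp (fun z => (starRingEnd ℂ) (g z)) q μ := hg.star

lemma integrable_pairing {p q : ℝ} (hpq : p.HolderConjugate q) {f g : α → ℂ}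
    (hf : MemLp f (.ofReal p) μ) (hg : MemLp g (.ofReal q) μ) :
    Integrable (fun z => f z * (starRingEnd ℂ) (g z)) μ := by
  have := hpq.ennrealOfReal
  exact hf.integrable_mul (memLp_conj hg)

lemma eLpNorm_mul_conj_le {p q : ℝ} (hpq : p.HolderConjugate q) {f g : α → ℂ}
    (hf : AEStronglyMeasurable f μ) (hg : AEStronglyMeasurable g μ) :
    eLpNorm (fun z => f z * (starRingEnd ℂ) (g z)) 1 μ ≤
      eLpNorm f (.ofReal p) μ * eLpNorm g (.ofReal q) μ := by
  have := hpq.ennrealOfReal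
  refine (eLpNorm_le_eLpNorm_mul_eLpNorm_of_nnnorm (p := .ofReal p) (q := .ofReal q) hf hg
    (fun a b => a * (starRingEnd ℂ) b) 1 (ae_of_all _ fun z => ?_)).trans ?_
  · simp [nnnorm_mul]
  · simp

lemma enorm_pairing_le {p q : ℝ} (hpq : p.HolderConjugate q) {f g : α → ℂ}
    (hf : AEStronglyMeasurable f μ) (hg : AEStronglyMeasurable g μ) :
    ‖pairing μ f g‖ₑ ≤ eLpNorm f (.ofReal p) μ * eLpNorm g (.ofReal q) μ := by
  refine (enorm_integral_le_lintegral_enorm _).trans ?_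
  rw [← eLpNorm_one_eq_lintegral_enorm]
  exact eLpNorm_mul_conj_le hpq hf hg

lemma norm_pairing_le {p q : ℝ} (hpq : p.HolderConjugate q) {f g : α → ℂ}
    (hf : MemLp f (.ofReal p) μ) (hg : MemLp g (.ofReal q) μ) :
    ‖pairing μ f g‖ ≤ (eLpNorm f (.ofReal p) μ).toReal * (eLpNorm g (.ofReal q) μ).toReal := by
  rw [← ENNReal.toReal_mul, ← toReal_enorm]
  exact ENNReal.toReal_mono (ENNReal.mul_ne_top hf.2.ne hg.2.ne) (enorm_pairing_le hpq hf.1 hg.1)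

lemma conj_pairing (f g : α → ℂ) : (starRingEnd ℂ) (pairing μ f g) = pairing μ g f := by
  unfold pairing
  rw [← integral_conj]
  simp only [map_mul, conj_conj, mul_comm]

lemma pairing_add_left {p q : ℝ} (hpq : p.HolderConjugate q) {f₁ f₂ g : α → ℂ}
    (hf₁ : MemLp f₁ (.ofReal p) μ) (hf₂ : MemLp f₂ (.ofReal p) μ) (hg : MemLp g (.ofReal q) μ) :
    pairing μ (f₁ + f₂) g = pairing μ f₁ g + pairing μ f₂ g := by
  unfold pairing
  rw [← integral_add (integrable_pairing hpq hf₁ hg) (integrable_pairing hpq hf₂ hg)]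
  simp only [Pi.add_apply, add_mul]

lemma pairing_sub_left {p q : ℝ} (hpq : p.HolderConjugate q) {f₁ f₂ g : α → ℂ}
    (hf₁ : MemLp f₁ (.ofReal p) μ) (hf₂ : MemLp f₂ (.ofReal p) μ) (hg : MemLp g (.ofReal q) μ) :
    pairing μ (f₁ - f₂) g = pairing μ f₁ g - pairing μ f₂ g := by
  unfold pairing
  rw [← integral_sub (integrable_pairing hpq hf₁ hg) (integrable_pairing hpq hf₂ hg)]
  simp only [Pi.sub_apply, sub_mul]

lemma pairing_smul_left (c : ℂ) (f g : α → ℂ) :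
    pairing μ (fun z => c * f z) g = c * pairing μ f g := by
  unfold pairing
  rw [← integral_const_mul]
  simp only [mul_assoc]

lemma pairing_sub_right {p q : ℝ} (hpq : p.HolderConjugate q) {f g₁ g₂ : α → ℂ}
    (hf : MemLp f (.ofReal p) μ) (hg₁ : MemLp g₁ (.ofReal q) μ) (hg₂ : MemLp g₂ (.ofReal q) μ) :
    pairing μ f (g₁ - g₂) = pairing μ f g₁ - pairing μ f g₂ := by
  rw [← conj_pairing, pairing_sub_left hpq.symm hg₁ hg₂ hf, map_sub, conj_pairing, conj_pairing]

lemma one_le_ofReal_of_lt {p : ℝ} (hp : 1 ≤ p) : 1 ≤ ENNReal.ofReal p := by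
  rw [← ENNReal.ofReal_one]; exact ENNReal.ofReal_le_ofReal hp

/-- Bounded pointwise convergence in `L^q` implies weak convergence. -/
lemma tendsto_pairing_of_ae {p q : ℝ} (hpq : p.HolderConjugate q) {F : ℕ → α → ℂ} {G h : α → ℂ}
    {M : ℝ≥0∞} (hM : M ≠ ⊤) (hF : ∀ k, AEStronglyMeasurable (F k) μ)
    (hFM : ∀ k, eLpNorm (F k) (.ofReal q) μ ≤ M)
    (hlim : ∀ᵐ z ∂μ, Filter.Tendsto (fun k => F k z) Filter.atTop (nhds (G z)))
    (hh : MemLp h (.ofReal p) μ) :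
    Filter.Tendsto (fun k => pairing μ h (F k)) Filter.atTop (nhds (pairing μ h G)) := by
  have hP1 := one_le_ofReal_of_lt hpq.lt.le
  have hGm : AEStronglyMeasurable G μ := aestronglyMeasurable_of_tendsto_ae _ hF hlim
  have hGM : eLpNorm G (.ofReal q) μ ≤ M := by
    refine (Lp.eLpNorm_lim_le_liminf_eLpNorm hF G hlim).trans ?_
    refine Filter.liminf_le_of_le (by isBoundedDefault) fun b hb => ?_
    obtain ⟨k, hk⟩ := hb.exists
    exact hk.trans (hFM k)
  have hbound : ∀ (s : Set α) (k : ℕ), MeasurableSet s →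
      eLpNorm (s.indicator fun z => h z * (starRingEnd ℂ) (F k z)) 1 μ ≤
      eLpNorm (s.indicator h) (.ofReal p) μ * M := by
    intro s k hs
    have : (s.indicator fun z => h z * (starRingEnd ℂ) (F k z)) =
        fun z => s.indicator h z * (starRingEnd ℂ) (F k z) := by
      ext z; by_cases hz : z ∈ s <;> simp [hz]
    rw [this]
    exact (eLpNorm_mul_conj_le hpq (hh.1.indicator hs) (hF k)).trans (by gcongr; exact hFM k)
  have hsmall : ∀ ε : ℝ, 0 < ε → ∃ δ : ℝ, 0 < δ ∧ ENNReal.ofReal δ * M ≤ ENNReal.ofReal ε := by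
    intro ε hε
    refine ⟨ε / (M.toReal + 1), by positivity, ?_⟩
    rw [← ENNReal.ofReal_toReal hM, ← ENNReal.ofReal_mul (by positivity)]
    refine ENNReal.ofReal_le_ofReal ?_
    rw [ENNReal.toReal_ofReal ENNReal.toReal_nonneg, div_mul_eq_mul_div,
      div_le_iff₀ (by positivity)]
    nlinarith [ENNReal.toReal_nonneg (a := M)]
  refine tendsto_integral_of_L1' _ (hh.1.mul hGm.star) (Filter.Eventually.of_forall fun k =>
    integrable_pairing hpq hh ⟨hF k, (hFM k).trans_lt hM.lt_top⟩) ?_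
  refine tendsto_Lp_of_tendsto_ae le_rfl ENNReal.one_ne_top (fun k => hh.1.mul (hF k).star)
    (memLp_one_iff_integrable.2 <|
      integrable_pairing hpq hh ⟨hGm, hGM.trans_lt hM.lt_top⟩) ?_ ?_ ?_
  · intro ε hε
    obtain ⟨δ, hδ, hδε⟩ := hsmall ε hε
    obtain ⟨η, hη, H⟩ := hh.eLpNorm_indicator_le hP1 ENNReal.ofReal_ne_top hδ
    exact ⟨η, hη, fun k s hs hμ => (hbound s k hs).trans
      ((mul_le_mul_left (H s hs hμ) M).trans hδε)⟩
  · intro ε hε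
    obtain ⟨δ, hδ, hδε⟩ := hsmall ε hε
    obtain ⟨s, hs, hμs, H⟩ := hh.exists_eLpNorm_indicator_compl_lt ENNReal.ofReal_ne_top
      (ENNReal.ofReal_pos.2 hδ).ne'
    refine ⟨s, hμs.ne, fun k => (hbound _ k hs.compl).trans
      ((mul_le_mul_left H.le M).trans (hδε.trans ?_))⟩
    simp
  · filter_upwards [hlim] with z hz
    exact tendsto_const_nhds.mul ((continuous_conj.tendsto _).comp hz)

/-- Duality characterization of the `L^q` norm. -/
lemma eLpNorm_le_of_pairing_le [SigmaFinite μ] {p q : ℝ} (hpq : p.HolderConjugate q) {g : α → ℂ}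
    (hg : AEStronglyMeasurable g μ) {M : ℝ≥0∞}
    (H : ∀ f, (∀ r : ℝ≥0∞, MemLp f r μ) →
      ‖pairing μ f g‖ₑ ≤ M * eLpNorm f (.ofReal p) μ) :
    eLpNorm g (.ofReal q) μ ≤ M := by
  wlog hgm : StronglyMeasurable g generalizing g
  · rw [eLpNorm_congr_ae hg.ae_eq_mk]
    refine this hg.stronglyMeasurable_mk.aestronglyMeasurable (fun f hf => ?_)
      hg.stronglyMeasurable_mk
    convert H f hf using 2
    exact integral_congr_ae (by filter_upwards [hg.ae_eq_mk] with z hz; rw [hz])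
  have hq0 := hpq.symm.pos
  have hp0 := hpq.pos
  let E : ℕ → Set α := fun j => {z | ‖g z‖ ≤ j} ∩ spanningSets μ j
  have hE : ∀ j, MeasurableSet (E j) := fun j =>
    (measurableSet_le hgm.norm.measurable measurable_const).inter (measurableSet_spanningSets μ j)
  have hEmono : Monotone E := fun i j hij => inter_subset_inter
    (fun z (hz : ‖g z‖ ≤ i) => hz.trans (by exact_mod_cast hij : (i : ℝ) ≤ j))
    (monotone_spanningSets μ hij)
  have hEU : ⋃ j, E j = univ := by
    refine eq_univ_of_forall fun z => mem_iUnion.2 ?_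
    obtain ⟨i, hi⟩ := exists_nat_ge ‖g z‖
    obtain ⟨j, hj⟩ := mem_iUnion.1 ((iUnion_spanningSets μ).ge (mem_univ z))
    exact ⟨max i j, hi.trans (by exact_mod_cast le_max_left i j),
      monotone_spanningSets μ (le_max_right i j) hj⟩
  have key : ∀ j, (∫⁻ z in E j, ‖g z‖ₑ ^ q ∂μ) ^ (1 / q) ≤ M := by
    intro j
    let f : α → ℂ := (E j).indicator fun z => ((‖g z‖ ^ (q - 2) : ℝ) : ℂ) * g z
    have hfm : StronglyMeasurable f := by
      refine StronglyMeasurable.indicator (StronglyMeasurable.mul ?_ hgm) (hE j)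
      exact (continuous_ofReal.measurable.comp
        (hgm.norm.measurable.pow_const _)).stronglyMeasurable
    have hq1 : 0 < q - 1 := by linarith [hpq.symm.lt]
    have hfn : ∀ z ∈ E j, ‖f z‖ = ‖g z‖ ^ (q - 1) := by
      intro z hz
      simp only [f, indicator_of_mem hz, norm_mul, norm_real]
      rw [Real.norm_of_nonneg (by positivity)]
      rcases eq_or_lt_of_le (norm_nonneg (g z)) with h | h
      · rw [← h, mul_zero, Real.zero_rpow hq1.ne']
      · rw [show q - 1 = q - 2 + 1 by ring, Real.rpow_add h, Real.rpow_one]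
    have hf0 : ∀ z ∉ E j, f z = 0 := fun z hz => indicator_of_notMem hz _
    have hμE : μ (E j) < ⊤ := (measure_mono inter_subset_right).trans_lt
      (measure_spanningSets_lt_top μ j)
    have hfL : ∀ r : ℝ≥0∞, MemLp f r μ := by
      intro r
      have : f = (E j).indicator f := by
        ext z; by_cases hz : z ∈ E j <;> simp [hz, hf0]
      rw [this, memLp_indicator_iff_restrict (hE j)]
      have : IsFiniteMeasure (μ.restrict (E j)) := ⟨by simpa using hμE⟩
      refine MemLp.of_bound hfm.aestronglyMeasurable ((j : ℝ) ^ (q - 1)) ?_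
      filter_upwards [ae_restrict_mem (hE j)] with z hz
      rw [hfn z hz]
      exact Real.rpow_le_rpow (norm_nonneg _) hz.1 hq1.le
    set A := ∫⁻ z in E j, ‖g z‖ₑ ^ q ∂μ with hA
    have hAtop : A ≠ ⊤ := by
      refine ((setLIntegral_mono_ae (g := fun _ => (ENNReal.ofReal j) ^ q) (by fun_prop)
        (ae_of_all _ fun z hz => ?_)).trans_lt ?_).ne
      · gcongr
        rw [← ofReal_norm]
        exact ENNReal.ofReal_le_ofReal hz.1
      · rw [setLIntegral_const]
        exact ENNReal.mul_lt_top (ENNReal.rpow_lt_top_of_nonneg hq0.le ENNReal.ofReal_ne_top) hμE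
    have hfp : eLpNorm f (.ofReal p) μ = A ^ (1 / p) := by
      rw [eLpNorm_eq_lintegral_rpow_enorm_toReal (by simpa using hp0) ENNReal.ofReal_ne_top,
        ENNReal.toReal_ofReal hp0.le, hA, ← lintegral_indicator (hE j)]
      congr 2
      ext z
      by_cases hz : z ∈ E j
      · rw [indicator_of_mem hz, ← ofReal_norm, hfn z hz, ← ofReal_norm,
          ENNReal.ofReal_rpow_of_nonneg (by positivity) hp0.le,
          ENNReal.ofReal_rpow_of_nonneg (by positivity) hq0.le, ← Real.rpow_mul (norm_nonneg _),
          hpq.symm.sub_one_mul_conj]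
      · rw [indicator_of_notMem hz, hf0 z hz]; simp [hp0]
    have hfg : ‖pairing μ f g‖ₑ = A := by
      have h1 : pairing μ f g = ((∫ z in E j, ‖g z‖ ^ q ∂μ : ℝ) : ℂ) := by
        rw [← integral_complex_ofReal, ← integral_indicator (hE j)]
        refine integral_congr_ae (ae_of_all _ fun z => ?_)
        by_cases hz : z ∈ E j
        · simp only [f, indicator_of_mem hz]
          rw [mul_assoc, mul_conj, normSq_eq_norm_sq, ← ofReal_mul]
          congr 1
          rcases eq_or_lt_of_le (norm_nonneg (g z)) with h | h
          · rw [← h, Real.zero_rpow hq0.ne']; simp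
          · rw [← Real.rpow_natCast, ← Real.rpow_add h]; congr 1; push_cast; ring
        · simp [hf0 z hz, hz]
      rw [h1, ← ofReal_norm, norm_real, Real.norm_of_nonneg
        (integral_nonneg fun z => by positivity), ofReal_integral_eq_lintegral_ofReal]
      · refine lintegral_congr fun z => ?_
        rw [← ofReal_norm, ENNReal.ofReal_rpow_of_nonneg (norm_nonneg _) hq0.le]
      · refine ⟨(hgm.norm.measurable.pow_const q).aestronglyMeasurable, ?_⟩
        rw [hasFiniteIntegral_iff_enorm]
        convert hAtop.lt_top using 1
        refine lintegral_congr fun z => ?_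
        rw [← ofReal_norm, ← ofReal_norm, Real.norm_of_nonneg (by positivity),
          ENNReal.ofReal_rpow_of_nonneg (norm_nonneg _) hq0.le]
      · exact ae_of_all _ fun z => by positivity
    have hH := H f hfL
    rw [hfg, hfp] at hH
    rcases eq_or_ne A 0 with h0 | h0
    · rw [h0, ENNReal.zero_rpow_of_pos (by positivity)]; exact bot_le
    have h2 : A ^ (1 / q) * A ^ (1 / p) = A := by
      rw [← ENNReal.rpow_add _ _ h0 hAtop, one_div, one_div, add_comm, hpq.inv_add_inv_eq_one,
        ENNReal.rpow_one]
    have h3 : A ^ (1 / p) ≠ 0 := by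
      simp [ENNReal.rpow_eq_zero_iff, h0, hAtop]
    have h4 : A ^ (1 / p) ≠ ⊤ := ENNReal.rpow_ne_top_of_nonneg (by positivity) hAtop
    exact (ENNReal.mul_le_mul_iff_left h3 h4).1 (h2.le.trans hH)
  rw [eLpNorm_eq_lintegral_rpow_enorm_toReal (by simpa using hq0) ENNReal.ofReal_ne_top,
    ENNReal.toReal_ofReal hq0.le, one_div, ENNReal.rpow_inv_le_iff hq0, ← setLIntegral_univ, ← hEU,
    setLIntegral_iUnion_of_directed _ hEmono.directed_le]
  exact iSup_le fun j => (ENNReal.rpow_inv_le_iff hq0).1 (one_div q ▸ key j)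

/-- Pointwise convergence without loss of mass implies strong convergence. -/
lemma tendsto_lintegral_sub_rpow {p : ℝ} (hp : 1 ≤ p) {F : ℕ → α → ℂ} {G : α → ℂ}
    {A : ℕ → ℝ≥0∞} (hF : ∀ k, AEStronglyMeasurable (F k) μ)
    (hlim : ∀ᵐ z ∂μ, Filter.Tendsto (fun k => F k z) Filter.atTop (nhds (G z)))
    (hG : ∫⁻ z, ‖G z‖ₑ ^ p ∂μ ≠ ⊤) (hFA : ∀ k, ∫⁻ z, ‖F k z‖ₑ ^ p ∂μ ≤ A k)
    (hA : Filter.Tendsto A Filter.atTop (nhds (∫⁻ z, ‖G z‖ₑ ^ p ∂μ))) :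
    Filter.Tendsto (fun k => ∫⁻ z, ‖F k z - G z‖ₑ ^ p ∂μ) Filter.atTop (nhds 0) := by
  set c : ℝ≥0∞ := 2 ^ (p - 1) with hc
  have hctop : c ≠ ⊤ := ENNReal.rpow_ne_top_of_nonneg (by linarith) (by simp)
  set J := ∫⁻ z, ‖G z‖ₑ ^ p ∂μ with hJ
  have hp0 : 0 < p := by linarith
  have hGm : AEStronglyMeasurable G μ := aestronglyMeasurable_of_tendsto_ae _ hF hlim
  let g : ℕ → α → ℝ≥0∞ := fun k z => c * (‖F k z‖ₑ ^ p + ‖G z‖ₑ ^ p)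
  let h : ℕ → α → ℝ≥0∞ := fun k z => ‖F k z - G z‖ₑ ^ p
  have hFm : ∀ k, AEMeasurable (fun z => ‖F k z‖ₑ ^ p) μ := fun k => (hF k).enorm.pow_const p
  have hgm : ∀ k, AEMeasurable (g k) μ := fun k =>
    ((hFm k).add (hGm.enorm.pow_const p)).const_mul c
  have hhm : ∀ k, AEMeasurable (h k) μ := fun k => ((hF k).sub hGm).enorm.pow_const p
  have hadd : ∀ u v : α → ℝ≥0∞, AEMeasurable u μ → AEMeasurable v μ →
      ∫⁻ z, c * (u z + v z) ∂μ = c * ((∫⁻ z, u z ∂μ) + ∫⁻ z, v z ∂μ) := by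
    intro u v hu hv
    rw [← lintegral_add_left' hu]
    exact lintegral_const_mul'' _ (hu.add hv)
  have hhg : ∀ k z, h k z ≤ g k z := fun k z =>
    (ENNReal.rpow_le_rpow enorm_sub_le hp0.le).trans
      (ENNReal.rpow_add_le_mul_rpow_add_rpow _ _ hp)
  have hsum : ∀ k, (∫⁻ z, h k z ∂μ) + ∫⁻ z, (g k z - h k z) ∂μ ≤ c * (A k + J) := by
    intro k
    rw [← lintegral_add_left' (hhm k)]
    calc _ = ∫⁻ z, g k z ∂μ := lintegral_congr fun z => add_tsub_cancel_of_le (hhg k z)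
      _ = c * ((∫⁻ z, ‖F k z‖ₑ ^ p ∂μ) + J) :=
        hadd _ _ (hFm k) (hGm.enorm.pow_const p)
      _ ≤ _ := by gcongr; exact hFA k
  have hB : Filter.Tendsto (fun k => c * (A k + J)) Filter.atTop (nhds (c * (J + J))) :=
    ENNReal.Tendsto.const_mul (hA.add_const J) (Or.inr hctop)
  have hBtop : c * (J + J) ≠ ⊤ := ENNReal.mul_ne_top hctop (ENNReal.add_ne_top.2 ⟨hG, hG⟩)
  have hfatou : c * (J + J) ≤
      Filter.liminf (fun k => ∫⁻ z, (g k z - h k z) ∂μ) Filter.atTop := by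
    refine le_trans (le_of_eq ?_) (lintegral_liminf_le' fun k => (hgm k).sub (hhm k))
    rw [hJ, ← hadd _ _ (hGm.enorm.pow_const p) (hGm.enorm.pow_const p)]
    refine lintegral_congr_ae ?_
    filter_upwards [hlim] with z hz
    refine (Filter.Tendsto.liminf_eq ?_).symm
    have h1 : Filter.Tendsto (fun k => g k z) Filter.atTop
        (nhds (c * (‖G z‖ₑ ^ p + ‖G z‖ₑ ^ p))) :=
      ENNReal.Tendsto.const_mul
        (((ENNReal.continuous_rpow_const.tendsto _).comp hz.enorm).add_const _) (Or.inr hctop)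
    have h2 : Filter.Tendsto (fun k => h k z) Filter.atTop (nhds 0) := by
      have h3 := (ENNReal.continuous_rpow_const (y := p)).tendsto ‖G z - G z‖ₑ |>.comp
        (hz.sub_const (G z)).enorm
      rw [sub_self, enorm_zero, ENNReal.zero_rpow_of_pos hp0] at h3
      exact h3
    simpa using ENNReal.Tendsto.sub h1 h2 (Or.inr ENNReal.zero_ne_top)
  rcases eq_or_ne (c * (J + J)) 0 with h0 | h0
  · rw [h0] at hB
    exact tendsto_of_tendsto_of_tendsto_of_le_of_le tendsto_const_nhds hB (fun _ => bot_le)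
      fun k => le_self_add.trans (hsum k)
  refine ENNReal.tendsto_nhds_zero.2 fun ε hε => ?_
  rcases eq_or_ne ε ⊤ with rfl | hεt
  · simp
  have hε2 : 0 < ε / 2 := ENNReal.half_pos hε.ne'
  have e1 := Filter.eventually_lt_of_lt_liminf
    ((ENNReal.sub_lt_self hBtop h0 hε2.ne').trans_le hfatou)
  have e2 := hB.eventually_lt_const (ENNReal.lt_add_right hBtop hε2.ne')
  filter_upwards [e1, e2] with k h1 h2
  have h3 := hsum k
  have h4 : c * (J + J) ≤ (∫⁻ z, (g k z - h k z) ∂μ) + ε / 2 := tsub_le_iff_right.1 h1.le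
  have h5 : ∫⁻ z, (g k z - h k z) ∂μ ≠ ⊤ :=
    ((le_add_self.trans h3).trans_lt (h2.trans
      (ENNReal.add_lt_top.2 ⟨hBtop.lt_top, (ENNReal.half_lt_self hε.ne' hεt).trans
        hεt.lt_top⟩))).ne
  refine (ENNReal.add_le_add_iff_right h5).1 ?_
  calc _ ≤ c * (A k + J) := h3
    _ ≤ c * (J + J) + ε / 2 := h2.le
    _ ≤ (∫⁻ z, (g k z - h k z) ∂μ) + ε / 2 + ε / 2 := by gcongr
    _ = ε + ∫⁻ z, (g k z - h k z) ∂μ := by rw [add_assoc, ENNReal.add_halves, add_comm]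

end Pairing

section WeightedMeasure

variable {n : ℕ} [NeZero n]

instance (ν : ℝ) : SigmaFinite (dV n ν) := by
  rw [dV_eq]
  exact SigmaFinite.withDensity_of_ne_top (ae_of_all _ fun _ => wt_ne_top _ _)

lemma dV_absolutelyContinuous (ν : ℝ) :
    dV n ν ≪ (volume : Measure (Fin n → ℂ)).restrict (tube n) :=
  withDensity_absolutelyContinuous _ _

lemma ae_mem_tube (ν : ℝ) : ∀ᵐ z ∂(dV n ν), z ∈ tube n :=
  (dV_absolutelyContinuous ν).ae_le (ae_restrict_mem measurableSet_tube)

lemma aestronglyMeasurable_dV {ν : ℝ} {F : (Fin n → ℂ) → ℂ}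
    (hF : DifferentiableOn ℂ F (tube n)) : AEStronglyMeasurable F (dV n ν) :=
  (hF.continuousOn.aestronglyMeasurable measurableSet_tube).mono_ac (dV_absolutelyContinuous ν)

lemma lpInt_eq {p ν : ℝ} (hp : 0 ≤ p) (F : (Fin n → ℂ) → ℂ) :
    lpInt n p ν F = ∫⁻ z, ‖F z‖ₑ ^ p ∂(dV n ν) := by
  refine lintegral_congr fun z => ?_
  rw [← ofReal_norm, ENNReal.ofReal_rpow_of_nonneg (norm_nonneg _) hp]

lemma lpNorm_eq {p ν : ℝ} (hp : 0 < p) (F : (Fin n → ℂ) → ℂ) :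
    lpNorm n p ν F = eLpNorm F (.ofReal p) (dV n ν) := by
  rw [_root_.lpNorm, lpInt_eq hp.le, eLpNorm_eq_lintegral_rpow_enorm_toReal (by simpa using hp)
    ENNReal.ofReal_ne_top, ENNReal.toReal_ofReal hp.le]

lemma lpInt_lt_top_iff {p ν : ℝ} (hp : 0 < p) (F : (Fin n → ℂ) → ℂ) :
    lpInt n p ν F < ⊤ ↔ eLpNorm F (.ofReal p) (dV n ν) < ⊤ := by
  rw [← lpNorm_eq hp, _root_.lpNorm, one_div, ENNReal.rpow_lt_top_iff_of_pos (inv_pos.2 hp)]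

lemma memA_iff {p ν : ℝ} (hp : 0 < p) (F : (Fin n → ℂ) → ℂ) :
    memA n p ν F ↔ DifferentiableOn ℂ F (tube n) ∧ MemLp F (.ofReal p) (dV n ν) :=
  and_congr_right fun h => by
    rw [lpInt_lt_top_iff hp, MemLp, and_iff_right (aestronglyMeasurable_dV h)]

lemma measurable_indicator_tube {F : (Fin n → ℂ) → ℂ} (hF : DifferentiableOn ℂ F (tube n)) :
    Measurable ((tube n).indicator F) := by
  classical
  rw [← piecewise_eq_indicator]
  exact hF.continuousOn.measurable_piecewise continuousOn_const measurableSet_tube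

lemma differentiableOn_indicator_tube {F : (Fin n → ℂ) → ℂ}
    (hF : DifferentiableOn ℂ F (tube n)) : DifferentiableOn ℂ ((tube n).indicator F) (tube n) :=
  hF.congr fun _ hz => indicator_of_mem hz F

lemma lintegral_tr_le' (hn : 3 ≤ n) (ν : ℝ) {p : ℝ} (hp : 1 ≤ p)
    {F : (Fin n → ℂ) → ℂ} (hF : DifferentiableOn ℂ F (tube n)) {ε : ℝ} (hε : 0 < ε) :
    bidisc univ * ∫⁻ z, ‖tr (ε * I) F z‖ₑ ^ p ∂(dV n ν) ≤
      ∫⁻ z, ‖(tube n).indicator F z‖ₑ ^ p * wtAvg hn (ν - (n : ℝ) / 2) ε (imP z) := by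
  refine le_trans (le_of_eq ?_) (lintegral_tr_le hn ν hp (differentiableOn_indicator_tube hF)
    (measurable_indicator_tube hF) hε)
  congr 1
  refine lintegral_congr_ae ?_
  filter_upwards [ae_mem_tube ν] with z hz
  have hz' : z + (ε * I : ℂ) • eC n ∈ tube n := add_smul_eC_mem hz (by simpa using hε.le)
  rw [tr, tr, indicator_of_mem hz']

lemma lintegral_indicator_tube {p ν : ℝ} {F : (Fin n → ℂ) → ℂ}
    (hF : DifferentiableOn ℂ F (tube n)) :
    ∫⁻ z, ‖(tube n).indicator F z‖ₑ ^ p * wt (ν - (n : ℝ) / 2) (imP z) =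
      ∫⁻ z, ‖F z‖ₑ ^ p ∂(dV n ν) := by
  rw [← lintegral_dV (f := fun z => ‖(tube n).indicator F z‖ₑ ^ p)
    ((measurable_indicator_tube hF).enorm.pow_const p)]
  refine lintegral_congr_ae ?_
  filter_upwards [ae_mem_tube ν] with z hz
  rw [indicator_of_mem hz]

lemma wtC_sq_ne_top (s : ℝ) : (2 * wtC s) * (2 * wtC s) ≠ ⊤ := by
  have : 2 * wtC s ≠ ⊤ := ENNReal.mul_ne_top (by simp) ENNReal.ofReal_ne_top
  exact ENNReal.mul_ne_top this this

/-- The constant in the translation estimate. -/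
def trC (ν : ℝ) (n : ℕ) : ℝ≥0∞ :=
  (bidisc univ)⁻¹ * ((2 * wtC (ν - (n : ℝ) / 2)) * (2 * wtC (ν - (n : ℝ) / 2)))

lemma trC_ne_top (ν : ℝ) (n : ℕ) : trC ν n ≠ ⊤ := by
  exact ENNReal.mul_ne_top (ENNReal.inv_ne_top.2 bidisc_univ_ne_zero) (wtC_sq_ne_top _)

lemma lintegral_tr_le_mul (hn : 3 ≤ n) {ν : ℝ} (hν : (n : ℝ) / 2 - 1 < ν) {p : ℝ} (hp : 1 ≤ p)
    {F : (Fin n → ℂ) → ℂ} (hF : DifferentiableOn ℂ F (tube n)) {ε : ℝ} (hε : 0 < ε) :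
    ∫⁻ z, ‖tr (ε * I) F z‖ₑ ^ p ∂(dV n ν) ≤ trC ν n * ∫⁻ z, ‖F z‖ₑ ^ p ∂(dV n ν) := by
  have hb : bidisc univ ≠ ⊤ := measure_ne_top _ _
  have h := lintegral_tr_le' hn ν hp hF hε
  have hs : -1 < ν - (n : ℝ) / 2 := by linarith
  have h2 : ∫⁻ z, ‖(tube n).indicator F z‖ₑ ^ p * wtAvg hn (ν - (n : ℝ) / 2) ε (imP z) ≤
      (2 * wtC (ν - (n : ℝ) / 2)) * (2 * wtC (ν - (n : ℝ) / 2)) *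
        ∫⁻ z, ‖F z‖ₑ ^ p ∂(dV n ν) := by
    rw [← lintegral_indicator_tube hF, ← lintegral_const_mul']
    · refine lintegral_mono fun z => ?_
      refine (mul_le_mul_right (wtAvg_le hn hs hε (imP z)) _).trans (le_of_eq ?_)
      ring
    · exact wtC_sq_ne_top _
  calc _ = (bidisc univ)⁻¹ * (bidisc univ * ∫⁻ z, ‖tr (ε * I) F z‖ₑ ^ p ∂(dV n ν)) := by
        rw [← mul_assoc, ENNReal.inv_mul_cancel bidisc_univ_ne_zero hb, one_mul]
    _ ≤ (bidisc univ)⁻¹ * _ := mul_le_mul_right (h.trans h2) _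
    _ = _ := by rw [trC, ← mul_assoc]

lemma eLpNorm_tr_le (hn : 3 ≤ n) {ν : ℝ} (hν : (n : ℝ) / 2 - 1 < ν) {p : ℝ} (hp : 1 ≤ p)
    {F : (Fin n → ℂ) → ℂ} (hF : DifferentiableOn ℂ F (tube n)) {ε : ℝ} (hε : 0 < ε) :
    eLpNorm (tr (ε * I) F) (.ofReal p) (dV n ν) ≤
      trC ν n ^ (1 / p) * eLpNorm F (.ofReal p) (dV n ν) := by
  have hp0 : 0 < p := by linarith
  rw [← lpNorm_eq hp0, ← lpNorm_eq hp0, _root_.lpNorm, _root_.lpNorm, lpInt_eq hp0.le, lpInt_eq hp0.le,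
    ← ENNReal.mul_rpow_of_nonneg _ _ (by positivity)]
  exact ENNReal.rpow_le_rpow (lintegral_tr_le_mul hn hν hp hF hε) (by positivity)

lemma exists_tendsto_lintegral_tr_le (hn : 3 ≤ n) {ν : ℝ} (hν : (n : ℝ) / 2 - 1 < ν) {p : ℝ}
    (hp : 1 ≤ p) {F : (Fin n → ℂ) → ℂ} (hF : DifferentiableOn ℂ F (tube n))
    (hFp : ∫⁻ z, ‖F z‖ₑ ^ p ∂(dV n ν) ≠ ⊤) {ε : ℕ → ℝ} (hε : ∀ k, 0 < ε k)
    (hε0 : Filter.Tendsto ε Filter.atTop (nhds 0)) :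
    ∃ A : ℕ → ℝ≥0∞, (∀ k, ∫⁻ z, ‖tr (ε k * I) F z‖ₑ ^ p ∂(dV n ν) ≤ A k) ∧
      Filter.Tendsto A Filter.atTop (nhds (∫⁻ z, ‖F z‖ₑ ^ p ∂(dV n ν))) := by
  have hb : bidisc univ ≠ ⊤ := measure_ne_top _ _
  have hs : -1 < ν - (n : ℝ) / 2 := by linarith
  have hp0 : 0 < p := by linarith
  have hC := wtC_sq_ne_top (ν - (n : ℝ) / 2)
  have hm : Measurable fun z => ‖(tube n).indicator F z‖ₑ ^ p :=
    (measurable_indicator_tube hF).enorm.pow_const p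
  refine ⟨fun k => (bidisc univ)⁻¹ * ∫⁻ z, ‖(tube n).indicator F z‖ₑ ^ p *
    wtAvg hn (ν - (n : ℝ) / 2) (ε k) (imP z), fun k => ?_, ?_⟩
  · calc _ = (bidisc univ)⁻¹ * (bidisc univ * ∫⁻ z, ‖tr (ε k * I) F z‖ₑ ^ p ∂(dV n ν)) := by
          rw [← mul_assoc, ENNReal.inv_mul_cancel bidisc_univ_ne_zero hb, one_mul]
      _ ≤ _ := mul_le_mul_right (lintegral_tr_le' hn ν hp hF (hε k)) _
  have key : Filter.Tendsto (fun k => ∫⁻ z, ‖(tube n).indicator F z‖ₑ ^ p *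
      wtAvg hn (ν - (n : ℝ) / 2) (ε k) (imP z)) Filter.atTop
      (nhds (∫⁻ z, ‖(tube n).indicator F z‖ₑ ^ p *
        (bidisc univ * wt (ν - (n : ℝ) / 2) (imP z)))) := by
    refine tendsto_lintegral_of_dominated_convergence
      (fun z => (2 * wtC (ν - (n : ℝ) / 2)) * (2 * wtC (ν - (n : ℝ) / 2)) *
        (‖(tube n).indicator F z‖ₑ ^ p * wt (ν - (n : ℝ) / 2) (imP z))) ?_ ?_ ?_ ?_
    · exact fun k => hm.mul ((measurable_wtAvg hn _ _).comp measurable_imP)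
    · refine fun k => ae_of_all _ fun z => ?_
      refine (mul_le_mul_right (wtAvg_le hn hs (hε k) (imP z)) _).trans (le_of_eq ?_)
      ring
    · rw [lintegral_const_mul' _ _ hC, lintegral_indicator_tube hF]
      exact ENNReal.mul_ne_top hC hFp
    · refine ae_of_all _ fun z => ?_
      by_cases hz : z ∈ tube n
      · refine ENNReal.Tendsto.const_mul (tendsto_wtAvg hn _ hz hε0) (Or.inr ?_)
        exact ENNReal.rpow_ne_top_of_nonneg hp0.le enorm_ne_top
      · simp [indicator_of_notMem hz, hp0]
  have := ENNReal.Tendsto.const_mul (a := (bidisc univ)⁻¹) key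
    (Or.inr (ENNReal.inv_ne_top.2 bidisc_univ_ne_zero))
  convert this using 2
  simp only [mul_left_comm _ (bidisc univ)]
  rw [lintegral_const_mul' _ _ hb, ← mul_assoc, ENNReal.inv_mul_cancel bidisc_univ_ne_zero hb,
    one_mul, lintegral_indicator_tube hF]

end WeightedMeasure

section SupBound

variable {n : ℕ} [NeZero n]

lemma lorBil_coneE (y : Fin n → ℝ) : lorBil (coneE n) y = y 0 := by
  simp [lorBil, coneE, Pi.single_apply]; ring

lemma lor_smul_coneE_add_ge {ε : ℝ} {y : Fin n → ℝ}
    (hy : ∀ i, |y i| ≤ ε / (8 * n)) : ε ^ 2 / 4 ≤ lor (ε • coneE n + y) ∧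
      |y 0| ≤ ε / 8 := by
  have hn1 : (1 : ℝ) ≤ n := by exact_mod_cast NeZero.one_le
  have hε : 0 ≤ ε := by
    have := (abs_nonneg _).trans (hy 0)
    by_contra h
    exact absurd (div_neg_of_neg_of_pos (not_le.1 h) (by positivity : (0 : ℝ) < 8 * n)) (by linarith)
  have h0 : |y 0| ≤ ε / 8 := (hy 0).trans (by gcongr; linarith)
  have hsum : ∑ i, y i ^ 2 ≤ ε ^ 2 / 64 := by
    calc ∑ i, y i ^ 2 ≤ ∑ _i : Fin n, (ε / (8 * n)) ^ 2 := by
          refine Finset.sum_le_sum fun i _ => ?_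
          rw [← sq_abs]; gcongr; exact hy i
      _ = ε ^ 2 / 64 / n := by simp; field_simp; norm_num
      _ ≤ _ := div_le_self (by positivity) hn1
  refine ⟨?_, h0⟩
  rw [lor_add, lor_smul, lorBil_smul_left, lorBil_coneE, lor_coneE]
  have h1 : - (ε ^ 2 / 64) ≤ lor y := by simp only [lor]; nlinarith [sq_nonneg (y 0)]
  nlinarith [(abs_le.1 h0).1]

/-- The constant in the pointwise lower bound for the weight. -/
def wtLow (s ε : ℝ) : ℝ := min ((ε ^ 2 / 4) ^ s) ((1 + 2 * ε) ^ 2)⁻¹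

lemma wtLow_pos (s : ℝ) {ε : ℝ} (hε : 0 < ε) : 0 < wtLow s ε :=
  lt_min (Real.rpow_pos_of_pos (by positivity) s) (by positivity)

lemma wtLow_le_wt {s ε : ℝ} (hs : -1 < s) (hε : 0 < ε) {y : Fin n → ℝ} (hy : y ∈ cone n)
    {η : Fin n → ℝ} (hη : ∀ i, |η i| ≤ ε / (8 * n)) {r : ℝ} (hr : y 0 ≤ r) :
    y + ε • coneE n + η ∈ cone n ∧
      ENNReal.ofReal (wtLow s ε * ((1 + r) ^ 2)⁻¹) ≤ wt s (y + ε • coneE n + η) := by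
  obtain ⟨h1, h2⟩ := lor_smul_coneE_add_ge hη
  have hr0 : 0 < r := hy.2.trans_le hr
  have h0 : 0 ≤ (ε • coneE n + η) 0 := by
    simp [coneE]; linarith [(abs_le.1 h2).1]
  have hre : y + ε • coneE n + η = (ε • coneE n + η) + y := by abel
  have hmem : y + ε • coneE n + η ∈ cone n := by
    rw [hre]; exact add_mem_cone (by linarith [sq_nonneg ε]) h0 hy
  refine ⟨hmem, ?_⟩
  rw [wt_of_mem s hmem]
  refine ENNReal.ofReal_le_ofReal ?_
  have hlow : ε ^ 2 / 4 ≤ lor (y + ε • coneE n + η) := by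
    rw [hre]; linarith [le_lor_add (by linarith [sq_nonneg ε]) h0 hy, hy.1]
  have hr1 : (1 : ℝ) ≤ (1 + r) ^ 2 := by nlinarith
  rcases le_or_gt 0 s with h | h
  · calc wtLow s ε * ((1 + r) ^ 2)⁻¹ ≤ (ε ^ 2 / 4) ^ s * 1 := by
          gcongr
          · exact min_le_left _ _
          · exact inv_le_one_of_one_le₀ hr1
      _ ≤ _ := by rw [mul_one]; exact Real.rpow_le_rpow (by positivity) hlow h
  · have hup : lor (y + ε • coneE n + η) ≤ (1 + 2 * ε) ^ 2 * (1 + r) ^ 2 := by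
      refine (lor_le_sq _).trans ?_
      rw [← mul_pow]
      have : (y + ε • coneE n + η) 0 ≤ (1 + 2 * ε) * (1 + r) := by
        simp [coneE]
        nlinarith [(abs_le.1 h2).2]
      exact pow_le_pow_left₀ hmem.2.le this 2
    have hB : 1 ≤ (1 + 2 * ε) ^ 2 * (1 + r) ^ 2 :=
      one_le_mul_of_one_le_of_one_le (by nlinarith) hr1
    calc wtLow s ε * ((1 + r) ^ 2)⁻¹ ≤ ((1 + 2 * ε) ^ 2)⁻¹ * ((1 + r) ^ 2)⁻¹ := by
          gcongr
          exact min_le_right _ _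
      _ = ((1 + 2 * ε) ^ 2 * (1 + r) ^ 2) ^ (-1 : ℝ) := by
          rw [Real.rpow_neg_one, mul_inv]
      _ ≤ ((1 + 2 * ε) ^ 2 * (1 + r) ^ 2) ^ s := Real.rpow_le_rpow_of_exponent_le hB hs.le
      _ ≤ _ := Real.rpow_le_rpow_of_nonpos hmem.1 hup h.le

lemma abs_im_apply_le_norm (z : Fin n → ℂ) (i : Fin n) : |imP z i| ≤ ‖z‖ :=
  (abs_im_le_norm _).trans (norm_le_pi_norm z i)

/-- The constant in the pointwise bound for functions in the Bergman space. -/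
def supC (n : ℕ) (s ε : ℝ) : ℝ≥0∞ :=
  (volume (Metric.ball (0 : Fin n → ℂ) (ε / (8 * n))))⁻¹ * ENNReal.ofReal (wtLow s ε)⁻¹

lemma supC_ne_top (n : ℕ) [NeZero n] (s : ℝ) {ε : ℝ} (hε : 0 < ε) : supC n s ε ≠ ⊤ := by
  refine ENNReal.mul_ne_top (ENNReal.inv_ne_top.2 ?_) ENNReal.ofReal_ne_top
  have : 0 < n := Nat.pos_of_ne_zero (NeZero.ne n)
  exact (Metric.measure_ball_pos _ _ (by positivity)).ne'

lemma enorm_tr_rpow_le {ν : ℝ} (hν : (n : ℝ) / 2 - 1 < ν) {p : ℝ} (hp : 1 ≤ p)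
    {F : (Fin n → ℂ) → ℂ} (hF : DifferentiableOn ℂ F (tube n)) {ε : ℝ} (hε : 0 < ε)
    {z : Fin n → ℂ} (hz : z ∈ tube n) :
    ‖tr (ε * I) F z‖ₑ ^ p ≤ supC n (ν - (n : ℝ) / 2) ε * ENNReal.ofReal ((1 + ‖z‖) ^ 2) *
      ∫⁻ w, ‖F w‖ₑ ^ p ∂(dV n ν) := by
  have hs : -1 < ν - (n : ℝ) / 2 := by linarith
  have hn0 : 0 < n := Nat.pos_of_ne_zero (NeZero.ne n)
  rw [← lintegral_indicator_tube hF]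
  set s := ν - (n : ℝ) / 2 with hsdef
  set ρ := ε / (8 * n) with hρ
  have hρ0 : 0 < ρ := by positivity
  have hF' := differentiableOn_indicator_tube hF
  have hm := measurable_indicator_tube hF
  set G := (tube n).indicator F with hG
  set z' := z + (ε * I : ℂ) • eC n with hz'
  set κ : Measure (Fin n → ℂ) := volume.restrict (Metric.ball 0 ρ) with hκ
  have hb0 : volume (Metric.ball (0 : Fin n → ℂ) ρ) ≠ 0 :=
    (Metric.measure_ball_pos _ _ hρ0).ne'
  have hbt : volume (Metric.ball (0 : Fin n → ℂ) ρ) ≠ ⊤ := measure_ball_lt_top.ne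
  have himz' : ∀ w : Fin n → ℂ, imP (z' + w) = imP z + ε • coneE n + imP w := by
    intro w; rw [hz', imP_add, imP_add, imP_smul_eC]; simp
  have hη : ∀ w : Fin n → ℂ, ‖w‖ ≤ ρ → ∀ i, |imP w i| ≤ ρ :=
    fun w hw i => (abs_im_apply_le_norm w i).trans hw
  have hr : imP z 0 ≤ ‖z‖ := (le_abs_self _).trans (abs_im_apply_le_norm z 0)
  have hmean := sub_mean (κ := κ)
    (fun c hc => (measurePreserving_smul_pi hc).restrict_ball hc ρ) LinearMap.id measurable_id
    hF' hm hp (z := z') (by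
      filter_upwards [ae_restrict_mem Metric.isOpen_ball.measurableSet] with w hw ζ hζ
      rw [Metric.mem_ball, dist_zero_right] at hw
      simp only [tube, mem_ofPred_eq, himz']
      refine (wtLow_le_wt hs hε hz (hη _ ?_) hr).1
      rw [LinearMap.id_apply, norm_smul]
      exact (mul_le_of_le_one_left (norm_nonneg _) hζ).trans hw.le)
  have hz'mem : z' ∈ tube n := add_smul_eC_mem hz (by simpa using hε.le)
  rw [hκ, Measure.restrict_apply_univ] at hmean
  have hGz : G z' = tr (ε * I) F z := indicator_of_mem hz'mem F
  rw [hGz] at hmean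
  set L := wtLow s ε * ((1 + ‖z‖) ^ 2)⁻¹ with hL
  have hL0 : 0 < L := mul_pos (wtLow_pos s hε) (by positivity)
  have hbound : ∫⁻ w in Metric.ball 0 ρ, ‖G (z' + w)‖ₑ ^ p ≤
      ENNReal.ofReal L⁻¹ * ∫⁻ w, ‖G w‖ₑ ^ p * wt s (imP w) := by
    calc _ ≤ ∫⁻ w in Metric.ball 0 ρ, ENNReal.ofReal L⁻¹ *
          (‖G (z' + w)‖ₑ ^ p * wt s (imP (z' + w))) := by
          refine lintegral_mono_ae ?_
          filter_upwards [ae_restrict_mem Metric.isOpen_ball.measurableSet] with w hw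
          rw [Metric.mem_ball, dist_zero_right] at hw
          have h1 := (wtLow_le_wt hs hε hz (hη w hw.le) hr).2
          rw [himz', mul_left_comm]
          refine le_mul_of_one_le_right' ?_
          calc (1 : ℝ≥0∞) = ENNReal.ofReal L⁻¹ * ENNReal.ofReal L := by
                rw [← ENNReal.ofReal_mul (by positivity), inv_mul_cancel₀ hL0.ne',
                  ENNReal.ofReal_one]
            _ ≤ _ := by gcongr
      _ ≤ ∫⁻ w, ENNReal.ofReal L⁻¹ * (‖G (z' + w)‖ₑ ^ p * wt s (imP (z' + w))) :=
          setLIntegral_le_lintegral _ _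
      _ = ENNReal.ofReal L⁻¹ * ∫⁻ w, ‖G (z' + w)‖ₑ ^ p * wt s (imP (z' + w)) :=
          lintegral_const_mul' _ _ ENNReal.ofReal_ne_top
      _ = _ := by
          rw [lintegral_add_left_eq_self (fun w => ‖G w‖ₑ ^ p * wt s (imP w))]
  have h3 := hmean.trans hbound
  calc ‖tr (ε * I) F z‖ₑ ^ p = (volume (Metric.ball (0 : Fin n → ℂ) ρ))⁻¹ *
        (volume (Metric.ball (0 : Fin n → ℂ) ρ) * ‖tr (ε * I) F z‖ₑ ^ p) := by
        rw [← mul_assoc, ENNReal.inv_mul_cancel hb0 hbt, one_mul]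
    _ ≤ (volume (Metric.ball (0 : Fin n → ℂ) ρ))⁻¹ *
        (ENNReal.ofReal L⁻¹ * ∫⁻ w, ‖G w‖ₑ ^ p * wt s (imP w)) := mul_le_mul_right h3 _
    _ = _ := by
        rw [supC, hL, mul_inv, inv_inv, ENNReal.ofReal_mul (by
          have := wtLow_pos s hε
          positivity)]
        ring

/-- Functions in the Bergman space are locally bounded by their norm. -/
lemma exists_local_bound {ν : ℝ} (hν : (n : ℝ) / 2 - 1 < ν) {p : ℝ} (hp : 1 ≤ p)
    {z₀ : Fin n → ℂ} (hz₀ : z₀ ∈ tube n) :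
    ∃ U ∈ nhds z₀, U ⊆ tube n ∧ ∃ C : ℝ≥0∞, C ≠ ⊤ ∧ ∀ F : (Fin n → ℂ) → ℂ,
      DifferentiableOn ℂ F (tube n) → ∀ z ∈ U,
      ‖F z‖ₑ ^ p ≤ C * ∫⁻ w, ‖F w‖ₑ ^ p ∂(dV n ν) := by
  have hc : Continuous fun q : ℝ × (Fin n → ℂ) => q.2 - (q.1 * I : ℂ) • eC n := by fun_prop
  have h1 : ∀ᶠ q : ℝ × (Fin n → ℂ) in nhds (0, z₀), q.2 - (q.1 * I : ℂ) • eC n ∈ tube n ∧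
      ‖q.2 - (q.1 * I : ℂ) • eC n‖ < ‖z₀‖ + 1 := by
    refine ((isOpen_tube.preimage hc).inter (isOpen_lt (continuous_norm.comp hc)
      continuous_const)).mem_nhds ⟨?_, ?_⟩
    · simpa using hz₀
    · simp
  rw [nhds_prod_eq, Filter.eventually_prod_iff] at h1
  obtain ⟨pa, hpa, pb, hpb, h⟩ := h1
  obtain ⟨r, hr, hball⟩ := Metric.eventually_nhds_iff.1 hpa
  have hpr : pa (r / 2) := hball (by rw [Real.dist_eq, sub_zero, abs_of_pos] <;> linarith)
  have hr2 : 0 < r / 2 := by positivity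
  have key : ∀ z, pb z → z = z - ((r / 2 : ℝ) * I : ℂ) • eC n + ((r / 2 : ℝ) * I : ℂ) • eC n :=
    fun z _ => by abel
  refine ⟨{z | pb z}, hpb, ?_, supC n (ν - (n : ℝ) / 2) (r / 2) *
    ENNReal.ofReal ((1 + (‖z₀‖ + 1)) ^ 2), ENNReal.mul_ne_top (supC_ne_top _ _ hr2)
    ENNReal.ofReal_ne_top, ?_⟩
  · intro z hz
    rw [key z hz]
    exact add_smul_eC_mem (h hpr hz).1 (by simpa using hr2.le)
  · intro F hF z hz
    have h2 := enorm_tr_rpow_le hν hp hF hr2 (h hpr hz).1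
    rw [tr, ← key z hz] at h2
    refine h2.trans ?_
    gcongr
    exact (h hpr hz).2.le

end SupBound

section Integrability

variable {n : ℕ} [NeZero n]

lemma norm_toC_smul_nullVec_le (hn : 3 ≤ n) {σ : ℝ} (hσ : |σ| ≤ 1) :
    ‖toC ((2 / 2 : ℝ) • nullVec n hn σ)‖ ≤ 1 := by
  refine (pi_norm_le_iff_of_nonneg zero_le_one).2 fun i => ?_
  by_cases h : i = 0
  · subst h; simp [toC, nullVec_zero]
  · by_cases h1 : i = ⟨1, by omega⟩
    · subst h1; simpa [toC, nullVec, one_ne hn] using hσ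
    · simp [toC, nullVec, h, h1]

/-- An exponent for which negative powers of `1 + ‖z‖` are integrable. -/
def decayExp (n : ℕ) (ν : ℝ) : ℝ := 2 * n + 2 * max (ν - (n : ℝ) / 2) 0 + 1

lemma decayExp_pos (n : ℕ) (ν : ℝ) : 0 < decayExp n ν := by
  have := le_max_right (ν - (n : ℝ) / 2) 0
  unfold decayExp; positivity

lemma wt_le_of_one_le_lor {s : ℝ} {z : Fin n → ℂ} (hz : 1 ≤ lor (imP z)) :
    wt s (imP z) ≤ ENNReal.ofReal ((1 + ‖z‖) ^ (2 * max s 0)) := by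
  by_cases h : imP z ∈ cone n
  · rw [wt_of_mem s h]
    refine ENNReal.ofReal_le_ofReal ?_
    have h1 : lor (imP z) ≤ (1 + ‖z‖) ^ (2 : ℝ) := by
      refine (lor_le_sq _).trans ?_
      rw [Real.rpow_two]
      refine pow_le_pow_left₀ h.2.le ?_ 2
      linarith [(le_abs_self _).trans (abs_im_apply_le_norm z 0)]
    calc lor (imP z) ^ s ≤ lor (imP z) ^ max s 0 :=
          Real.rpow_le_rpow_of_exponent_le hz (le_max_left _ _)
      _ ≤ ((1 + ‖z‖) ^ (2 : ℝ)) ^ max s 0 :=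
          Real.rpow_le_rpow (by linarith) h1 (le_max_right _ _)
      _ = _ := (Real.rpow_mul (by positivity) _ _).symm
  · rw [wt_of_notMem s h]; exact zero_le

lemma lintegral_decay_ne_top (hn : 3 ≤ n) {ν : ℝ} (hν : (n : ℝ) / 2 - 1 < ν) :
    ∫⁻ z, ENNReal.ofReal ((1 + ‖z‖) ^ (-decayExp n ν)) ∂(dV n ν) ≠ ⊤ := by
  have hs : -1 < ν - (n : ℝ) / 2 := by linarith
  have hM0 := decayExp_pos n ν
  rw [lintegral_dV (by fun_prop)]
  have hMs : decayExp n ν = 2 * n + 2 * max (ν - (n : ℝ) / 2) 0 + 1 := rfl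
  generalize ν - (n : ℝ) / 2 = s at *
  generalize decayExp n ν = M at *
  let S : Set (Fin n → ℂ) := {z | 1 ≤ lor (imP z)}
  have hS : MeasurableSet S := measurableSet_le measurable_const (continuous_lor.measurable.comp measurable_imP)
  let h : (Fin n → ℂ) → ℝ≥0∞ := S.indicator fun z => ENNReal.ofReal ((1 + ‖z‖) ^ (-M))
  have hh : Measurable h := Measurable.indicator (by fun_prop) hS
  have hfin : ∫⁻ z, h z * wtAvg hn s 2 (imP z) ≠ ⊤ := by
    have h1 : ∀ z, h z * wtAvg hn s 2 (imP z) ≤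
        (2 * wtC s) * (2 * wtC s) * ENNReal.ofReal ((1 + ‖z‖) ^ (-(2 * n + 1 : ℝ))) := by
      intro z
      by_cases hz : z ∈ S
      · calc h z * wtAvg hn s 2 (imP z) ≤ ENNReal.ofReal ((1 + ‖z‖) ^ (-M)) *
              ((2 * wtC s) * (2 * wtC s) * ENNReal.ofReal ((1 + ‖z‖) ^ (2 * max s 0))) := by
              rw [show h z = _ from indicator_of_mem hz _]
              gcongr
              refine (wtAvg_le hn hs two_pos (imP z)).trans ?_
              gcongr
              exact wt_le_of_one_le_lor hz
          _ = _ := by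
              rw [mul_left_comm, ← ENNReal.ofReal_mul (by positivity),
                ← Real.rpow_add (by positivity)]
              congr 4
              rw [hMs]; ring
      · rw [show h z = 0 from indicator_of_notMem hz _]; simp
    refine ((lintegral_mono h1).trans_lt ?_).ne
    rw [lintegral_const_mul' _ _ (wtC_sq_ne_top s)]
    refine ENNReal.mul_lt_top (wtC_sq_ne_top s).lt_top (finite_integral_one_add_norm ?_)
    have : Module.finrank ℝ (Fin n → ℂ) = 2 * n := by
      rw [Module.finrank_pi_fintype]; simp [Complex.finrank_real_complex, mul_comm]
    rw [this]; push_cast; linarith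
  rw [← lintegral_shift_mul_wt hn s 2 hh] at hfin
  have hb : (volume (Metric.ball (0 : ℂ) (1 / 2))) * (volume (Metric.ball (0 : ℂ) (1 / 2))) ≠ 0 := by
    have := (Metric.measure_ball_pos (volume : Measure ℂ) 0 one_half_pos).ne'
    exact mul_ne_zero this this
  set B : Set (ℂ × ℂ) := Metric.ball 0 (1 / 2) ×ˢ Metric.ball 0 (1 / 2) with hB
  have hBm : MeasurableSet B := (Metric.isOpen_ball.prod Metric.isOpen_ball).measurableSet
  have hbB : bidisc B ≠ 0 := by
    rw [bidisc, hB, Measure.prod_prod, Measure.restrict_apply Metric.isOpen_ball.measurableSet,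
      inter_eq_left.2 (Metric.ball_subset_ball (by norm_num))]
    exact hb
  have hlow : ∀ z, bidisc B * ENNReal.ofReal ((5 : ℝ) ^ (-M)) *
      (ENNReal.ofReal ((1 + ‖z‖) ^ (-M)) * wt s (imP z)) ≤
      ∫⁻ v, h (z + ((((2 : ℝ) : ℂ) * I) • eC n + nullMap n hn 2 v)) * wt s (imP z) ∂bidisc := by
    intro z
    by_cases hz : z ∈ tube n
    · calc _ = ∫⁻ v in B, ENNReal.ofReal ((5 : ℝ) ^ (-M)) *
            (ENNReal.ofReal ((1 + ‖z‖) ^ (-M)) * wt s (imP z)) ∂bidisc := by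
            rw [setLIntegral_const]; ring
        _ ≤ ∫⁻ v in B, h (z + ((((2 : ℝ) : ℂ) * I) • eC n + nullMap n hn 2 v)) *
            wt s (imP z) ∂bidisc := by
            refine setLIntegral_mono' hBm fun v hv => ?_
            rw [← mul_assoc]
            gcongr
            have hv1 : ‖v.1‖ < 1 / 2 := by simpa using hv.1
            have hv2 : ‖v.2‖ < 1 / 2 := by simpa using hv.2
            have hnull : ∀ (σ : ℝ) (ζ : ℂ) (y : Fin n → ℝ), σ ^ 2 = 1 → ‖ζ‖ < 1 / 2 → y ∈ cone n →
                lor y ≤ lor ((1 / 2 + ζ.im) • (2 / 2 : ℝ) • nullVec n hn σ + y) ∧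
                (1 / 2 + ζ.im) • (2 / 2 : ℝ) • nullVec n hn σ + y ∈ cone n := by
              intro σ ζ y hσ hζ hy
              have hζ' := (abs_le.1 ((abs_im_le_norm ζ).trans hζ.le)).1
              have hl : lor ((1 / 2 + ζ.im) • (2 / 2 : ℝ) • nullVec n hn σ) = 0 := by
                rw [lor_smul, lor_smul, lor_nullVec hn hσ]; simp
              have h0 : 0 ≤ ((1 / 2 + ζ.im) • (2 / 2 : ℝ) • nullVec n hn σ) 0 := by
                simp only [Pi.smul_apply, nullVec_zero, smul_eq_mul]
                norm_num; linarith
              refine ⟨?_, add_mem_cone hl.ge h0 hy⟩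
              have := le_lor_add hl.ge h0 hy
              linarith
            have hsp : imP (z + ((((2 : ℝ) : ℂ) * I) • eC n + nullMap n hn 2 v)) =
                (1 / 2 + v.1.im) • (2 / 2 : ℝ) • nullVec n hn 1 +
                ((1 / 2 + v.2.im) • (2 / 2 : ℝ) • nullVec n hn (-1) + (coneE n + imP z)) := by
              rw [imP_add, imP_shift, show coneE n = (1 / 2 : ℝ) • (2 : ℝ) • coneE n by
                rw [smul_smul]; norm_num, smul_coneE_eq hn]
              module
            have hcz : coneE n + imP z ∈ cone n := add_mem_cone coneE_mem.1.le coneE_mem.2.le hz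
            have hlz : 1 ≤ lor (coneE n + imP z) := by
              have := le_lor_add (lor_coneE (n := n) ▸ zero_le_one) coneE_mem.2.le hz
              have h2 := hz.1
              rw [lor_coneE] at this
              linarith
            obtain ⟨ha1, ha2⟩ := hnull (-1) v.2 _ (by norm_num) hv2 hcz
            obtain ⟨hc1, -⟩ := hnull 1 v.1 _ (by norm_num) hv1 ha2
            have hmem : z + ((((2 : ℝ) : ℂ) * I) • eC n + nullMap n hn 2 v) ∈ S := by
              change 1 ≤ lor _
              rw [hsp]; linarith
            rw [show h _ = _ from indicator_of_mem hmem _, ← ENNReal.ofReal_mul (by positivity)]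
            refine ENNReal.ofReal_le_ofReal ?_
            rw [← Real.mul_rpow (by positivity) (by positivity)]
            refine Real.rpow_le_rpow_of_nonpos (by positivity) ?_ (by linarith)
            have hw : ‖(((2 : ℝ) : ℂ) * I) • eC n + nullMap n hn 2 v‖ ≤ 4 := by
              have e1 : ‖(((2 : ℝ) : ℂ) * I) • eC n‖ ≤ 2 := by
                rw [norm_smul, eC, Pi.norm_single]; simp
              have e2 : ‖nullMap n hn 2 v‖ ≤ 2 := by
                rw [nullMap_apply]
                refine (norm_add_le _ _).trans ?_
                rw [norm_smul, norm_smul]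
                have f1 := norm_toC_smul_nullVec_le hn (σ := 1) (by norm_num)
                have f2 := norm_toC_smul_nullVec_le hn (σ := -1) (by norm_num)
                nlinarith [norm_nonneg v.1, norm_nonneg v.2,
                  norm_nonneg (toC ((2 / 2 : ℝ) • nullVec n hn 1)),
                  norm_nonneg (toC ((2 / 2 : ℝ) • nullVec n hn (-1)))]
              linarith [norm_add_le ((((2 : ℝ) : ℂ) * I) • eC n) (nullMap n hn 2 v)]
            have := norm_add_le z ((((2 : ℝ) : ℂ) * I) • eC n + nullMap n hn 2 v)
            linarith [norm_nonneg z]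
        _ ≤ _ := setLIntegral_le_lintegral _ _
    · rw [wt_of_notMem s (show imP z ∉ cone n from hz)]; simp
  intro htop
  refine hfin (top_le_iff.1 ?_)
  calc (⊤ : ℝ≥0∞) = bidisc B * ENNReal.ofReal ((5 : ℝ) ^ (-M)) * ⊤ := by
        rw [ENNReal.mul_top]
        refine mul_ne_zero hbB ?_
        have : (0 : ℝ) < 5 ^ (-M) := by positivity
        simpa using this
    _ = ∫⁻ z, bidisc B * ENNReal.ofReal ((5 : ℝ) ^ (-M)) *
      (ENNReal.ofReal ((1 + ‖z‖) ^ (-M)) * wt s (imP z)) := by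
        rw [lintegral_const_mul' _ _ (ENNReal.mul_ne_top (measure_ne_top _ _)
          ENNReal.ofReal_ne_top), htop]
    _ ≤ _ := lintegral_mono hlow

end Integrability

section Regularization

variable {n : ℕ} [NeZero n]

/-- The affine factors of the decaying multiplier. -/
def multFactor (δ : ℝ) (j : Fin n) (z : Fin n → ℂ) : ℂ := 1 - (δ * I) * (z 0 + z j / 2)

lemma one_le_norm_multFactor {δ : ℝ} (hδ : 0 < δ) {z : Fin n → ℂ} (hz : z ∈ tube n) (j : Fin n) :
    1 ≤ ‖multFactor δ j z‖ ∧ δ * ‖z 0 + z j / 2‖ ≤ ‖multFactor δ j z‖ := by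
  set w := z 0 + z j / 2 with hw
  have him : 0 ≤ w.im := by
    have h1 := abs_le_of_mem_cone hz j
    have h2 := hz.2
    simp only [imP] at h1 h2
    have h3 : w.im = (z 0).im + (z j).im / 2 := by simp [hw]
    rw [h3]; linarith [(abs_le.1 h1).1]
  have hre : (multFactor δ j z).re = 1 + δ * w.im := by simp [multFactor, ← hw]
  have him' : (multFactor δ j z).im = -(δ * w.re) := by simp [multFactor, ← hw]
  refine ⟨?_, ?_⟩
  · refine le_trans ?_ ((le_abs_self _).trans (abs_re_le_norm _))
    rw [hre]; linarith [mul_nonneg hδ.le him]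
  · refine (le_abs_self _).trans (abs_le_of_sq_le_sq ?_ (norm_nonneg _))
    rw [mul_pow, ← normSq_eq_norm_sq, ← normSq_eq_norm_sq, normSq_apply, normSq_apply, hre, him']
    nlinarith [mul_nonneg hδ.le him]

/-- A holomorphic multiplier on the tube, decaying at infinity. -/
def mult (N : ℕ) (δ : ℝ) (z : Fin n → ℂ) : ℂ := ∏ j, (multFactor δ j z ^ N)⁻¹

lemma norm_inv_multFactor_pow_le_one (N : ℕ) {δ : ℝ} (hδ : 0 < δ) {z : Fin n → ℂ}
    (hz : z ∈ tube n) (j : Fin n) : ‖(multFactor δ j z ^ N)⁻¹‖ ≤ 1 := by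
  rw [norm_inv, norm_pow]
  exact inv_le_one_of_one_le₀ (one_le_pow₀ (one_le_norm_multFactor hδ hz j).1)

lemma norm_mult_le_factor (N : ℕ) {δ : ℝ} (hδ : 0 < δ) {z : Fin n → ℂ} (hz : z ∈ tube n)
    (j : Fin n) : ‖mult N δ z‖ ≤ (‖multFactor δ j z‖ ^ N)⁻¹ := by
  rw [mult, norm_prod, ← Finset.mul_prod_erase _ _ (Finset.mem_univ j), ← norm_pow, ← norm_inv]
  exact mul_le_of_le_one_right (norm_nonneg _) (Finset.prod_le_one (fun _ _ => norm_nonneg _)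
    fun i _ => norm_inv_multFactor_pow_le_one N hδ hz i)

lemma norm_mult_le_one (N : ℕ) {δ : ℝ} (hδ : 0 < δ) {z : Fin n → ℂ} (hz : z ∈ tube n) :
    ‖mult N δ z‖ ≤ 1 := by
  rw [mult, norm_prod]
  exact Finset.prod_le_one (fun _ _ => norm_nonneg _)
    fun i _ => norm_inv_multFactor_pow_le_one N hδ hz i

lemma norm_mult_mul_le (N : ℕ) {δ : ℝ} (hδ : 0 < δ) {z : Fin n → ℂ} (hz : z ∈ tube n) :
    ‖mult N δ z‖ * (1 + ‖z‖) ^ N ≤ (1 + 4 / δ) ^ N := by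
  set B := (‖mult N δ z‖)⁻¹
  obtain ⟨j, hj⟩ : ∃ j, 1 + ‖z‖ ≤ (1 + 4 / δ) * ‖multFactor δ j z‖ := by
    by_contra! hcon
    have h0 := hcon 0
    obtain ⟨a0, b0⟩ := one_le_norm_multFactor hδ hz 0
    have hbound : ∀ i, ‖z i‖ ≤ ‖z‖ * (9 / 10) := by
      intro i
      have hi := hcon i
      obtain ⟨ai, bi⟩ := one_le_norm_multFactor hδ hz i
      have f : ∀ x : ℝ, 1 ≤ x → (1 + 4 / δ) * x < 1 + ‖z‖ → δ * (4 / δ * x) ≤ δ * ‖z‖ := by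
        intro x hx h
        have : 4 / δ * x ≤ ‖z‖ := by linarith
        exact mul_le_mul_of_nonneg_left this hδ.le
      have g : ∀ x : ℝ, δ * (4 / δ * x) = 4 * x := fun x => by field_simp
      have c0 := f _ a0 h0
      have ci := f _ ai hi
      rw [g] at c0 ci
      have d0 : 4 * ‖z 0 + z 0 / 2‖ ≤ ‖z‖ := by
        have : δ * (4 * ‖z 0 + z 0 / 2‖) ≤ δ * ‖z‖ := by linarith
        exact le_of_mul_le_mul_left this hδ
      have di : 4 * ‖z 0 + z i / 2‖ ≤ ‖z‖ := by
        have : δ * (4 * ‖z 0 + z i / 2‖) ≤ δ * ‖z‖ := by linarith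
        exact le_of_mul_le_mul_left this hδ
      have e : z i = 2 * (z 0 + z i / 2) - (4 / 3) * (z 0 + z 0 / 2) := by ring
      have hn := norm_sub_le (2 * (z 0 + z i / 2)) ((4 / 3 : ℂ) * (z 0 + z 0 / 2))
      rw [← e, norm_mul, norm_mul] at hn
      have n1 : ‖(2 : ℂ)‖ = 2 := by simp
      have n2 : ‖(4 / 3 : ℂ)‖ = 4 / 3 := by simp
      rw [n1, n2] at hn
      linarith [norm_nonneg z]
    have hz0 : ‖z‖ ≤ ‖z‖ * (9 / 10) :=
      (pi_norm_le_iff_of_nonneg (by positivity)).2 hbound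
    have hz1 : ‖z‖ = 0 := by linarith [norm_nonneg z]
    rw [hz1] at h0
    have : (0 : ℝ) < 4 / δ := by positivity
    nlinarith
  have h1 : 0 < ‖multFactor δ j z‖ := by linarith [(one_le_norm_multFactor hδ hz j).1]
  calc ‖mult N δ z‖ * (1 + ‖z‖) ^ N
      ≤ (‖multFactor δ j z‖ ^ N)⁻¹ * ((1 + 4 / δ) * ‖multFactor δ j z‖) ^ N := by
        gcongr
        exact norm_mult_le_factor N hδ hz j
    _ = _ := by rw [mul_pow]; field_simp

lemma mult_differentiableOn (N : ℕ) {δ : ℝ} (hδ : 0 < δ) :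
    DifferentiableOn ℂ (mult N δ) (tube n) := by
  unfold mult
  have h : ∀ j : Fin n, DifferentiableOn ℂ (fun z => (multFactor δ j z ^ N)⁻¹) (tube n) := fun j => by
    refine DifferentiableOn.fun_inv ?_ fun z hz => pow_ne_zero _ (norm_pos_iff.1 ?_)
    · unfold multFactor; fun_prop
    · linarith [(one_le_norm_multFactor hδ hz j).1]
  exact fun z hz => (HasFDerivWithinAt.finsetProd fun j _ =>
    (h j z hz).hasFDerivWithinAt).differentiableWithinAt

lemma tendsto_mult (N : ℕ) (z : Fin n → ℂ) :
    Filter.Tendsto (fun δ : ℝ => mult N δ z) (nhds 0) (nhds 1) := by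
  have h : ContinuousAt (fun δ : ℝ => mult N δ z) 0 := by
    unfold mult multFactor
    refine tendsto_finsetProd _ fun j _ => ?_
    refine ContinuousAt.inv₀ (by fun_prop) (by simp)
  simpa [mult, multFactor] using h.tendsto

/-- The exponent of the multiplier used in the regularization. -/
def multExp (n : ℕ) (ν : ℝ) : ℕ := ⌈decayExp n ν⌉₊ + 2

/-- The regularization parameters. -/
def regε (k : ℕ) : ℝ := 1 / (k + 1)

lemma regε_pos (k : ℕ) : 0 < regε k := by unfold regε; positivity

lemma tendsto_regε : Filter.Tendsto regε Filter.atTop (nhds 0) :=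
  tendsto_one_div_add_atTop_nhds_zero_nat

/-- Regularization operators: translate into the tube and multiply by a decaying function. -/
def reg (ν : ℝ) (k : ℕ) (F : (Fin n → ℂ) → ℂ) : (Fin n → ℂ) → ℂ :=
  fun z => mult (multExp n ν) (regε k) z * tr (regε k * I) F z

lemma reg_add (ν : ℝ) (k : ℕ) (F G : (Fin n → ℂ) → ℂ) :
    reg ν k (F + G) = reg ν k F + reg ν k G := by
  ext z; simp [reg, tr, mul_add]

lemma reg_const_mul (ν : ℝ) (k : ℕ) (c : ℂ) (F : (Fin n → ℂ) → ℂ) :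
    reg ν k (fun z => c * F z) = fun z => c * reg ν k F z := by
  ext z; simp only [reg, tr]; ring

lemma tr_regε_differentiableOn (k : ℕ) {F : (Fin n → ℂ) → ℂ} (hF : DifferentiableOn ℂ F (tube n)) :
    DifferentiableOn ℂ (tr (regε k * I) F) (tube n) :=
  tr_differentiableOn hF (by simpa using (regε_pos k).le)

lemma reg_differentiableOn (ν : ℝ) (k : ℕ) {F : (Fin n → ℂ) → ℂ}
    (hF : DifferentiableOn ℂ F (tube n)) : DifferentiableOn ℂ (reg ν k F) (tube n) :=
  (mult_differentiableOn _ (regε_pos k)).mul (tr_regε_differentiableOn k hF)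

lemma tendsto_tr {F : (Fin n → ℂ) → ℂ} (hF : DifferentiableOn ℂ F (tube n)) {z : Fin n → ℂ}
    (hz : z ∈ tube n) :
    Filter.Tendsto (fun k => tr (regε k * I) F z) Filter.atTop (nhds (F z)) := by
  have h1 : Continuous fun ε : ℝ => z + (ε * I : ℂ) • eC n := by fun_prop
  have h2 : ContinuousAt (fun ε : ℝ => F (z + (ε * I : ℂ) • eC n)) 0 := by
    refine ContinuousAt.comp (g := F) ?_ h1.continuousAt
    simpa using hF.continuousOn.continuousAt (isOpen_tube.mem_nhds hz)
  have h3 := h2.tendsto.comp tendsto_regε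
  simp only [ofReal_zero, zero_mul, zero_smul, add_zero] at h3
  exact h3

lemma tendsto_reg (ν : ℝ) {F : (Fin n → ℂ) → ℂ} (hF : DifferentiableOn ℂ F (tube n))
    {z : Fin n → ℂ} (hz : z ∈ tube n) :
    Filter.Tendsto (fun k => reg ν k F z) Filter.atTop (nhds (F z)) := by
  have h := ((tendsto_mult (multExp n ν) z).comp tendsto_regε).mul (tendsto_tr hF hz)
  rwa [one_mul] at h

lemma enorm_reg_le (ν : ℝ) (k : ℕ) (F : (Fin n → ℂ) → ℂ) {z : Fin n → ℂ} (hz : z ∈ tube n) :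
    ‖reg ν k F z‖ₑ ≤ ‖tr (regε k * I) F z‖ₑ := by
  refine enorm_le_iff_norm_le.2 ?_
  rw [reg, norm_mul]
  exact mul_le_of_le_one_left (norm_nonneg _) (norm_mult_le_one _ (regε_pos k) hz)

lemma eLpNorm_reg_le (hn : 3 ≤ n) {ν : ℝ} (hν : (n : ℝ) / 2 - 1 < ν) {p : ℝ} (hp : 1 ≤ p)
    (k : ℕ) {F : (Fin n → ℂ) → ℂ} (hF : DifferentiableOn ℂ F (tube n)) :
    eLpNorm (reg ν k F) (.ofReal p) (dV n ν) ≤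
      trC ν n ^ (1 / p) * eLpNorm F (.ofReal p) (dV n ν) := by
  refine le_trans ?_ (eLpNorm_tr_le hn hν hp hF (regε_pos k))
  refine eLpNorm_mono_enorm_ae ?_
  filter_upwards [ae_mem_tube ν] with z hz using enorm_reg_le ν k F hz

lemma eLpNorm_ofReal_eq {α : Type*} [MeasurableSpace α] {μ : Measure α} {p : ℝ} (hp : 0 < p)
    (f : α → ℂ) : eLpNorm f (.ofReal p) μ = (∫⁻ z, ‖f z‖ₑ ^ p ∂μ) ^ (1 / p) := by
  rw [eLpNorm_eq_lintegral_rpow_enorm_toReal (by simpa using hp)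
    ENNReal.ofReal_ne_top, ENNReal.toReal_ofReal hp.le]

lemma lintegral_ne_top_of_memLp {α : Type*} [MeasurableSpace α] {μ : Measure α} {p : ℝ}
    (hp : 0 < p) {f : α → ℂ} (hf : MemLp f (.ofReal p) μ) : ∫⁻ z, ‖f z‖ₑ ^ p ∂μ ≠ ⊤ := by
  have h := hf.2
  rw [eLpNorm_ofReal_eq hp, one_div, ENNReal.rpow_lt_top_iff_of_pos (inv_pos.2 hp)] at h
  exact h.ne

lemma tendsto_eLpNorm_reg_sub (hn : 3 ≤ n) {ν : ℝ} (hν : (n : ℝ) / 2 - 1 < ν) {p : ℝ} (hp : 1 ≤ p)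
    {F : (Fin n → ℂ) → ℂ} (hF : DifferentiableOn ℂ F (tube n))
    (hFp : MemLp F (.ofReal p) (dV n ν)) :
    Filter.Tendsto (fun k => eLpNorm (reg ν k F - F) (.ofReal p) (dV n ν)) Filter.atTop
      (nhds 0) := by
  have hp0 : 0 < p := by linarith
  have hfin := lintegral_ne_top_of_memLp hp0 hFp
  obtain ⟨A, hA, hA'⟩ := exists_tendsto_lintegral_tr_le hn hν hp hF hfin regε_pos tendsto_regε
  have h := tendsto_lintegral_sub_rpow hp (F := fun k => reg ν k F) (G := F)
    (fun k => aestronglyMeasurable_dV (reg_differentiableOn ν k hF))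
    (by filter_upwards [ae_mem_tube ν] with z hz using tendsto_reg ν hF hz) hfin
    (A := A) (fun k => (lintegral_mono_ae (by
      filter_upwards [ae_mem_tube ν] with z hz
      exact ENNReal.rpow_le_rpow (enorm_reg_le ν k F hz) hp0.le)).trans (hA k)) hA'
  have h2 := (ENNReal.continuous_rpow_const (y := 1 / p)).tendsto 0 |>.comp h
  rw [ENNReal.zero_rpow_of_pos (by positivity)] at h2
  refine h2.congr fun k => ?_
  rw [eLpNorm_ofReal_eq hp0]
  rfl

/-- The regularization operators map each Bergman space boundedly into all the others. -/
lemma exists_eLpNorm_reg_le (hn : 3 ≤ n) {ν : ℝ} (hν : (n : ℝ) / 2 - 1 < ν) {a b : ℝ}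
    (ha : 1 ≤ a) (hb : 1 ≤ b) (k : ℕ) :
    ∃ C : ℝ≥0∞, C ≠ ⊤ ∧ ∀ F : (Fin n → ℂ) → ℂ, DifferentiableOn ℂ F (tube n) →
      eLpNorm (reg ν k F) (.ofReal b) (dV n ν) ≤ C * eLpNorm F (.ofReal a) (dV n ν) := by
  have ha0 : 0 < a := by linarith
  have hb0 : 0 < b := by linarith
  have hk := regε_pos k
  set s := ν - (n : ℝ) / 2 with hs
  set N := multExp n ν with hN
  set J := ∫⁻ z, ENNReal.ofReal ((1 + ‖z‖) ^ (-decayExp n ν)) ∂(dV n ν) with hJ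
  set D : ℝ≥0∞ := ENNReal.ofReal ((1 + 4 / regε k) ^ N) * supC n s (regε k) ^ (1 / a) with hD
  have hDt : D ≠ ⊤ := ENNReal.mul_ne_top ENNReal.ofReal_ne_top
    (ENNReal.rpow_ne_top_of_nonneg (by positivity) (supC_ne_top n s hk))
  refine ⟨D * J ^ (1 / b), ENNReal.mul_ne_top hDt
    (ENNReal.rpow_ne_top_of_nonneg (by positivity) (lintegral_decay_ne_top hn hν)), ?_⟩
  intro F hF
  set E := eLpNorm F (.ofReal a) (dV n ν) with hE
  have hpt : ∀ z ∈ tube n, ‖reg ν k F z‖ₑ ^ b ≤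
      (D * E) ^ b * ENNReal.ofReal ((1 + ‖z‖) ^ (-decayExp n ν)) := by
    intro z hz
    have h1 := enorm_tr_rpow_le hν ha hF hk hz
    have h2 : ‖tr (regε k * I) F z‖ₑ ≤
        supC n s (regε k) ^ (1 / a) * ENNReal.ofReal ((1 + ‖z‖) ^ 2) * E := by
      have h3 := ENNReal.rpow_le_rpow h1 (show 0 ≤ 1 / a by positivity)
      rw [← ENNReal.rpow_mul, mul_one_div_cancel ha0.ne', ENNReal.rpow_one,
        ENNReal.mul_rpow_of_nonneg _ _ (by positivity),
        ENNReal.mul_rpow_of_nonneg _ _ (by positivity), ← eLpNorm_ofReal_eq ha0] at h3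
      refine h3.trans ?_
      gcongr
      rw [ENNReal.ofReal_rpow_of_nonneg (by positivity) (by positivity)]
      refine ENNReal.ofReal_le_ofReal ?_
      have : (1 : ℝ) ≤ (1 + ‖z‖) ^ 2 := one_le_pow₀ (by linarith [norm_nonneg z])
      exact (Real.rpow_le_rpow_of_exponent_le this ((div_le_one ha0).2 ha)).trans_eq
        (Real.rpow_one _)
    have h4 : ‖mult N (regε k) z‖ₑ * ENNReal.ofReal ((1 + ‖z‖) ^ 2) ≤
        ENNReal.ofReal ((1 + 4 / regε k) ^ N) *
          ENNReal.ofReal ((1 + ‖z‖) ^ (-decayExp n ν)) := by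
      rw [← ofReal_norm, ← ENNReal.ofReal_mul (norm_nonneg _), ← ENNReal.ofReal_mul (by positivity)]
      refine ENNReal.ofReal_le_ofReal ?_
      have h5 := norm_mult_mul_le N hk hz
      have h1z : (1 : ℝ) ≤ 1 + ‖z‖ := by linarith [norm_nonneg z]
      have h6 : (1 + ‖z‖) ^ 2 ≤ (1 + ‖z‖) ^ N * (1 + ‖z‖) ^ (-decayExp n ν) := by
        rw [← Real.rpow_natCast _ N, ← Real.rpow_add (by positivity), ← Real.rpow_natCast _ 2]
        refine Real.rpow_le_rpow_of_exponent_le h1z ?_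
        have := Nat.le_ceil (decayExp n ν)
        rw [hN, multExp]; push_cast; linarith
      calc _ ≤ ‖mult N (regε k) z‖ * ((1 + ‖z‖) ^ N * (1 + ‖z‖) ^ (-decayExp n ν)) := by gcongr
        _ = (‖mult N (regε k) z‖ * (1 + ‖z‖) ^ N) * (1 + ‖z‖) ^ (-decayExp n ν) := by ring
        _ ≤ _ := by gcongr
    have h7 : ‖reg ν k F z‖ₑ ≤ D * E * ENNReal.ofReal ((1 + ‖z‖) ^ (-decayExp n ν)) := by
      calc ‖reg ν k F z‖ₑ = ‖mult N (regε k) z‖ₑ * ‖tr (regε k * I) F z‖ₑ := by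
            rw [reg, enorm_mul]
        _ ≤ ‖mult N (regε k) z‖ₑ *
            (supC n s (regε k) ^ (1 / a) * ENNReal.ofReal ((1 + ‖z‖) ^ 2) * E) := by gcongr
        _ = (‖mult N (regε k) z‖ₑ * ENNReal.ofReal ((1 + ‖z‖) ^ 2)) *
            (supC n s (regε k) ^ (1 / a) * E) := by ring
        _ ≤ (ENNReal.ofReal ((1 + 4 / regε k) ^ N) *
          ENNReal.ofReal ((1 + ‖z‖) ^ (-decayExp n ν))) * (supC n s (regε k) ^ (1 / a) * E) := by
            gcongr
        _ = _ := by rw [hD]; ring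
    refine (ENNReal.rpow_le_rpow h7 hb0.le).trans ?_
    rw [ENNReal.mul_rpow_of_nonneg _ _ hb0.le]
    gcongr
    rw [ENNReal.ofReal_rpow_of_nonneg (by positivity) hb0.le]
    refine ENNReal.ofReal_le_ofReal ?_
    rw [← Real.rpow_mul (by positivity)]
    refine Real.rpow_le_rpow_of_exponent_le (by linarith [norm_nonneg z]) ?_
    nlinarith [decayExp_pos n ν]
  rw [eLpNorm_ofReal_eq hb0]
  calc _ ≤ (∫⁻ z, (D * E) ^ b * ENNReal.ofReal ((1 + ‖z‖) ^ (-decayExp n ν)) ∂(dV n ν)) ^ (1 / b) := by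
        refine ENNReal.rpow_le_rpow (lintegral_mono_ae ?_) (by positivity)
        filter_upwards [ae_mem_tube ν] with z hz using hpt z hz
    _ = D * E * J ^ (1 / b) := by
        rw [lintegral_const_mul _ (by fun_prop), ENNReal.mul_rpow_of_nonneg _ _ (by positivity),
          ← ENNReal.rpow_mul, mul_one_div_cancel hb0.ne', ENNReal.rpow_one]
    _ = _ := by ring

lemma memLp_reg (hn : 3 ≤ n) {ν : ℝ} (hν : (n : ℝ) / 2 - 1 < ν) {a b : ℝ}
    (ha : 1 ≤ a) (hb : 1 ≤ b) (k : ℕ) {F : (Fin n → ℂ) → ℂ} (hF : DifferentiableOn ℂ F (tube n))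
    (hFa : MemLp F (.ofReal a) (dV n ν)) : MemLp (reg ν k F) (.ofReal b) (dV n ν) := by
  obtain ⟨C, hC, h⟩ := exists_eLpNorm_reg_le hn hν ha hb k
  exact ⟨aestronglyMeasurable_dV (reg_differentiableOn ν k hF),
    (h F hF).trans_lt (ENNReal.mul_lt_top hC.lt_top hFa.2)⟩

end Regularization

section UniformBound

variable {n : ℕ} [NeZero n]

lemma wtLow_le_wt_dilate {s ε : ℝ} (hs : -1 < s) (hε : 0 < ε) {y : Fin n → ℝ} (hy : y ∈ cone n)
    {t : ℝ} (ht : |t| ≤ 1 / 2) {η : Fin n → ℝ} (hη : ∀ i, |η i| ≤ ε / 2 / (8 * n)) :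
    (y + ε • coneE n) + t • (y + ε • coneE n) + η ∈ cone n ∧
      ENNReal.ofReal (wtLow s (ε / 2) * ((1 + 2 * (y 0 + ε)) ^ 2)⁻¹) ≤
        wt s ((y + ε • coneE n) + t • (y + ε • coneE n) + η) := by
  obtain ⟨ht1, ht2⟩ := abs_le.1 ht
  have hy0 := hy.2
  have hmem : ((t + 1 / 2) * ε) • coneE n + (1 + t) • y ∈ cone n := by
    refine add_mem_cone ?_ ?_ (smul_mem_cone (by linarith) hy)
    · rw [lor_smul, lor_coneE]; positivity
    · have : 0 ≤ (t + 1 / 2) * ε := mul_nonneg (by linarith) hε.le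
      simpa [coneE] using this
  have hr : (((t + 1 / 2) * ε) • coneE n + (1 + t) • y) 0 ≤ 2 * (y 0 + ε) := by
    simp [coneE]; nlinarith
  have h := wtLow_le_wt hs (half_pos hε) hmem hη hr
  have he : ((t + 1 / 2) * ε) • coneE n + (1 + t) • y + (ε / 2) • coneE n + η =
      (y + ε • coneE n) + t • (y + ε • coneE n) + η := by module
  rwa [he] at h

/-- The constant in the uniform bound for translates of functions in the Bergman space. -/
def unifC (n : ℕ) (s ε : ℝ) : ℝ≥0∞ :=
  (volume (Metric.ball (0 : ℂ) (1 / 2)) * volume (Metric.ball (0 : Fin n → ℂ) (ε / 2 / (8 * n))))⁻¹ *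
    ENNReal.ofReal ((wtLow s (ε / 2))⁻¹ * (Real.pi * (ε / 2 / (8 * n)) ^ 2 * (ε⁻¹ + 2) ^ 2))

lemma unifC_ne_top (n : ℕ) [NeZero n] (s : ℝ) {ε : ℝ} (hε : 0 < ε) : unifC n s ε ≠ ⊤ := by
  refine ENNReal.mul_ne_top (ENNReal.inv_ne_top.2 (mul_ne_zero ?_ ?_)) ENNReal.ofReal_ne_top
  · exact (Metric.measure_ball_pos _ _ (by positivity)).ne'
  · have : 0 < n := Nat.pos_of_ne_zero (NeZero.ne n)
    exact (Metric.measure_ball_pos _ _ (by positivity)).ne'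

lemma enorm_tr_rpow_le_uniform {ν : ℝ} (hν : (n : ℝ) / 2 - 1 < ν) {p : ℝ} (hp : 1 ≤ p)
    {F : (Fin n → ℂ) → ℂ} (hF : DifferentiableOn ℂ F (tube n)) {ε : ℝ} (hε : 0 < ε)
    {z : Fin n → ℂ} (hz : z ∈ tube n) :
    ‖tr (ε * I) F z‖ₑ ^ p ≤ unifC n (ν - (n : ℝ) / 2) ε * ∫⁻ w, ‖F w‖ₑ ^ p ∂(dV n ν) := by
  have hs : -1 < ν - (n : ℝ) / 2 := by linarith
  have hn0 : 0 < n := Nat.pos_of_ne_zero (NeZero.ne n)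
  rw [← lintegral_indicator_tube hF]
  set s := ν - (n : ℝ) / 2 with hsdef
  set ρ := ε / 2 / (8 * n) with hρ
  have hρ0 : 0 < ρ := by positivity
  have hF' := differentiableOn_indicator_tube hF
  have hm := measurable_indicator_tube hF
  set G := (tube n).indicator F with hG
  set z' := z + (ε * I : ℂ) • eC n with hz'
  set y' := imP z + ε • coneE n with hy'
  have hy0 : 0 < imP z 0 := hz.2
  have hr : y' 0 = imP z 0 + ε := by simp [hy', coneE]
  have hr0 : 0 < y' 0 := by rw [hr]; positivity
  set κ₁ : Measure ℂ := volume.restrict (Metric.ball 0 (1 / 2)) with hκ₁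
  set κ₂ : Measure (Fin n → ℂ) := volume.restrict (Metric.ball 0 ρ) with hκ₂
  have hb0 : volume (Metric.ball (0 : ℂ) (1 / 2)) *
      volume (Metric.ball (0 : Fin n → ℂ) ρ) ≠ 0 :=
    mul_ne_zero (Metric.measure_ball_pos _ _ (by positivity)).ne'
      (Metric.measure_ball_pos _ _ hρ0).ne'
  have hbt : volume (Metric.ball (0 : ℂ) (1 / 2)) *
      volume (Metric.ball (0 : Fin n → ℂ) ρ) ≠ ⊤ :=
    ENNReal.mul_ne_top measure_ball_lt_top.ne measure_ball_lt_top.ne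
  let Φ : ℂ × (Fin n → ℂ) →ₗ[ℂ] (Fin n → ℂ) :=
    (LinearMap.fst ℂ ℂ (Fin n → ℂ)).smulRight (toC y') + LinearMap.snd ℂ ℂ (Fin n → ℂ)
  have hΦ : ∀ v, Φ v = v.1 • toC y' + v.2 := fun v => rfl
  have hΦm : Measurable Φ := by
    have : (Φ : ℂ × (Fin n → ℂ) → Fin n → ℂ) = fun v => v.1 • toC y' + v.2 := rfl
    rw [this]; fun_prop
  have him : ∀ v : ℂ × (Fin n → ℂ), imP (z' + Φ v) = y' + v.1.im • y' + imP v.2 := by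
    intro v
    rw [hΦ, hz', imP_add, imP_add, imP_add, imP_smul_eC, imP_smul_toC, hy']
    simp [add_assoc]
  have hkey : ∀ v : ℂ × (Fin n → ℂ), ‖v.1‖ ≤ 1 / 2 → ‖v.2‖ ≤ ρ → z' + Φ v ∈ tube n ∧
      ENNReal.ofReal (wtLow s (ε / 2) * ((1 + 2 * y' 0) ^ 2)⁻¹) ≤ wt s (imP (z' + Φ v)) := by
    intro v h1 h2
    rw [tube, mem_ofPred_eq, him, hr]
    exact wtLow_le_wt_dilate hs hε hz ((abs_im_le_norm _).trans h1)
      fun i => (abs_im_apply_le_norm _ i).trans h2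
  have hae : ∀ᵐ v ∂(κ₁.prod κ₂), ‖v.1‖ ≤ 1 / 2 ∧ ‖v.2‖ < ρ := by
    rw [hκ₁, hκ₂, Measure.prod_restrict]
    filter_upwards [ae_restrict_mem (Metric.isOpen_ball.measurableSet.prod
      Metric.isOpen_ball.measurableSet)] with v hv
    simpa using And.intro (mem_ball_zero_iff.1 hv.1).le (mem_ball_zero_iff.1 hv.2)
  have hmean := sub_mean (κ := κ₁.prod κ₂)
    (fun c hc => ((measurePreserving_smul_complex hc).restrict_ball hc _).prod
      ((measurePreserving_smul_pi hc).restrict_ball hc _)) Φ hΦm hF' hm hp (z := z') (by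
      filter_upwards [hae] with v hv ζ hζ
      rw [← map_smul]
      refine (hkey _ ?_ ?_).1
      · rw [Prod.smul_fst, norm_smul]
        exact (mul_le_of_le_one_left (norm_nonneg _) hζ).trans hv.1
      · rw [Prod.smul_snd, norm_smul]
        exact (mul_le_of_le_one_left (norm_nonneg _) hζ).trans hv.2.le)
  have hz'mem : z' ∈ tube n := add_smul_eC_mem hz (by simpa using hε.le)
  have hGz : G z' = tr (ε * I) F z := indicator_of_mem hz'mem F
  rw [hGz, ← univ_prod_univ, Measure.prod_prod, hκ₁, hκ₂, Measure.restrict_apply_univ,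
    Measure.restrict_apply_univ, ← hκ₁, ← hκ₂] at hmean
  set L := wtLow s (ε / 2) * ((1 + 2 * y' 0) ^ 2)⁻¹ with hL
  have hL0 : 0 < L := mul_pos (wtLow_pos s (by positivity)) (by positivity)
  set g : (Fin n → ℂ) → ℝ≥0∞ := fun u => ‖G u‖ₑ ^ p * wt s (imP u) with hg
  have hgm : Measurable g := (hm.enorm.pow_const p).mul ((measurable_wt s).comp measurable_imP)
  set S : Set (ℂ × (Fin n → ℂ)) := {v | ‖v.2 0 - z' 0 - v.1 * (y' 0 : ℝ)‖ < ρ} with hS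
  have hSm : MeasurableSet S := measurableSet_lt (by fun_prop) measurable_const
  have hHm : Measurable (S.indicator fun v => g v.2) := (hgm.comp measurable_snd).indicator hSm
  have hvol : ∀ u : Fin n → ℂ, volume {ζ : ℂ | (ζ, u) ∈ S} = ENNReal.ofReal (Real.pi * (ρ / y' 0) ^ 2) := by
    intro u
    have : {ζ : ℂ | (ζ, u) ∈ S} = Metric.ball ((u 0 - z' 0) / (y' 0 : ℝ)) (ρ / y' 0) := by
      ext ζ
      have hne : ((y' 0 : ℝ) : ℂ) ≠ 0 := by exact_mod_cast hr0.ne'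
      have h1 : u 0 - z' 0 - ζ * (y' 0 : ℝ) = ((u 0 - z' 0) / (y' 0 : ℝ) - ζ) * (y' 0 : ℝ) := by
        field_simp
      rw [mem_ofPred_eq, hS, mem_ofPred_eq, Metric.mem_ball, dist_comm, dist_eq_norm, h1, norm_mul,
        norm_real, Real.norm_of_nonneg hr0.le, lt_div_iff₀ hr0]
    rw [this, Complex.volume_ball, mul_comm, ← ENNReal.ofReal_pow (by positivity),
      ENNReal.ofReal_mul Real.pi_pos.le]
    congr 1
    rw [← NNReal.coe_real_pi, ENNReal.ofReal_coe_nnreal]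
  have hbound : ∫⁻ v, ‖G (z' + Φ v)‖ₑ ^ p ∂(κ₁.prod κ₂) ≤
      ENNReal.ofReal L⁻¹ * (ENNReal.ofReal (Real.pi * (ρ / y' 0) ^ 2) * ∫⁻ u, g u) := by
    calc _ ≤ ∫⁻ v, ENNReal.ofReal L⁻¹ * S.indicator (fun v => g v.2) (v.1, z' + Φ v)
          ∂(κ₁.prod κ₂) := by
          refine lintegral_mono_ae ?_
          filter_upwards [hae] with v hv
          have hvS : (v.1, z' + Φ v) ∈ S := by
            have : (z' + Φ v) 0 - z' 0 - v.1 * (y' 0 : ℝ) = v.2 0 := by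
              simp [hΦ, toC]
            rw [hS, mem_ofPred_eq, this]
            exact (norm_le_pi_norm v.2 0).trans_lt hv.2
          rw [indicator_of_mem hvS, hg, mul_left_comm]
          refine le_mul_of_one_le_right' ?_
          calc (1 : ℝ≥0∞) = ENNReal.ofReal L⁻¹ * ENNReal.ofReal L := by
                rw [← ENNReal.ofReal_mul (by positivity), inv_mul_cancel₀ hL0.ne',
                  ENNReal.ofReal_one]
            _ ≤ _ := by gcongr; exact (hkey v hv.1 hv.2.le).2
      _ ≤ ∫⁻ v, ENNReal.ofReal L⁻¹ * S.indicator (fun v => g v.2) (v.1, z' + Φ v)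
          ∂((volume : Measure ℂ).prod (volume : Measure (Fin n → ℂ))) := by
          refine lintegral_mono' ?_ le_rfl
          rw [hκ₁, hκ₂, Measure.prod_restrict]
          exact Measure.restrict_le_self
      _ = ENNReal.ofReal L⁻¹ * ∫⁻ ζ : ℂ, ∫⁻ w, S.indicator (fun v => g v.2) (ζ, z' + Φ (ζ, w)) := by
          rw [lintegral_const_mul' _ _ ENNReal.ofReal_ne_top, lintegral_prod]
          exact (hHm.comp (measurable_fst.prodMk (hΦm.const_add z'))).aemeasurable
      _ = ENNReal.ofReal L⁻¹ * ∫⁻ ζ : ℂ, ∫⁻ u, S.indicator (fun v => g v.2) (ζ, u) := by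
          congr 1
          refine lintegral_congr fun ζ => ?_
          simp only [hΦ, ← add_assoc]
          exact lintegral_add_left_eq_self (fun u => S.indicator (fun v => g v.2) (ζ, u)) _
      _ = ENNReal.ofReal L⁻¹ * ∫⁻ u, ∫⁻ ζ : ℂ, S.indicator (fun v => g v.2) (ζ, u) := by
          congr 1
          exact lintegral_lintegral_swap
            (f := fun ζ u => S.indicator (fun v => g v.2) (ζ, u)) hHm.aemeasurable
      _ = _ := by
          rw [← lintegral_const_mul _ hgm]
          congr 1
          refine lintegral_congr fun u => ?_
          rw [← hvol u]
          have : ∀ ζ : ℂ, S.indicator (fun v => g v.2) (ζ, u) =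
              {ζ : ℂ | (ζ, u) ∈ S}.indicator (fun _ => g u) ζ := fun ζ => rfl
          simp only [this]
          refine (lintegral_indicator_const (measurable_prodMk_right hSm) _).trans ?_
          rw [mul_comm]; rfl
  have h3 := hmean.trans hbound
  have hC : L⁻¹ * (Real.pi * (ρ / y' 0) ^ 2) ≤
      (wtLow s (ε / 2))⁻¹ * (Real.pi * ρ ^ 2 * (ε⁻¹ + 2) ^ 2) := by
    have : L⁻¹ * (Real.pi * (ρ / y' 0) ^ 2) =
        (wtLow s (ε / 2))⁻¹ * (Real.pi * ρ ^ 2 * ((y' 0)⁻¹ + 2) ^ 2) := by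
      rw [hL]; field_simp
    rw [this]
    have hw := wtLow_pos s (half_pos hε)
    gcongr
    rw [hr]; linarith
  calc ‖tr (ε * I) F z‖ₑ ^ p = (volume (Metric.ball (0 : ℂ) (1 / 2)) *
          volume (Metric.ball (0 : Fin n → ℂ) ρ))⁻¹ * (volume (Metric.ball (0 : ℂ) (1 / 2)) *
          volume (Metric.ball (0 : Fin n → ℂ) ρ) * ‖tr (ε * I) F z‖ₑ ^ p) := by
        rw [← mul_assoc, ENNReal.inv_mul_cancel hb0 hbt, one_mul]
    _ ≤ _ := mul_le_mul_right h3 _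
    _ ≤ _ := by
        rw [unifC, mul_assoc]
        refine mul_le_mul_right ?_ _
        rw [← mul_assoc, ← ENNReal.ofReal_mul (by positivity)]
        exact mul_le_mul_left (ENNReal.ofReal_le_ofReal hC) _

end UniformBound

section PointFunctional

variable {n : ℕ} [NeZero n]

lemma memLp_tr (hn : 3 ≤ n) {ν : ℝ} (hν : (n : ℝ) / 2 - 1 < ν) {a b : ℝ} (ha : 1 ≤ a)
    (hab : a ≤ b) {F : (Fin n → ℂ) → ℂ} (hF : DifferentiableOn ℂ F (tube n))
    (hFa : MemLp F (.ofReal a) (dV n ν)) {ε : ℝ} (hε : 0 < ε) :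
    MemLp (tr (ε * I) F) (.ofReal b) (dV n ν) := by
  have ha0 : 0 < a := by linarith
  have hb0 : 0 < b := by linarith
  have htr : DifferentiableOn ℂ (tr (ε * I) F) (tube n) :=
    tr_differentiableOn hF (by simpa using hε.le)
  refine ⟨aestronglyMeasurable_dV htr, ?_⟩
  set M : ℝ≥0∞ := unifC n (ν - (n : ℝ) / 2) ε * ∫⁻ w, ‖F w‖ₑ ^ a ∂(dV n ν) with hM
  have hMt : M ≠ ⊤ := ENNReal.mul_ne_top (unifC_ne_top n _ hε) (lintegral_ne_top_of_memLp ha0 hFa)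
  have h1 : ∫⁻ w, ‖tr (ε * I) F w‖ₑ ^ a ∂(dV n ν) ≠ ⊤ :=
    lintegral_ne_top_of_memLp ha0 ⟨aestronglyMeasurable_dV htr,
      (eLpNorm_tr_le hn hν ha hF hε).trans_lt
        (ENNReal.mul_lt_top (ENNReal.rpow_lt_top_of_nonneg (by positivity) (trC_ne_top _ _)) hFa.2)⟩
  have h2 : ∫⁻ w, ‖tr (ε * I) F w‖ₑ ^ b ∂(dV n ν) ≤
      ∫⁻ w, M ^ ((b - a) / a) * ‖tr (ε * I) F w‖ₑ ^ a ∂(dV n ν) := by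
    refine lintegral_mono_ae ?_
    filter_upwards [ae_mem_tube ν] with w hw
    have h3 := ENNReal.rpow_le_rpow (enorm_tr_rpow_le_uniform hν ha hF hε hw)
      (show 0 ≤ (b - a) / a from div_nonneg (by linarith) ha0.le)
    rw [← ENNReal.rpow_mul, mul_div_cancel₀ _ ha0.ne'] at h3
    calc ‖tr (ε * I) F w‖ₑ ^ b = ‖tr (ε * I) F w‖ₑ ^ (b - a) * ‖tr (ε * I) F w‖ₑ ^ a := by
          rw [← ENNReal.rpow_add_of_nonneg _ _ (by linarith) ha0.le, sub_add_cancel]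
      _ ≤ _ := mul_le_mul_left h3 _
  have hMp : M ^ ((b - a) / a) ≠ ⊤ :=
    ENNReal.rpow_ne_top_of_nonneg (div_nonneg (by linarith) ha0.le) hMt
  rw [lintegral_const_mul' _ _ hMp] at h2
  rw [eLpNorm_ofReal_eq hb0]
  exact ENNReal.rpow_lt_top_of_nonneg (by positivity)
    (h2.trans_lt (ENNReal.mul_lt_top hMp.lt_top h1.lt_top)).ne

lemma integral_ball_eq {F : (Fin n → ℂ) → ℂ} (hF : DifferentiableOn ℂ F (tube n))
    {z : Fin n → ℂ} {r : ℝ} (hr : Metric.closedBall z r ⊆ tube n) :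
    ∫ w in Metric.ball z r, F w = volume.real (Metric.ball z r) • F z := by
  have hF' := differentiableOn_indicator_tube hF
  have hm := measurable_indicator_tube hF
  set G := (tube n).indicator F with hG
  set κ : Measure (Fin n → ℂ) := volume.restrict (Metric.ball 0 r) with hκ
  have hfin : IsFiniteMeasure κ := ⟨by
    rw [hκ, Measure.restrict_apply_univ]; exact measure_ball_lt_top⟩
  have hpre : (fun w => z + w) ⁻¹' Metric.ball z r = Metric.ball 0 r := by
    ext w; simp
  have hmp := (measurePreserving_add_left (volume : Measure (Fin n → ℂ)) z).restrict_preimage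
    (s := Metric.ball z r) Metric.isOpen_ball.measurableSet
  rw [hpre, ← hκ] at hmp
  have hemb : MeasurableEmbedding fun w : Fin n → ℂ => z + w := measurableEmbedding_addLeft z
  rcases le_or_gt r 0 with hr0 | hr0
  · simp [Metric.ball_eq_empty.2 hr0]
  have hsub : Metric.ball z r ⊆ tube n := Metric.ball_subset_closedBall.trans hr
  have hzt : z ∈ tube n := hr (Metric.mem_closedBall_self hr0.le)
  have hFG : ∫ w in Metric.ball z r, F w = ∫ w, G (z + w) ∂κ := by
    rw [hmp.integral_comp hemb]
    refine setIntegral_congr_fun Metric.isOpen_ball.measurableSet fun w hw => ?_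
    exact (indicator_of_mem (hsub hw) F).symm
  obtain ⟨M, hM⟩ := (isCompact_closedBall z r).exists_bound_of_continuousOn
    (hF'.continuousOn.mono hr)
  have hmem : ∀ᵐ w ∂κ, ‖w‖ < r := by
    rw [hκ]
    filter_upwards [ae_restrict_mem Metric.isOpen_ball.measurableSet] with w hw
    simpa using hw
  have hball : ∀ w : Fin n → ℂ, ‖w‖ < r → ∀ ζ : ℂ, ‖ζ‖ ≤ 1 → z + ζ • w ∈ Metric.closedBall z r := by
    intro w hw ζ hζ
    simp only [Metric.mem_closedBall, dist_self_add_left, norm_smul]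
    exact (mul_le_of_le_one_left (norm_nonneg _) hζ).trans hw.le
  set τ : Measure ℝ := volume.restrict (Ioc 0 (2 * Real.pi)) with hτ
  have h2π : (0 : ℝ) < 2 * Real.pi := by positivity
  have hintegrable : Integrable (Function.uncurry fun (w : Fin n → ℂ) (θ : ℝ) =>
      G (z + exp (θ * I) • w)) (κ.prod τ) := by
    refine Integrable.of_bound (C := M) ?_ ?_
    · exact (hm.comp (by fun_prop :
        Measurable fun q : (Fin n → ℂ) × ℝ => z + exp (q.2 * I) • q.1)).aestronglyMeasurable
    · have h1 : ∀ᵐ q ∂(κ.prod τ), ‖q.1‖ < r := Measure.quasiMeasurePreserving_fst.ae hmem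
      filter_upwards [h1] with q hq
      exact hM _ (hball _ hq _ (norm_exp_ofReal_mul_I _).le)
  have hswap := integral_integral_swap hintegrable
  have hrot : ∀ θ : ℝ, ∫ w, G (z + exp (θ * I) • w) ∂κ = ∫ w, G (z + w) ∂κ := by
    intro θ
    have hc : ‖exp (θ * I)‖ = 1 := norm_exp_ofReal_mul_I θ
    have hmp := (measurePreserving_smul_pi (n := n) hc).restrict_ball hc r
    have he : MeasurableEmbedding fun v : Fin n → ℂ => exp (θ * I) • v :=
      (Homeomorph.smulOfNeZero _ (exp_ne_zero _)).measurableEmbedding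
    exact hmp.integral_comp he (fun w => G (z + w))
  have hmean : ∀ᵐ w ∂κ, ∫ θ, G (z + exp (θ * I) • w) ∂τ = (2 * Real.pi) • G z := by
    filter_upwards [hmem] with w hw
    have := circle_mean hF' (z := z) (v := w) fun ζ hζ => hr (hball w hw ζ hζ)
    rw [intervalIntegral.integral_of_le h2π.le] at this
    rw [← this, smul_smul, mul_inv_cancel₀ h2π.ne', one_smul]
  rw [integral_congr_ae hmean] at hswap
  simp only [hrot, integral_const] at hswap
  have hl : τ.real univ = 2 * Real.pi := by
    rw [hτ, measureReal_restrict_apply_univ, Real.volume_real_Ioc_of_le h2π.le, sub_zero]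
  have hk : κ.real univ = volume.real (Metric.ball z r) := by
    rw [hκ, measureReal_restrict_apply_univ, ← hpre]
    exact congrArg ENNReal.toReal (measure_preimage_add _ _ _)
  rw [hl, hk, smul_comm, show G z = F z from indicator_of_mem hzt F] at hswap
  rw [hFG]
  exact ((smul_right_injective ℂ h2π.ne') hswap).symm

/-- Evaluation at a point of the tube is represented by a bounded function of compact support. -/
lemma exists_pointFunctional (ν : ℝ) {z : Fin n → ℂ} (hz : z ∈ tube n) :
    ∃ b : (Fin n → ℂ) → ℂ, (∀ r, MemLp b r (dV n ν)) ∧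
      ∀ F : (Fin n → ℂ) → ℂ, DifferentiableOn ℂ F (tube n) → pairing (dV n ν) F b = F z := by
  obtain ⟨r, hr0, hr⟩ := Metric.nhds_basis_closedBall.mem_iff.1 (isOpen_tube.mem_nhds hz)
  set s := ν - (n : ℝ) / 2 with hs
  have hlor : ∀ w ∈ Metric.closedBall z r, 0 < lor (imP w) := fun w hw => (hr hw).1
  have hcont : ∀ t : ℝ, ContinuousOn (fun w : Fin n → ℂ => lor (imP w) ^ t)
      (Metric.closedBall z r) := fun t =>
    (continuous_lor.comp continuous_imP).continuousOn.rpow_const fun w hw => Or.inl (hlor w hw).ne'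
  set c : ℝ := (volume.real (Metric.ball z r))⁻¹ with hc
  have hB : MeasurableSet (Metric.ball z r) := Metric.isOpen_ball.measurableSet
  set b : (Fin n → ℂ) → ℂ := (Metric.ball z r).indicator
    fun w => ((c * lor (imP w) ^ (-s) : ℝ) : ℂ) with hb
  have hmeas : Measurable fun w : Fin n → ℂ => ((c * lor (imP w) ^ (-s) : ℝ) : ℂ) := by
    refine measurable_ofReal.comp (measurable_const.mul ?_)
    exact (continuous_lor.measurable.comp measurable_imP).pow_const _
  have hmw : Measurable fun w : Fin n → ℂ => wt s (imP w) := (measurable_wt s).comp measurable_imP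
  have hsub : Metric.ball z r ⊆ Metric.closedBall z r := Metric.ball_subset_closedBall
  refine ⟨b, fun q => ?_, fun F hF => ?_⟩
  · rw [hb, memLp_indicator_iff_restrict hB]
    obtain ⟨M, hM⟩ := (isCompact_closedBall z r).exists_bound_of_continuousOn (hcont s)
    obtain ⟨N, hN⟩ := (isCompact_closedBall z r).exists_bound_of_continuousOn (hcont (-s))
    have : IsFiniteMeasure ((dV n ν).restrict (Metric.ball z r)) := ⟨by
      rw [Measure.restrict_apply_univ, dV_eq, withDensity_apply _ hB]
      calc _ ≤ ∫⁻ w in Metric.ball z r, ENNReal.ofReal M := by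
            refine setLIntegral_mono' hB fun w hw => ?_
            rw [wt_of_mem s (hr (hsub hw))]
            exact ENNReal.ofReal_le_ofReal ((le_abs_self _).trans (hM w (hsub hw)))
        _ < ⊤ := by
            rw [setLIntegral_const]
            exact ENNReal.mul_lt_top ENNReal.ofReal_lt_top measure_ball_lt_top⟩
    refine MemLp.of_bound hmeas.aestronglyMeasurable (|c| * N) ?_
    filter_upwards [ae_restrict_mem hB] with w hw
    rw [norm_real, norm_mul, Real.norm_eq_abs c]
    exact mul_le_mul_of_nonneg_left (hN w (hsub hw)) (abs_nonneg c)
  · rw [pairing, dV_eq, integral_withDensity_eq_integral_toReal_smul hmw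
      (ae_of_all _ fun w => (wt_ne_top _ _).lt_top)]
    have : (fun w => (wt s (imP w)).toReal • (F w * (starRingEnd ℂ) (b w))) =
        (Metric.ball z r).indicator fun w => (c : ℂ) * F w := by
      ext w
      by_cases hw : w ∈ Metric.ball z r
      · have hl := hlor w (hsub hw)
        rw [indicator_of_mem hw, hb, indicator_of_mem hw, wt_of_mem s (hr (hsub hw)),
          ENNReal.toReal_ofReal (Real.rpow_nonneg hl.le _), conj_ofReal, real_smul,
          mul_left_comm, ← ofReal_mul, mul_left_comm, ← Real.rpow_add hl, add_neg_cancel,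
          Real.rpow_zero, mul_one, mul_comm]
      · rw [indicator_of_notMem hw, hb, indicator_of_notMem hw]; simp
    rw [this, integral_indicator hB, integral_const_mul, integral_ball_eq hF hr, real_smul,
      ← mul_assoc, ← ofReal_mul, hc, inv_mul_cancel₀, ofReal_one, one_mul]
    exact (ENNReal.toReal_pos (Metric.measure_ball_pos _ _ hr0).ne' measure_ball_lt_top.ne).ne'

end PointFunctional

section HolomorphicLimit

variable {n : ℕ} [NeZero n]

open Filter Topology Metric in
/-- Pointwise limits of locally uniformly bounded sequences of holomorphic functions are
holomorphic. -/
lemma differentiableOn_of_tendsto {F : ℕ → (Fin n → ℂ) → ℂ} {G : (Fin n → ℂ) → ℂ}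
    (hF : ∀ k, DifferentiableOn ℂ (F k) (tube n))
    (hlim : ∀ z ∈ tube n, Tendsto (fun k => F k z) atTop (𝓝 (G z)))
    (hb : ∀ z ∈ tube n, ∃ U ∈ 𝓝 z, ∃ C : ℝ, ∀ k, ∀ w ∈ U, ‖F k w‖ ≤ C) :
    DifferentiableOn ℂ G (tube n) := by
  intro z₀ hz₀
  obtain ⟨U, hU, C, hC⟩ := hb z₀ hz₀
  obtain ⟨r, hr0, hr⟩ := nhds_basis_closedBall.mem_iff.1
    (inter_mem (isOpen_tube.mem_nhds hz₀) hU)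
  obtain ⟨R, hR0, rfl⟩ : ∃ R, 0 < R ∧ r = 3 * R := ⟨r / 3, by positivity, by ring⟩
  have hsub : ball z₀ (3 * R) ⊆ tube n := fun w hw => (hr (ball_subset_closedBall hw)).1
  set κ : Measure (Fin n → ℂ) := volume.restrict (ball z₀ (3 * R)) with hκ
  have hfin : IsFiniteMeasure κ := ⟨by
    rw [hκ, Measure.restrict_apply_univ]; exact measure_ball_lt_top⟩
  have hmem : ∀ᵐ w ∂κ, w ∈ ball z₀ (3 * R) := ae_restrict_mem measurableSet_ball
  have hFm : ∀ k, AEStronglyMeasurable (F k) κ := fun k =>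
    ((hF k).continuousOn.mono hsub).aestronglyMeasurable measurableSet_ball
  have hlimκ : ∀ᵐ w ∂κ, Tendsto (fun k => F k w) atTop (𝓝 (G w)) := by
    filter_upwards [hmem] with w hw using hlim w (hsub hw)
  have hGm : AEStronglyMeasurable G κ := aestronglyMeasurable_of_tendsto_ae atTop hFm hlimκ
  have hFb : ∀ k, ∀ᵐ w ∂κ, ‖F k w‖ ≤ C := by
    intro k
    filter_upwards [hmem] with w hw using hC k w (hr (ball_subset_closedBall hw)).2
  have hGb : ∀ᵐ w ∂κ, ‖G w‖ ≤ C := by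
    filter_upwards [hlimκ, ae_all_iff.2 hFb] with w h1 h2
    exact le_of_tendsto h1.norm (Eventually.of_forall h2)
  have hFi : ∀ k, Integrable (F k) κ := fun k => Integrable.of_bound (hFm k) C (hFb k)
  have hGi : Integrable G κ := Integrable.of_bound hGm C hGb
  set Δ : ℕ → ℝ := fun k => ∫ w, ‖F k w - G w‖ ∂κ with hΔ
  have hΔ0 : Tendsto Δ atTop (𝓝 0) := by
    have := tendsto_integral_of_dominated_convergence (μ := κ) (F := fun k w => ‖F k w - G w‖)
      (f := fun _ => (0 : ℝ)) (fun _ => C + C) (fun k => ((hFm k).sub hGm).norm)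
      (integrable_const _)
      (fun k => by
        filter_upwards [hFb k, hGb] with w h1 h2
        rw [norm_norm]
        exact (norm_sub_le _ _).trans (add_le_add h1 h2))
      (by
        filter_upwards [hlimκ] with w hw
        simpa using (hw.sub_const (G w)).norm)
    simpa using this
  set V : ℝ := volume.real (ball z₀ R) with hV
  have hV0 : 0 < V := ENNReal.toReal_pos (measure_ball_pos _ _ hR0).ne' measure_ball_lt_top.ne
  have hdist : ∀ k j, ∀ z ∈ ball z₀ (2 * R), ‖F k z - F j z‖ ≤ (Δ k + Δ j) / V := by
    intro k j z hz
    have hz' : dist z z₀ < 2 * R := hz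
    have hzs : ball z R ⊆ ball z₀ (3 * R) := ball_subset_ball' (by linarith)
    have hzc : closedBall z R ⊆ tube n :=
      (closedBall_subset_closedBall' (by linarith)).trans fun w hw => (hr hw).1
    have h1 := integral_ball_eq ((hF k).sub (hF j)) hzc
    have h2 : volume.real (ball z R) = V := by
      simp only [hV, Measure.real, Measure.addHaar_ball_center]
    have hi : Integrable (fun w => ‖F k w - F j w‖) κ := ((hFi k).sub (hFi j)).norm
    rw [le_div_iff₀ hV0]
    calc ‖F k z - F j z‖ * V = ‖∫ w in ball z R, (F k - F j) w‖ := by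
          rw [h1, h2, norm_smul, Real.norm_of_nonneg hV0.le, mul_comm]; rfl
      _ ≤ ∫ w in ball z R, ‖F k w - F j w‖ := norm_integral_le_integral_norm _
      _ ≤ ∫ w, ‖F k w - F j w‖ ∂κ :=
          setIntegral_mono_set hi (ae_of_all _ fun _ => norm_nonneg _) hzs.eventuallyLE
      _ ≤ ∫ w, (‖F k w - G w‖ + ‖F j w - G w‖) ∂κ := by
          refine integral_mono hi (((hFi k).sub hGi).norm.add ((hFi j).sub hGi).norm) fun w => ?_
          simpa [dist_eq_norm] using dist_triangle_right (F k w) (F j w) (G w)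
      _ = Δ k + Δ j := integral_add ((hFi k).sub hGi).norm ((hFi j).sub hGi).norm
  have hΔnn : ∀ k, 0 ≤ Δ k := fun k => integral_nonneg fun _ => norm_nonneg _
  have hfd : ∀ k j, ∀ z ∈ ball z₀ R, ‖fderiv ℂ (F k) z - fderiv ℂ (F j) z‖ ≤
      (2 * ((Δ k + Δ j) / V)) / R := by
    intro k j z hz
    have hz' : dist z z₀ < R := hz
    have hzt : z ∈ tube n := hsub (ball_subset_ball (by linarith) hz)
    have hzs : ball z R ⊆ ball z₀ (2 * R) := ball_subset_ball' (by linarith)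
    have hd : ∀ k, DifferentiableAt ℂ (F k) z := fun k =>
      (hF k).differentiableAt (isOpen_tube.mem_nhds hzt)
    rw [← fderiv_fun_sub (hd k) (hd j)]
    refine norm_fderiv_le_div_of_mapsTo_ball
      (((hF k).sub (hF j)).mono (hzs.trans ((ball_subset_ball (by linarith)).trans hsub)))
      (fun w hw => ?_) hR0
    rw [mem_closedBall, dist_eq_norm, two_mul]
    exact (norm_sub_le _ _).trans (add_le_add (hdist k j w (hzs hw))
      (hdist k j z (hzs (mem_ball_self hR0))))
  have hcauchy : UniformCauchySeqOn (fun k => fderiv ℂ (F k)) atTop (ball z₀ R) := by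
    rw [Metric.uniformCauchySeqOn_iff]
    intro ε hε
    have h1 : ∀ᶠ k in atTop, Δ k < ε * R * V / 4 :=
      hΔ0.eventually_lt_const (by positivity)
    obtain ⟨N, hN⟩ := eventually_atTop.1 h1
    refine ⟨N, fun k hk j hj z hz => ?_⟩
    rw [dist_eq_norm]
    refine (hfd k j z hz).trans_lt ?_
    rw [div_lt_iff₀ hR0, ← mul_div_assoc, div_lt_iff₀ hV0]
    linarith [hN k hk, hN j hj]
  have hex : ∀ z ∈ ball z₀ R, ∃ L, Tendsto (fun k => fderiv ℂ (F k) z) atTop (𝓝 L) :=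
    fun z hz => cauchySeq_tendsto_of_complete (hcauchy.cauchySeq hz)
  choose! g' hg' using hex
  have hunif := hcauchy.tendstoUniformlyOn_of_tendsto hg'
  have hsub1 : ball z₀ R ⊆ tube n := (ball_subset_ball (by linarith)).trans hsub
  refine (hasFDerivAt_of_tendstoUniformlyOn isOpen_ball hunif (fun k z hz =>
    ((hF k).differentiableAt (isOpen_tube.mem_nhds (hsub1 hz))).hasFDerivAt)
    (fun z hz => hlim z (hsub1 hz))
    (mem_ball_self hR0)).differentiableAt.differentiableWithinAt

end HolomorphicLimit

section Closedness

variable {n : ℕ} [NeZero n]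

open Filter Topology

lemma exists_enorm_le_eLpNorm {ν : ℝ} (hν : (n : ℝ) / 2 - 1 < ν) {p : ℝ} (hp : 1 ≤ p)
    {z₀ : Fin n → ℂ} (hz₀ : z₀ ∈ tube n) :
    ∃ U ∈ 𝓝 z₀, U ⊆ tube n ∧ ∃ C : ℝ≥0∞, C ≠ ⊤ ∧ ∀ F : (Fin n → ℂ) → ℂ,
      DifferentiableOn ℂ F (tube n) → ∀ z ∈ U,
      ‖F z‖ₑ ≤ C * eLpNorm F (.ofReal p) (dV n ν) := by
  have hp0 : 0 < p := by linarith
  obtain ⟨U, hU, hUt, C, hC, h⟩ := exists_local_bound hν hp hz₀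
  refine ⟨U, hU, hUt, C ^ (1 / p), ENNReal.rpow_ne_top_of_nonneg (by positivity) hC, ?_⟩
  intro F hF z hz
  have h1 := ENNReal.rpow_le_rpow (h F hF z hz) (show 0 ≤ 1 / p by positivity)
  rwa [← ENNReal.rpow_mul, mul_one_div_cancel hp0.ne', ENNReal.rpow_one,
    ENNReal.mul_rpow_of_nonneg _ _ (by positivity), ← eLpNorm_ofReal_eq hp0] at h1

/-- A bounded sequence in the Bergman space converging pointwise has its limit in the space. -/
lemma memLp_of_tendsto {ν : ℝ} (hν : (n : ℝ) / 2 - 1 < ν) {p : ℝ} (hp : 1 ≤ p)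
    {F : ℕ → (Fin n → ℂ) → ℂ} {G : (Fin n → ℂ) → ℂ} (hF : ∀ k, DifferentiableOn ℂ (F k) (tube n))
    {M : ℝ≥0∞} (hM : M ≠ ⊤) (hFM : ∀ k, eLpNorm (F k) (.ofReal p) (dV n ν) ≤ M)
    (hlim : ∀ z ∈ tube n, Tendsto (fun k => F k z) atTop (𝓝 (G z))) :
    DifferentiableOn ℂ G (tube n) ∧ MemLp G (.ofReal p) (dV n ν) := by
  have hG : DifferentiableOn ℂ G (tube n) := by
    refine differentiableOn_of_tendsto hF hlim fun z hz => ?_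
    obtain ⟨U, hU, -, C, hC, h⟩ := exists_enorm_le_eLpNorm hν hp hz
    refine ⟨U, hU, (C * M).toReal, fun k w hw => ?_⟩
    rw [← toReal_enorm]
    exact ENNReal.toReal_mono (ENNReal.mul_ne_top hC hM)
      ((h _ (hF k) w hw).trans (mul_le_mul_right (hFM k) C))
  refine ⟨hG, aestronglyMeasurable_dV hG, lt_of_le_of_lt ?_ hM.lt_top⟩
  refine Lp.eLpNorm_le_of_ae_tendsto (u := atTop) (Eventually.of_forall hFM)
    (fun k => aestronglyMeasurable_dV (hF k)) ?_
  filter_upwards [ae_mem_tube ν] with z hz using hlim z hz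

/-- The Bergman space as a subspace of `L^p`. -/
def bergmanLp (n : ℕ) [NeZero n] (p : ℝ≥0∞) (ν : ℝ) : Submodule ℂ (Lp ℂ p (dV n ν)) where
  carrier := {f | ∃ F : (Fin n → ℂ) → ℂ, DifferentiableOn ℂ F (tube n) ∧ ⇑f =ᵐ[dV n ν] F}
  add_mem' := by
    rintro f g ⟨F, hF, hfF⟩ ⟨G, hG, hgG⟩
    exact ⟨F + G, hF.add hG, (Lp.coeFn_add f g).trans (hfF.add hgG)⟩
  zero_mem' := ⟨0, differentiableOn_const _, Lp.coeFn_zero _ _ _⟩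
  smul_mem' := by
    rintro c f ⟨F, hF, hfF⟩
    exact ⟨c • F, hF.const_smul c, (Lp.coeFn_smul c f).trans (hfF.const_smul c)⟩

lemma isClosed_bergmanLp {ν : ℝ} (hν : (n : ℝ) / 2 - 1 < ν) {p : ℝ≥0∞} [hp : Fact (1 ≤ p)]
    (hpt : p ≠ ⊤) : IsClosed (bergmanLp n p ν : Set (Lp ℂ p (dV n ν))) := by
  have hP : ENNReal.ofReal p.toReal = p := ENNReal.ofReal_toReal hpt
  have hp1 : 1 ≤ p.toReal := by
    rw [← ENNReal.toReal_one]; exact ENNReal.toReal_mono hpt hp.out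
  refine IsSeqClosed.isClosed fun u f hu huf => ?_
  choose F hF huF using hu
  have hsub : ∀ k j, eLpNorm (F k - F j) p (dV n ν) = ‖u k - u j‖ₑ := fun k j => by
    rw [Lp.enorm_def]
    exact eLpNorm_congr_ae (((huF k).symm.sub (huF j).symm).trans (Lp.coeFn_sub _ _).symm)
  have hcau : ∀ z ∈ tube n, CauchySeq fun k => F k z := by
    intro z hz
    obtain ⟨U, hU, -, C, hC, h⟩ := exists_enorm_le_eLpNorm hν hp1 hz
    rw [Metric.cauchySeq_iff]
    intro ε hε
    obtain ⟨N, hN⟩ := Metric.cauchySeq_iff.1 huf.cauchySeq (ε / (C.toReal + 1)) (by positivity)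
    refine ⟨N, fun k hk j hj => ?_⟩
    have h1 := h _ ((hF k).sub (hF j)) z (mem_of_mem_nhds hU)
    rw [hP, hsub] at h1
    have h2 := ENNReal.toReal_mono (ENNReal.mul_ne_top hC enorm_ne_top) h1
    rw [ENNReal.toReal_mul, toReal_enorm, toReal_enorm] at h2
    have h3 := hN k hk j hj
    rw [dist_eq_norm, lt_div_iff₀ (by positivity)] at h3
    rw [dist_eq_norm]
    refine h2.trans_lt (lt_of_le_of_lt ?_ h3)
    nlinarith [norm_nonneg (u k - u j)]
  have hex : ∀ z ∈ tube n, ∃ w, Tendsto (fun k => F k z) atTop (𝓝 w) :=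
    fun z hz => cauchySeq_tendsto_of_complete (hcau z hz)
  choose! G hG using hex
  obtain ⟨M, hM⟩ := huf.norm.bddAbove_range
  have hFM : ∀ k, eLpNorm (F k) p (dV n ν) ≤ ENNReal.ofReal M := fun k => by
    rw [← eLpNorm_congr_ae (huF k), ← Lp.enorm_def, ← ofReal_norm]
    exact ENNReal.ofReal_le_ofReal (hM (mem_range_self k))
  refine ⟨G, (memLp_of_tendsto hν hp1 hF ENNReal.ofReal_ne_top (hP.symm ▸ hFM) hG).1, ?_⟩
  obtain ⟨ns, hns, hae⟩ := (tendstoInMeasure_of_tendsto_Lp huf).exists_seq_tendsto_ae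
  filter_upwards [hae, ae_all_iff.2 huF, ae_mem_tube ν] with z h1 h2 h3
  simp only [h2] at h1
  exact tendsto_nhds_unique h1 ((hG z h3).comp hns.tendsto_atTop)

/-- Holomorphic functions which agree almost everywhere agree. -/
lemma eqOn_of_ae_eq {ν : ℝ} (hν : (n : ℝ) / 2 - 1 < ν) {F G : (Fin n → ℂ) → ℂ}
    (hF : DifferentiableOn ℂ F (tube n)) (hG : DifferentiableOn ℂ G (tube n))
    (h : F =ᵐ[dV n ν] G) : EqOn F G (tube n) := by
  intro z hz
  obtain ⟨U, hU, -, C, hC, hb⟩ := exists_enorm_le_eLpNorm hν le_rfl hz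
  have h1 := hb _ (hF.sub hG) z (mem_of_mem_nhds hU)
  have h2 : F - G =ᵐ[dV n ν] 0 := by
    filter_upwards [h] with w hw using sub_eq_zero.2 hw
  rw [eLpNorm_congr_ae h2, eLpNorm_zero, mul_zero, nonpos_iff_eq_zero, enorm_eq_zero] at h1
  exact sub_eq_zero.1 h1

end Closedness

section Projection

variable {n : ℕ} [NeZero n]

open scoped InnerProductSpace

lemma inner_toLp {α : Type*} [MeasurableSpace α] {μ : Measure α} {f g : α → ℂ}
    (hf : MemLp f 2 μ) (hg : MemLp g 2 μ) : ⟪hg.toLp g, hf.toLp f⟫_ℂ = pairing μ f g := by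
  rw [L2.inner_def, pairing]
  refine integral_congr_ae ?_
  filter_upwards [hf.coeFn_toLp, hg.coeFn_toLp] with z h1 h2
  rw [h1, h2]; rfl

/-- Existence of the Bergman projection. -/
lemma exists_bergman_projection {ν : ℝ} (hν : (n : ℝ) / 2 - 1 < ν) {f : (Fin n → ℂ) → ℂ}
    (hf : MemLp f 2 (dV n ν)) :
    ∃ g : (Fin n → ℂ) → ℂ, DifferentiableOn ℂ g (tube n) ∧ MemLp g 2 (dV n ν) ∧
      ∀ h : (Fin n → ℂ) → ℂ, DifferentiableOn ℂ h (tube n) → MemLp h 2 (dV n ν) →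
        pairing (dV n ν) f h = pairing (dV n ν) g h := by
  have hclosed := isClosed_bergmanLp hν (p := 2) (by simp)
  have : CompleteSpace (bergmanLp n 2 ν) := hclosed.completeSpace_coe
  obtain ⟨g, hg, hgF⟩ := ((bergmanLp n 2 ν).orthogonalProjectionOnto (hf.toLp f)).2
  have hg2 : MemLp g 2 (dV n ν) := (memLp_congr_ae hgF).1 (Lp.memLp _)
  refine ⟨g, hg, hg2, fun h hh hh2 => ?_⟩
  have hmem : hh2.toLp h ∈ bergmanLp n 2 ν := ⟨h, hh, hh2.coeFn_toLp⟩
  have h1 := (bergmanLp n 2 ν).sub_starProjection_mem_orthogonal (hf.toLp f) _ hmem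
  have h2 : (bergmanLp n 2 ν).starProjection (hf.toLp f) = hg2.toLp g := by
    refine Lp.ext (hgF.trans hg2.coeFn_toLp.symm)
  rw [h2, inner_sub_right, sub_eq_zero, inner_toLp, inner_toLp] at h1
  exact h1

/-- Riesz representation on the Hilbert space `A²`. -/
lemma exists_riesz {ν : ℝ} (hν : (n : ℝ) / 2 - 1 < ν) {φ : ((Fin n → ℂ) → ℂ) → ℂ}
    (hadd : ∀ F G : (Fin n → ℂ) → ℂ, DifferentiableOn ℂ F (tube n) → MemLp F 2 (dV n ν) →
      DifferentiableOn ℂ G (tube n) → MemLp G 2 (dV n ν) → φ (F + G) = φ F + φ G)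
    (hsmul : ∀ (c : ℂ) (F : (Fin n → ℂ) → ℂ), DifferentiableOn ℂ F (tube n) →
      MemLp F 2 (dV n ν) → φ (fun z => c * F z) = c * φ F)
    {C : ℝ} (hC : ∀ F : (Fin n → ℂ) → ℂ, DifferentiableOn ℂ F (tube n) → MemLp F 2 (dV n ν) →
      ‖φ F‖ ≤ C * (eLpNorm F 2 (dV n ν)).toReal) :
    ∃ F : (Fin n → ℂ) → ℂ, DifferentiableOn ℂ F (tube n) ∧ MemLp F 2 (dV n ν) ∧
      ∀ G : (Fin n → ℂ) → ℂ, DifferentiableOn ℂ G (tube n) → MemLp G 2 (dV n ν) →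
        φ G = pairing (dV n ν) G F := by
  have hclosed := isClosed_bergmanLp hν (p := 2) (by simp)
  have : CompleteSpace (bergmanLp n 2 ν) := hclosed.completeSpace_coe
  have hcongr : ∀ F G : (Fin n → ℂ) → ℂ, DifferentiableOn ℂ F (tube n) → MemLp F 2 (dV n ν) →
      DifferentiableOn ℂ G (tube n) → MemLp G 2 (dV n ν) → F =ᵐ[dV n ν] G → φ F = φ G := by
    intro F G hF hF2 hG hG2 h
    have h0 : F - G =ᵐ[dV n ν] 0 := by filter_upwards [h] with w hw using sub_eq_zero.2 hw
    have h1 := hC (F - G) (hF.sub hG) (hF2.sub hG2)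
    rw [eLpNorm_congr_ae h0, eLpNorm_zero, ENNReal.toReal_zero, mul_zero, norm_le_zero_iff] at h1
    have h2 := hadd (F - G) G (hF.sub hG) (hF2.sub hG2) hG hG2
    rwa [sub_add_cancel, h1, zero_add] at h2
  choose rep hrep hae using fun f : bergmanLp n 2 ν => f.2
  have hrep2 : ∀ f, MemLp (rep f) 2 (dV n ν) := fun f => (memLp_congr_ae (hae f)).1 (Lp.memLp _)
  let L : bergmanLp n 2 ν →ₗ[ℂ] ℂ :=
    { toFun := fun f => φ (rep f)
      map_add' := fun f g => by
        rw [← hadd _ _ (hrep f) (hrep2 f) (hrep g) (hrep2 g)]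
        refine hcongr _ _ (hrep _) (hrep2 _) ((hrep f).add (hrep g)) ((hrep2 f).add (hrep2 g)) ?_
        exact (hae _).symm.trans ((Lp.coeFn_add _ _).trans ((hae f).add (hae g)))
      map_smul' := fun c f => by
        rw [RingHom.id_apply, smul_eq_mul, ← hsmul c _ (hrep f) (hrep2 f)]
        refine hcongr _ _ (hrep _) (hrep2 _) ((hrep f).const_smul c) ((hrep2 f).const_smul c) ?_
        exact (hae _).symm.trans ((Lp.coeFn_smul _ _).trans ((hae f).const_smul c)) }
  let Lc : StrongDual ℂ (bergmanLp n 2 ν) := L.mkContinuous C fun f => by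
    refine (hC _ (hrep f) (hrep2 f)).trans (le_of_eq ?_)
    rw [← eLpNorm_congr_ae (hae f)]; rfl
  set f := (InnerProductSpace.toDual ℂ (bergmanLp n 2 ν)).symm Lc with hf
  refine ⟨rep f, hrep f, hrep2 f, fun G hG hG2 => ?_⟩
  let g : bergmanLp n 2 ν := ⟨hG2.toLp G, G, hG, hG2.coeFn_toLp⟩
  have h1 : ⟪f, g⟫_ℂ = Lc g := InnerProductSpace.toDual_symm_apply
  have h2 : Lc g = φ G :=
    hcongr _ _ (hrep g) (hrep2 g) hG hG2 ((hae g).symm.trans hG2.coeFn_toLp)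
  have h3 : (hrep2 f).toLp (rep f) = f := Lp.ext ((hrep2 f).coeFn_toLp.trans (hae f).symm)
  rw [← h2, ← h1, ← inner_toLp hG2 (hrep2 f), h3]; rfl

end Projection

section SelfAdjoint

variable {n : ℕ} [NeZero n]

/-- The integrand of the contour integral used to move imaginary translations. -/
def slideK (ε : ℝ) (F G : (Fin n → ℂ) → ℂ) (z : Fin n → ℂ) (t : ℂ) : ℂ :=
  tr t G z * (starRingEnd ℂ) (tr ((starRingEnd ℂ) t + ε * I) F z)

lemma differentiableAt_tr_param {F : (Fin n → ℂ) → ℂ} (hF : DifferentiableOn ℂ F (tube n))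
    {z : Fin n → ℂ} (hz : z ∈ tube n) {t : ℂ} (ht : 0 ≤ t.im) :
    DifferentiableAt ℂ (fun t => tr t F z) t := by
  have h := hF.differentiableAt (isOpen_tube.mem_nhds (add_smul_eC_mem hz ht))
  exact h.comp t (f := fun t : ℂ => z + t • eC n) (by fun_prop)

lemma differentiableAt_slideK {ε : ℝ} {F G : (Fin n → ℂ) → ℂ}
    (hF : DifferentiableOn ℂ F (tube n)) (hG : DifferentiableOn ℂ G (tube n))
    {z : Fin n → ℂ} (hz : z ∈ tube n) {t : ℂ} (ht : 0 ≤ t.im) (htε : t.im ≤ ε) :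
    DifferentiableAt ℂ (slideK ε F G z) t := by
  refine (differentiableAt_tr_param hG hz ht).mul ?_
  have h : DifferentiableAt ℂ (fun s : ℂ => tr (s + ε * I) F z) ((starRingEnd ℂ) t) := by
    have := differentiableAt_tr_param hF hz (t := (starRingEnd ℂ) t + ε * I) (by simpa using htε)
    exact this.comp ((starRingEnd ℂ) t) (f := fun s : ℂ => s + ε * I) (by fun_prop)
  have h2 := h.conj_conj
  rw [conj_conj] at h2
  exact h2

lemma slideK_rect {ε : ℝ} (hε : 0 < ε) {F G : (Fin n → ℂ) → ℂ}
    (hF : DifferentiableOn ℂ F (tube n)) (hG : DifferentiableOn ℂ G (tube n))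
    {z : Fin n → ℂ} (hz : z ∈ tube n) :
    (∫ x : ℝ in 0..1, slideK ε F G z x) - (∫ x : ℝ in 0..1, slideK ε F G z (x + ε * I)) +
      I * (∫ y : ℝ in 0..ε, slideK ε F G z (1 + y * I)) -
      I * (∫ y : ℝ in 0..ε, slideK ε F G z (y * I)) = 0 := by
  have h := Complex.integral_boundary_rect_eq_zero_of_differentiableOn (slideK ε F G z)
    0 (1 + ε * I) ?_
  · simpa using h
  · intro t ht
    have h2 := ht.2
    simp only [zero_im, add_im, one_im, mul_im, ofReal_re, I_im, mul_one, ofReal_im, I_re,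
      mul_zero, add_zero, zero_add, mem_preimage, uIcc_of_le hε.le, mem_Icc] at h2
    exact (differentiableAt_slideK hF hG hz h2.1 h2.2).differentiableWithinAt

lemma slideK_ofReal (ε : ℝ) (F G : (Fin n → ℂ) → ℂ) (z : Fin n → ℂ) (x : ℝ) :
    slideK ε F G z x = (fun w => G w * (starRingEnd ℂ) (tr (ε * I) F w)) (z + (x : ℂ) • eC n) := by
  simp only [slideK, tr, conj_ofReal, add_smul, add_assoc]

lemma slideK_ofReal_add (ε : ℝ) (F G : (Fin n → ℂ) → ℂ) (z : Fin n → ℂ) (x : ℝ) :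
    slideK ε F G z (x + ε * I) =
      (fun w => tr (ε * I) G w * (starRingEnd ℂ) (F w)) (z + (x : ℂ) • eC n) := by
  simp only [slideK, tr, map_add, map_mul, conj_ofReal, conj_I, add_smul, add_assoc]
  congr 4
  simp

lemma slideK_one_add (ε : ℝ) (F G : (Fin n → ℂ) → ℂ) (z : Fin n → ℂ) (y : ℝ) :
    slideK ε F G z (1 + y * I) = slideK ε F G (z + ((1 : ℝ) : ℂ) • eC n) (y * I) := by
  simp only [slideK, tr, map_add, map_one, add_smul, add_assoc, ofReal_one]

lemma slideK_mul_I (ε : ℝ) (F G : (Fin n → ℂ) → ℂ) (z : Fin n → ℂ) (y : ℝ) :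
    slideK ε F G z (y * I) =
      tr (y * I) G z * (starRingEnd ℂ) (tr ((ε - y : ℝ) * I) F z) := by
  simp only [slideK]
  congr 3
  simp; ring

lemma measurePreserving_add_ofReal (ν x : ℝ) :
    MeasurePreserving (fun z : Fin n → ℂ => z + (x : ℂ) • eC n) (dV n ν) (dV n ν) := by
  have hm : Measurable fun z : Fin n → ℂ => z + (x : ℂ) • eC n := by fun_prop
  refine ⟨hm, Measure.ext_of_lintegral _ fun f hf => ?_⟩
  rw [lintegral_map hf hm, lintegral_dV (f := fun z => f (z + (x : ℂ) • eC n)) (hf.comp hm),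
    lintegral_dV hf]
  have h : ∀ z : Fin n → ℂ, imP (z + (x : ℂ) • eC n) = imP z := fun z => by
    rw [imP_add, imP_smul_eC]; simp
  rw [← lintegral_add_right_eq_self (fun z => f z * wt (ν - (n : ℝ) / 2) (imP z))
    ((x : ℂ) • eC n)]
  simp only [h]

lemma integrable_prod_of_bound {α : Type*} [MeasurableSpace α] {μ : Measure α} [SigmaFinite μ]
    {κ : α × ℝ → ℂ} (hm : Measurable κ) {a b : ℝ} {N : ℝ≥0∞} (hN : N ≠ ⊤)
    (h : ∀ᵐ y ∂(volume.restrict (Ioc a b)), ∫⁻ z, ‖κ (z, y)‖ₑ ∂μ ≤ N) :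
    Integrable κ (μ.prod (volume.restrict (Ioc a b))) := by
  refine ⟨hm.aestronglyMeasurable, ?_⟩
  rw [HasFiniteIntegral, lintegral_prod_symm _ hm.enorm.aemeasurable]
  calc _ ≤ ∫⁻ _, N ∂(volume.restrict (Ioc a b)) := lintegral_mono_ae h
    _ < ⊤ := by
      rw [lintegral_const]
      exact ENNReal.mul_lt_top hN.lt_top (by simp)

lemma integral_translate_average {ν : ℝ} {Φ : (Fin n → ℂ) → ℂ} (hm : Measurable Φ)
    (hΦ : Integrable Φ (dV n ν)) :
    Integrable (fun z => ∫ x : ℝ in 0..1, Φ (z + (x : ℂ) • eC n)) (dV n ν) ∧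
      ∫ z, (∫ x : ℝ in 0..1, Φ (z + (x : ℂ) • eC n)) ∂(dV n ν) = ∫ z, Φ z ∂(dV n ν) := by
  have hκ : Integrable (fun q : (Fin n → ℂ) × ℝ => Φ (q.1 + (q.2 : ℂ) • eC n))
      ((dV n ν).prod (volume.restrict (Ioc 0 1))) := by
    refine integrable_prod_of_bound (hm.comp (by fun_prop)) hΦ.2.ne (ae_of_all _ fun y => ?_)
    exact ((measurePreserving_add_ofReal ν y).lintegral_comp hm.enorm).le
  simp only [intervalIntegral.integral_of_le zero_le_one]
  refine ⟨hκ.integral_prod_left, ?_⟩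
  rw [integral_integral_swap hκ]
  have : ∀ x : ℝ, ∫ z, Φ (z + (x : ℂ) • eC n) ∂(dV n ν) = ∫ z, Φ z ∂(dV n ν) := fun x => by
    have h := integral_map (μ := dV n ν) (measurePreserving_add_ofReal ν x).measurable.aemeasurable
      (f := Φ) hm.aestronglyMeasurable
    rw [(measurePreserving_add_ofReal ν x).map_eq] at h
    exact h.symm
  simp only [this, integral_const]
  simp

lemma integrable_vertical (hn : 3 ≤ n) {ν : ℝ} (hν : (n : ℝ) / 2 - 1 < ν) {p q : ℝ}
    (hpq : p.HolderConjugate q) {ε : ℝ} (hε : 0 < ε) {F G : (Fin n → ℂ) → ℂ}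
    (hF : DifferentiableOn ℂ F (tube n)) (hG : DifferentiableOn ℂ G (tube n))
    (hFm : Measurable F) (hGm : Measurable G) (hFq : MemLp F (.ofReal q) (dV n ν))
    (hGp : MemLp G (.ofReal p) (dV n ν)) :
    Integrable (fun z => ∫ y : ℝ in 0..ε, slideK ε F G z (y * I)) (dV n ν) := by
  have hκ : Integrable (fun r : (Fin n → ℂ) × ℝ => slideK ε F G r.1 (r.2 * I))
      ((dV n ν).prod (volume.restrict (Ioc 0 ε))) := by
    refine integrable_prod_of_bound (N := (trC ν n ^ (1 / p) * eLpNorm G (.ofReal p) (dV n ν)) *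
      (trC ν n ^ (1 / q) * eLpNorm F (.ofReal q) (dV n ν))) ?_ ?_ ?_
    · simp only [slideK_mul_I, tr]
      refine (hGm.comp (by fun_prop)).mul (continuous_conj.measurable.comp (hFm.comp ?_))
      fun_prop
    · refine ENNReal.mul_ne_top (ENNReal.mul_ne_top ?_ hGp.2.ne) (ENNReal.mul_ne_top ?_ hFq.2.ne)
      · exact ENNReal.rpow_ne_top_of_nonneg (by have := hpq.pos; positivity) (trC_ne_top ν n)
      · exact ENNReal.rpow_ne_top_of_nonneg (by have := hpq.symm.pos; positivity) (trC_ne_top ν n)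
    · have h0 : ∀ᵐ y ∂(volume.restrict (Ioc 0 ε)), y ∈ Ioo 0 ε := by
        rw [← Measure.restrict_congr_set Ioo_ae_eq_Ioc]
        exact ae_restrict_mem measurableSet_Ioo
      filter_upwards [h0] with y hy
      simp only [slideK_mul_I]
      rw [← eLpNorm_one_eq_lintegral_enorm]
      have hi : ∀ t : ℝ, 0 < t → 0 ≤ ((t : ℂ) * I).im := fun t ht => by simpa using ht.le
      have hy2 : 0 < ε - y := sub_pos.2 hy.2
      refine (eLpNorm_mul_conj_le hpq
        (aestronglyMeasurable_dV (tr_differentiableOn hG (hi y hy.1)))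
        (aestronglyMeasurable_dV (tr_differentiableOn hF (hi _ hy2)))).trans ?_
      exact mul_le_mul' (eLpNorm_tr_le hn hν hpq.lt.le hG hy.1)
        (eLpNorm_tr_le hn hν hpq.symm.lt.le hF hy2)
  simp only [intervalIntegral.integral_of_le hε.le]
  exact hκ.integral_prod_left

lemma memLp_tr_self (hn : 3 ≤ n) {ν : ℝ} (hν : (n : ℝ) / 2 - 1 < ν) {p : ℝ} (hp : 1 ≤ p)
    {F : (Fin n → ℂ) → ℂ} (hF : DifferentiableOn ℂ F (tube n))
    (hFp : MemLp F (.ofReal p) (dV n ν)) {ε : ℝ} (hε : 0 < ε) :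
    MemLp (tr (ε * I) F) (.ofReal p) (dV n ν) :=
  memLp_tr hn hν hp le_rfl hF hFp hε

lemma pairing_tr_of_measurable (hn : 3 ≤ n) {ν : ℝ} (hν : (n : ℝ) / 2 - 1 < ν) {p q : ℝ}
    (hpq : p.HolderConjugate q) {ε : ℝ} (hε : 0 < ε) {F G : (Fin n → ℂ) → ℂ}
    (hF : DifferentiableOn ℂ F (tube n)) (hG : DifferentiableOn ℂ G (tube n))
    (hFm : Measurable F) (hGm : Measurable G) (hFq : MemLp F (.ofReal q) (dV n ν))
    (hGp : MemLp G (.ofReal p) (dV n ν)) :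
    pairing (dV n ν) (tr (ε * I) G) F = pairing (dV n ν) G (tr (ε * I) F) := by
  have hmt : ∀ {H : (Fin n → ℂ) → ℂ}, Measurable H → Measurable (tr (ε * I) H) :=
    fun h => h.comp (by fun_prop)
  have hA := integral_translate_average (Φ := fun z => G z * (starRingEnd ℂ) (tr (ε * I) F z))
    (hGm.mul (continuous_conj.measurable.comp (hmt hFm)))
    (integrable_pairing hpq hGp (memLp_tr_self hn hν hpq.symm.lt.le hF hFq hε))
  have hB := integral_translate_average (Φ := fun z => tr (ε * I) G z * (starRingEnd ℂ) (F z))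
    ((hmt hGm).mul (continuous_conj.measurable.comp hFm))
    (integrable_pairing hpq (memLp_tr_self hn hν hpq.lt.le hG hGp hε) hFq)
  have hJ := integrable_vertical hn hν hpq hε hF hG hFm hGm hFq hGp
  have hJ1 : Integrable (fun z => ∫ y : ℝ in 0..ε, slideK ε F G z (1 + y * I)) (dV n ν) := by
    simp only [slideK_one_add]
    have h := (measurePreserving_add_ofReal (n := n) ν 1).integrable_comp hJ.1
    exact h.2 hJ
  have hJeq : ∫ z, (∫ y : ℝ in 0..ε, slideK ε F G z (1 + y * I)) ∂(dV n ν) =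
      ∫ z, (∫ y : ℝ in 0..ε, slideK ε F G z (y * I)) ∂(dV n ν) := by
    simp only [slideK_one_add]
    have h := integral_map (μ := dV n ν)
      (measurePreserving_add_ofReal ν 1).measurable.aemeasurable
      (f := fun z => ∫ y : ℝ in 0..ε, slideK ε F G z (y * I))
      (by rw [(measurePreserving_add_ofReal ν 1).map_eq]; exact hJ.1)
    rw [(measurePreserving_add_ofReal ν 1).map_eq] at h
    exact h.symm
  have key : ∀ᵐ z ∂(dV n ν), (∫ x : ℝ in 0..1, slideK ε F G z (x + ε * I)) =
      (∫ x : ℝ in 0..1, slideK ε F G z x) +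
      I * ((∫ y : ℝ in 0..ε, slideK ε F G z (1 + y * I)) -
        ∫ y : ℝ in 0..ε, slideK ε F G z (y * I)) := by
    filter_upwards [ae_mem_tube ν] with z hz
    linear_combination -(slideK_rect hε hF hG hz)
  have h := integral_congr_ae key
  simp only [slideK_ofReal, slideK_ofReal_add] at h
  have hJd : Integrable (fun z => I * ((∫ y : ℝ in 0..ε, slideK ε F G z (1 + y * I)) -
      ∫ y : ℝ in 0..ε, slideK ε F G z (y * I))) (dV n ν) := (hJ1.sub hJ).const_mul I
  rw [integral_add hA.1 hJd, integral_const_mul, integral_sub hJ1 hJ, hJeq,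
    sub_self, mul_zero, add_zero] at h
  exact hB.2.symm.trans (h.trans hA.2)

/-- Imaginary translations along `e` are symmetric for the duality pairing. -/
lemma pairing_tr (hn : 3 ≤ n) {ν : ℝ} (hν : (n : ℝ) / 2 - 1 < ν) {p q : ℝ}
    (hpq : p.HolderConjugate q) {ε : ℝ} (hε : 0 < ε) {F G : (Fin n → ℂ) → ℂ}
    (hF : DifferentiableOn ℂ F (tube n)) (hG : DifferentiableOn ℂ G (tube n))
    (hFq : MemLp F (.ofReal q) (dV n ν)) (hGp : MemLp G (.ofReal p) (dV n ν)) :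
    pairing (dV n ν) (tr (ε * I) G) F = pairing (dV n ν) G (tr (ε * I) F) := by
  have hi : ∀ H : (Fin n → ℂ) → ℂ, (tube n).indicator H =ᵐ[dV n ν] H := fun H => by
    filter_upwards [ae_mem_tube ν] with z hz
    exact indicator_of_mem hz H
  have hit : ∀ H : (Fin n → ℂ) → ℂ, ∀ z ∈ tube n,
      tr (ε * I) ((tube n).indicator H) z = tr (ε * I) H z := fun H z hz =>
    indicator_of_mem (add_smul_eC_mem hz (by simpa using hε.le)) H
  have h := pairing_tr_of_measurable hn hν hpq hε (differentiableOn_indicator_tube hF)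
    (differentiableOn_indicator_tube hG) (measurable_indicator_tube hF)
    (measurable_indicator_tube hG) (hFq.ae_eq (hi F).symm) (hGp.ae_eq (hi G).symm)
  convert h using 1 <;>
  · refine integral_congr_ae ?_
    filter_upwards [ae_mem_tube ν] with z hz
    simp only [hit _ z hz, indicator_of_mem hz]

end SelfAdjoint

section Duality

variable {n : ℕ} [NeZero n]

open Filter Topology

lemma memA.memLp {p ν : ℝ} {F : (Fin n → ℂ) → ℂ} (hF : memA n p ν F) (hp : 0 < p) :
    MemLp F (.ofReal p) (dV n ν) := ((memA_iff hp F).1 hF).2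

lemma memA_of_memLp {p ν : ℝ} (hp : 0 < p) {F : (Fin n → ℂ) → ℂ}
    (hF : DifferentiableOn ℂ F (tube n)) (hFp : MemLp F (.ofReal p) (dV n ν)) : memA n p ν F :=
  (memA_iff hp F).2 ⟨hF, hFp⟩

lemma memA.sub {p ν : ℝ} (hp : 0 < p) {F G : (Fin n → ℂ) → ℂ} (hF : memA n p ν F)
    (hG : memA n p ν G) : memA n p ν (F - G) :=
  memA_of_memLp hp (hF.1.sub hG.1) ((hF.memLp hp).sub (hG.memLp hp))

lemma memA_reg (hn : 3 ≤ n) {ν : ℝ} (hν : (n : ℝ) / 2 - 1 < ν) {a b : ℝ} (ha : 1 ≤ a)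
    (hb : 1 ≤ b) (k : ℕ) {F : (Fin n → ℂ) → ℂ} (hF : memA n a ν F) : memA n b ν (reg ν k F) :=
  memA_of_memLp (by linarith) (reg_differentiableOn ν k hF.1)
    (memLp_reg hn hν ha hb k hF.1 (hF.memLp (by linarith)))

lemma memA_tr (hn : 3 ≤ n) {ν : ℝ} (hν : (n : ℝ) / 2 - 1 < ν) {a b : ℝ} (ha : 1 ≤ a)
    (hab : a ≤ b) {ε : ℝ} (hε : 0 < ε) {F : (Fin n → ℂ) → ℂ} (hF : memA n a ν F) :
    memA n b ν (tr (ε * I) F) :=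
  memA_of_memLp (by linarith) (tr_differentiableOn hF.1 (by simpa using hε.le))
    (memLp_tr hn hν ha hab hF.1 (hF.memLp (by linarith)) hε)

lemma exists_isProj {ν : ℝ} (hν : (n : ℝ) / 2 - 1 < ν) {f : (Fin n → ℂ) → ℂ}
    (hf : MemLp f (.ofReal 2) (dV n ν)) : ∃ g, isProj n ν f g := by
  rw [ENNReal.ofReal_ofNat] at hf
  obtain ⟨g, hg, hg2, h⟩ := exists_bergman_projection hν hf
  refine ⟨g, memA_of_memLp two_pos hg (by rwa [ENNReal.ofReal_ofNat]), fun F hF => ?_⟩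
  exact h F hF.1 (by simpa using hF.memLp two_pos)

lemma isProj.pairing_eq {ν : ℝ} {f g h : (Fin n → ℂ) → ℂ} (hfg : isProj n ν f g)
    (hh : memA n 2 ν h) : pairing (dV n ν) f h = pairing (dV n ν) g h := hfg.2 h hh

lemma projBounded_iff {p ν : ℝ} (hp : 0 < p) :
    projBounded n p ν ↔ ∃ C : ℝ≥0∞, C ≠ ⊤ ∧ ∀ f g : (Fin n → ℂ) → ℂ,
      MemLp f (.ofReal 2) (dV n ν) → MemLp f (.ofReal p) (dV n ν) → isProj n ν f g →
      eLpNorm g (.ofReal p) (dV n ν) ≤ C * eLpNorm f (.ofReal p) (dV n ν) := by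
  constructor
  · rintro ⟨C, -, h⟩
    refine ⟨.ofReal C, by simp, fun f g hf2 hfp hfg => ?_⟩
    rw [← lpNorm_eq hp, ← lpNorm_eq hp]
    exact h f g hf2.1 ((lpInt_lt_top_iff two_pos f).2 hf2.2) ((lpInt_lt_top_iff hp f).2 hfp.2) hfg
  · rintro ⟨C, hC, h⟩
    refine ⟨C.toReal + 1, by positivity, fun f g hfm hf2 hfp hfg => ?_⟩
    rw [lpNorm_eq hp, lpNorm_eq hp]
    refine (h f g ⟨hfm, (lpInt_lt_top_iff two_pos f).1 hf2⟩ ⟨hfm, (lpInt_lt_top_iff hp f).1 hfp⟩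
      hfg).trans (mul_le_mul_left ?_ _)
    calc C = ENNReal.ofReal C.toReal := (ENNReal.ofReal_toReal hC).symm
      _ ≤ _ := ENNReal.ofReal_le_ofReal (by linarith)

lemma tendsto_pairing_reg (hn : 3 ≤ n) {ν : ℝ} (hν : (n : ℝ) / 2 - 1 < ν) {p q : ℝ}
    (hpq : p.HolderConjugate q) {F h : (Fin n → ℂ) → ℂ} (hF : memA n q ν F)
    (hh : MemLp h (.ofReal p) (dV n ν)) :
    Tendsto (fun k => pairing (dV n ν) h (reg ν k F)) atTop (𝓝 (pairing (dV n ν) h F)) := by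
  have hq := hpq.symm.lt.le
  refine tendsto_pairing_of_ae hpq
    (M := trC ν n ^ (1 / q) * eLpNorm F (.ofReal q) (dV n ν)) ?_
    (fun k => aestronglyMeasurable_dV (reg_differentiableOn ν k hF.1))
    (fun k => eLpNorm_reg_le hn hν hq k hF.1) ?_ hh
  · refine ENNReal.mul_ne_top (ENNReal.rpow_ne_top_of_nonneg ?_ (trC_ne_top ν n))
      (hF.memLp hpq.symm.pos).2.ne
    have := hpq.symm.pos
    positivity
  · filter_upwards [ae_mem_tube ν] with z hz using tendsto_reg ν hF.1 hz

lemma eq_zero_of_pairing_eq_zero_of_bounded (hn : 3 ≤ n) {ν : ℝ} (hν : (n : ℝ) / 2 - 1 < ν)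
    {p q : ℝ} (hpq : p.HolderConjugate q) (hP : projBounded n p ν) {D : (Fin n → ℂ) → ℂ}
    (hD : memA n q ν D) (h : ∀ G, memA n p ν G → pairing (dV n ν) G D = 0) :
    ∀ z ∈ tube n, D z = 0 := by
  intro z hz
  obtain ⟨C, hC, hP⟩ := (projBounded_iff hpq.pos).1 hP
  obtain ⟨b, hb, hbz⟩ := exists_pointFunctional ν hz
  obtain ⟨g, hg⟩ := exists_isProj hν (hb (.ofReal 2))
  have hgp : memA n p ν g := memA_of_memLp hpq.pos hg.1.1 ⟨aestronglyMeasurable_dV hg.1.1,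
    (hP b g (hb _) (hb _) hg).trans_lt (ENNReal.mul_lt_top hC.lt_top (hb _).2)⟩
  have h1 := tendsto_pairing_reg hn hν hpq hD (hb (.ofReal p))
  have h2 := tendsto_pairing_reg hn hν hpq hD (hgp.memLp hpq.pos)
  rw [h g hgp] at h2
  have h3 : ∀ k, pairing (dV n ν) b (reg ν k D) = pairing (dV n ν) g (reg ν k D) := fun k =>
    hg.pairing_eq (memA_reg hn hν hpq.symm.lt.le one_le_two k hD)
  simp only [h3] at h1
  have h4 := tendsto_nhds_unique h1 h2
  rw [← hbz D hD.1, ← conj_pairing, h4, map_zero]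

lemma isBddFunc.map_sub {p ν : ℝ} (hp : 0 < p) {γ : ((Fin n → ℂ) → ℂ) → ℂ}
    (hγ : isBddFunc n p ν γ) {F G : (Fin n → ℂ) → ℂ} (hF : memA n p ν F) (hG : memA n p ν G) :
    γ (F - G) = γ F - γ G := by
  have := hγ.1 (F - G) G (hF.sub hp hG) hG
  rw [sub_add_cancel] at this
  rw [this, add_sub_cancel_right]

lemma isBddFunc.exists_enorm_le {p ν : ℝ} (hp : 0 < p) {γ : ((Fin n → ℂ) → ℂ) → ℂ}
    (hγ : isBddFunc n p ν γ) : ∃ C : ℝ≥0∞, C ≠ ⊤ ∧ ∀ F, memA n p ν F →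
      ‖γ F‖ₑ ≤ C * eLpNorm F (.ofReal p) (dV n ν) := by
  obtain ⟨C, hC⟩ := hγ.2.2
  refine ⟨.ofReal |C|, by simp, fun F hF => ?_⟩
  have h := hC F hF
  rw [lpNorm_eq hp] at h
  rw [← ofReal_norm, ← ENNReal.ofReal_toReal (hF.memLp hp).2.ne, ← ENNReal.ofReal_mul (abs_nonneg C)]
  exact ENNReal.ofReal_le_ofReal
    (h.trans (mul_le_mul_of_nonneg_right (le_abs_self C) ENNReal.toReal_nonneg))

lemma isBddFunc.tendsto_reg (hn : 3 ≤ n) {ν : ℝ} (hν : (n : ℝ) / 2 - 1 < ν) {p : ℝ} (hp : 1 ≤ p)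
    {γ : ((Fin n → ℂ) → ℂ) → ℂ} (hγ : isBddFunc n p ν γ) {F : (Fin n → ℂ) → ℂ}
    (hF : memA n p ν F) : Tendsto (fun k => γ (reg ν k F)) atTop (𝓝 (γ F)) := by
  have hp0 : 0 < p := by linarith
  obtain ⟨C, hC, h⟩ := hγ.exists_enorm_le hp0
  have h1 := ENNReal.Tendsto.const_mul (tendsto_eLpNorm_reg_sub hn hν hp hF.1 (hF.memLp hp0))
    (Or.inr hC)
  rw [mul_zero] at h1
  rw [tendsto_iff_edist_tendsto_0]
  refine tendsto_of_tendsto_of_tendsto_of_le_of_le tendsto_const_nhds h1 (fun _ => zero_le)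
    fun k => ?_
  have hk := memA_reg hn hν hp hp k hF
  rw [edist_eq_enorm_sub, ← hγ.map_sub hp0 hk hF]
  exact h _ (hk.sub hp0 hF)

lemma exists_reg_representative (hn : 3 ≤ n) {ν : ℝ} (hν : (n : ℝ) / 2 - 1 < ν) {p : ℝ}
    (hp : 1 ≤ p) {γ : ((Fin n → ℂ) → ℂ) → ℂ} (hγ : isBddFunc n p ν γ) (k : ℕ) :
    ∃ F, memA n 2 ν F ∧ ∀ G, memA n 2 ν G → γ (reg ν k G) = pairing (dV n ν) G F := by
  have hp0 : 0 < p := by linarith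
  have hmem : ∀ F, DifferentiableOn ℂ F (tube n) → MemLp F 2 (dV n ν) → memA n 2 ν F :=
    fun F hF hF2 => memA_of_memLp two_pos hF (by rwa [ENNReal.ofReal_ofNat])
  obtain ⟨C, hC, hb⟩ := hγ.exists_enorm_le hp0
  obtain ⟨C', hC', hreg⟩ := exists_eLpNorm_reg_le hn hν one_le_two hp k
  obtain ⟨F, hF, hF2, h⟩ := exists_riesz hν (φ := fun G => γ (reg ν k G)) (C := (C * C').toReal)
    (fun F G hF hF2 hG hG2 => by
      rw [reg_add]
      exact hγ.1 _ _ (memA_reg hn hν one_le_two hp k (hmem F hF hF2))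
        (memA_reg hn hν one_le_two hp k (hmem G hG hG2)))
    (fun c F hF hF2 => by
      rw [reg_const_mul]
      exact hγ.2.1 c _ (memA_reg hn hν one_le_two hp k (hmem F hF hF2)))
    (fun F hF hF2 => by
      rw [← toReal_enorm, ← ENNReal.toReal_mul, mul_assoc]
      refine ENNReal.toReal_mono
        (ENNReal.mul_ne_top hC (ENNReal.mul_ne_top hC' hF2.2.ne)) ?_
      refine (hb _ (memA_reg hn hν one_le_two hp k (hmem F hF hF2))).trans (mul_le_mul_right ?_ C)
      simpa using hreg F hF)
  exact ⟨F, hmem F hF hF2, fun G hG => h G hG.1 (by simpa using hG.memLp two_pos)⟩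

lemma exists_representative_of_bounded (hn : 3 ≤ n) {ν : ℝ} (hν : (n : ℝ) / 2 - 1 < ν)
    {p q : ℝ} (hpq : p.HolderConjugate q) (hP : projBounded n p ν)
    {γ : ((Fin n → ℂ) → ℂ) → ℂ} (hγ : isBddFunc n p ν γ) :
    ∃ F, memA n q ν F ∧ ∀ G, memA n p ν G → γ G = pairing (dV n ν) G F := by
  have hp := hpq.lt.le
  have hp0 := hpq.pos
  obtain ⟨C, hC, hP⟩ := (projBounded_iff hp0).1 hP
  obtain ⟨C', hC', hγC⟩ := hγ.exists_enorm_le hp0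
  choose Fk hFk hFkγ using exists_reg_representative hn hν hp hγ
  have hproj : ∀ f g : (Fin n → ℂ) → ℂ, MemLp f (.ofReal 2) (dV n ν) →
      MemLp f (.ofReal p) (dV n ν) → isProj n ν f g → memA n p ν g := fun f g hf2 hfp hfg =>
    memA_of_memLp hp0 hfg.1.1 ⟨aestronglyMeasurable_dV hfg.1.1,
      (hP f g hf2 hfp hfg).trans_lt (ENNReal.mul_lt_top hC.lt_top hfp.2)⟩
  have hpair : ∀ f g : (Fin n → ℂ) → ℂ, isProj n ν f g → ∀ k,
      pairing (dV n ν) f (Fk k) = γ (reg ν k g) := fun f g hfg k => by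
    rw [hfg.pairing_eq (hFk k), hFkγ k g hfg.1]
  set T := trC ν n ^ (1 / p) with hT
  have hTtop : T ≠ ⊤ := ENNReal.rpow_ne_top_of_nonneg (by positivity) (trC_ne_top ν n)
  set M := C' * (T * C) with hM
  have hMtop : M ≠ ⊤ := ENNReal.mul_ne_top hC' (ENNReal.mul_ne_top hTtop hC)
  have hFkM : ∀ k, eLpNorm (Fk k) (.ofReal q) (dV n ν) ≤ M := fun k => by
    refine eLpNorm_le_of_pairing_le hpq (aestronglyMeasurable_dV (hFk k).1) fun f hf => ?_
    obtain ⟨g, hg⟩ := exists_isProj hν (hf (.ofReal 2))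
    have hgp := hproj f g (hf _) (hf _) hg
    rw [hpair f g hg k, hM, mul_assoc, mul_assoc]
    refine (hγC _ (memA_reg hn hν hp hp k hgp)).trans (mul_le_mul_right ?_ _)
    exact (eLpNorm_reg_le hn hν hp k hgp.1).trans (mul_le_mul_right (hP f g (hf _) (hf _) hg) _)
  have hlim : ∀ z ∈ tube n, ∃ L, Tendsto (fun k => Fk k z) atTop (𝓝 L) := fun z hz => by
    obtain ⟨b, hb, hbz⟩ := exists_pointFunctional ν hz
    obtain ⟨g, hg⟩ := exists_isProj hν (hb (.ofReal 2))
    refine ⟨(starRingEnd ℂ) (γ g), ?_⟩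
    have h := (continuous_conj.tendsto _).comp (hγ.tendsto_reg hn hν hp (hproj b g (hb _) (hb _) hg))
    refine h.congr fun k => ?_
    rw [Function.comp_apply, ← hpair b g hg k, conj_pairing, hbz _ (hFk k).1]
  choose! F hF using hlim
  obtain ⟨hF1, hFq⟩ := memLp_of_tendsto hν hpq.symm.lt.le (fun k => (hFk k).1) hMtop hFkM hF
  have hFA : memA n q ν F := memA_of_memLp hpq.symm.pos hF1 hFq
  have h2p : ∀ G, memA n 2 ν G → memA n p ν G → γ G = pairing (dV n ν) G F := fun G hG2 hGp => by
    have h1 := tendsto_pairing_of_ae hpq hMtop (fun k => aestronglyMeasurable_dV (hFk k).1) hFkM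
      (by filter_upwards [ae_mem_tube ν] with z hz using hF z hz) (hGp.memLp hp0)
    have h2 := hγ.tendsto_reg hn hν hp hGp
    simp only [hFkγ _ G hG2] at h2
    exact tendsto_nhds_unique h2 h1
  refine ⟨F, hFA, fun G hG => ?_⟩
  have h1 := hγ.tendsto_reg hn hν hp hG
  have h2 := (continuous_conj.tendsto _).comp (tendsto_pairing_reg hn hν hpq.symm hG hFq)
  rw [conj_pairing] at h2
  refine tendsto_nhds_unique h1 (h2.congr fun k => ?_)
  rw [Function.comp_apply, conj_pairing, h2p _ (memA_reg hn hν hp one_le_two k hG)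
    (memA_reg hn hν hp hp k hG)]

end Duality

section Converse

variable {n : ℕ} [NeZero n]

open Filter Topology

lemma pairing_congr_right {α : Type*} [MeasurableSpace α] {μ : Measure α} (f : α → ℂ)
    {g₁ g₂ : α → ℂ} (h : g₁ =ᵐ[μ] g₂) : pairing μ f g₁ = pairing μ f g₂ :=
  integral_congr_ae (by filter_upwards [h] with z hz; rw [hz])

lemma pairing_add_right {α : Type*} [MeasurableSpace α] {μ : Measure α} {p q : ℝ}
    (hpq : p.HolderConjugate q) {f g₁ g₂ : α → ℂ}
    (hf : MemLp f (.ofReal p) μ) (hg₁ : MemLp g₁ (.ofReal q) μ) (hg₂ : MemLp g₂ (.ofReal q) μ) :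
    pairing μ f (g₁ + g₂) = pairing μ f g₁ + pairing μ f g₂ := by
  rw [← conj_pairing, pairing_add_left hpq.symm hg₁ hg₂ hf, map_add, conj_pairing, conj_pairing]

lemma pairing_smul_right {α : Type*} [MeasurableSpace α] {μ : Measure α} (c : ℂ) (f g : α → ℂ) :
    pairing μ f (c • g) = (starRingEnd ℂ) c * pairing μ f g := by
  rw [← conj_pairing, ← conj_pairing g f, ← map_mul]
  exact congrArg _ (pairing_smul_left c g f)

lemma tendsto_pairing_Lp {α : Type*} [MeasurableSpace α] {μ : Measure α} {p q : ℝ}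
    (hpq : p.HolderConjugate q) [Fact (1 ≤ ENNReal.ofReal q)] {f : α → ℂ}
    (hf : MemLp f (.ofReal p) μ) {u : ℕ → Lp ℂ (.ofReal q) μ} {x : Lp ℂ (.ofReal q) μ}
    (hu : Tendsto u atTop (𝓝 x)) :
    Tendsto (fun k => pairing μ f (u k)) atTop (𝓝 (pairing μ f x)) := by
  rw [tendsto_iff_norm_sub_tendsto_zero] at hu ⊢
  have h := hu.const_mul (eLpNorm f (.ofReal p) μ).toReal
  rw [mul_zero] at h
  refine squeeze_zero (fun _ => norm_nonneg _) (fun k => ?_) h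
  rw [← pairing_sub_right hpq hf (Lp.memLp _) (Lp.memLp _),
    ← pairing_congr_right f (Lp.coeFn_sub (u k) x)]
  exact norm_pairing_le hpq hf (Lp.memLp _)

lemma isBddFunc_pairing {ν p q : ℝ} (hpq : p.HolderConjugate q) {f : (Fin n → ℂ) → ℂ}
    (hf : MemLp f (.ofReal q) (dV n ν)) :
    isBddFunc n p ν (fun G => pairing (dV n ν) G f) := by
  refine ⟨fun F G hF hG => pairing_add_left hpq (hF.memLp hpq.pos) (hG.memLp hpq.pos) hf,
    fun c F _ => pairing_smul_left c F f, (eLpNorm f (.ofReal q) (dV n ν)).toReal, fun F hF => ?_⟩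
  rw [lpNorm_eq hpq.pos, mul_comm]
  exact norm_pairing_le hpq (hF.memLp hpq.pos) hf

/-- If every bounded functional on `A^p` is represented by a unique element of `A^q`, then the
representative of `G ↦ ⟪G, f⟫` depends boundedly on `f ∈ L^q`. -/
lemma exists_bound_representative {ν : ℝ} (hν : (n : ℝ) / 2 - 1 < ν)
    {p q : ℝ} (hpq : p.HolderConjugate q)
    (hinj : ∀ F₁ F₂, memA n q ν F₁ → memA n q ν F₂ →
      (∀ G, memA n p ν G → pairing (dV n ν) G F₁ = pairing (dV n ν) G F₂) → EqOn F₁ F₂ (tube n))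
    (hsurj : ∀ f : (Fin n → ℂ) → ℂ, MemLp f (.ofReal q) (dV n ν) → ∃ F, memA n q ν F ∧
      ∀ G, memA n p ν G → pairing (dV n ν) G f = pairing (dV n ν) G F) :
    ∃ C : ℝ≥0∞, C ≠ ⊤ ∧ ∀ f F : (Fin n → ℂ) → ℂ, MemLp f (.ofReal q) (dV n ν) → memA n q ν F →
      (∀ G, memA n p ν G → pairing (dV n ν) G f = pairing (dV n ν) G F) →
      eLpNorm F (.ofReal q) (dV n ν) ≤ C * eLpNorm f (.ofReal q) (dV n ν) := by
  have hq0 := hpq.symm.pos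
  have : Fact (1 ≤ ENNReal.ofReal q) := ⟨one_le_ofReal_of_lt hpq.symm.lt.le⟩
  have huniq : ∀ F₁ F₂, memA n q ν F₁ → memA n q ν F₂ →
      (∀ G, memA n p ν G → pairing (dV n ν) G F₁ = pairing (dV n ν) G F₂) →
      F₁ =ᵐ[dV n ν] F₂ := fun F₁ F₂ h₁ h₂ h => by
    filter_upwards [ae_mem_tube ν] with z hz using hinj F₁ F₂ h₁ h₂ h hz
  choose rep hrep hpair using fun u : Lp ℂ (.ofReal q) (dV n ν) => hsurj u (Lp.memLp u)
  have hrepL : ∀ u, MemLp (rep u) (.ofReal q) (dV n ν) := fun u => (hrep u).memLp hq0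
  let S : Lp ℂ (.ofReal q) (dV n ν) →ₗ[ℂ] Lp ℂ (.ofReal q) (dV n ν) :=
    { toFun := fun u => (hrepL u).toLp (rep u)
      map_add' := fun u v => by
        rw [← MemLp.toLp_add, MemLp.toLp_eq_toLp_iff]
        refine huniq _ _ (hrep _)
          (memA_of_memLp hq0 ((hrep u).1.add (hrep v).1) ((hrepL u).add (hrepL v))) fun G hG => ?_
        have hGp := hG.memLp hpq.pos
        rw [← hpair _ G hG, pairing_congr_right G (Lp.coeFn_add u v),
          pairing_add_right hpq hGp (Lp.memLp u) (Lp.memLp v),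
          pairing_add_right hpq hGp (hrepL u) (hrepL v), hpair u G hG, hpair v G hG]
      map_smul' := fun c u => by
        rw [RingHom.id_apply, ← MemLp.toLp_const_smul, MemLp.toLp_eq_toLp_iff]
        refine huniq _ _ (hrep _)
          (memA_of_memLp hq0 ((hrep u).1.const_smul c) ((hrepL u).const_smul c)) fun G hG => ?_
        rw [← hpair _ G hG, pairing_congr_right G (Lp.coeFn_smul c u), pairing_smul_right,
          pairing_smul_right, hpair u G hG] }
  have hS : ∀ u, ⇑(S u) =ᵐ[dV n ν] rep u := fun u => (hrepL u).coeFn_toLp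
  have hcont : Continuous S := by
    refine S.continuous_of_seq_closed_graph fun u x y hu hSu => ?_
    obtain ⟨Y, hY, hyY⟩ := (isClosed_bergmanLp hν (by simp)).mem_of_tendsto hSu
      (Eventually.of_forall fun k => ⟨rep (u k), (hrep _).1, hS (u k)⟩)
    refine Lp.ext (hyY.trans (EventuallyEq.trans ?_ (hS x).symm))
    refine huniq _ _ (memA_of_memLp hq0 hY ((memLp_congr_ae hyY).1 (Lp.memLp y))) (hrep x)
      fun G hG => ?_
    have hGp := hG.memLp hpq.pos
    have h1 := tendsto_pairing_Lp hpq hGp hu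
    have h2 := tendsto_pairing_Lp hpq hGp hSu
    rw [← pairing_congr_right G hyY, ← hpair x G hG]
    refine tendsto_nhds_unique h2 (h1.congr fun k => ?_)
    rw [hpair _ G hG, Function.comp_apply, pairing_congr_right G (hS (u k))]
  let Sc : Lp ℂ (.ofReal q) (dV n ν) →L[ℂ] Lp ℂ (.ofReal q) (dV n ν) := ⟨S, hcont⟩
  refine ⟨‖Sc‖ₑ, enorm_ne_top, fun f F hf hF h => ?_⟩
  have hFS : F =ᵐ[dV n ν] Sc (hf.toLp f) := by
    refine EventuallyEq.trans (huniq _ _ hF (hrep _) fun G hG => ?_) (hS _).symm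
    rw [← h G hG, ← hpair _ G hG, pairing_congr_right G hf.coeFn_toLp]
  rw [eLpNorm_congr_ae hFS, ← Lp.enorm_def, ← Lp.enorm_toLp hf]
  exact Sc.le_opENorm _

lemma eqOn_zero_of_pairing_self {ν : ℝ} (hν : (n : ℝ) / 2 - 1 < ν) {D : (Fin n → ℂ) → ℂ}
    (hD : memA n 2 ν D) (h : pairing (dV n ν) D D = 0) : EqOn D 0 (tube n) := by
  have hD2 : MemLp D 2 (dV n ν) := by simpa using hD.memLp two_pos
  rw [← inner_toLp hD2 hD2, inner_self_eq_zero] at h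
  refine eqOn_of_ae_eq hν hD.1 (differentiableOn_const 0) ?_
  exact hD2.coeFn_toLp.symm.trans (by rw [h]; exact Lp.coeFn_zero _ _ _)

/-- The representative of `G ↦ ⟪G, f⟫` is the Bergman projection of `f`. -/
lemma eqOn_representative_isProj (hn : 3 ≤ n) {ν : ℝ} (hν : (n : ℝ) / 2 - 1 < ν)
    {p q : ℝ} (hpq : p.HolderConjugate q)
    (hinj : ∀ F₁ F₂, memA n q ν F₁ → memA n q ν F₂ →
      (∀ G, memA n p ν G → pairing (dV n ν) G F₁ = pairing (dV n ν) G F₂) → EqOn F₁ F₂ (tube n))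
    {f F g : (Fin n → ℂ) → ℂ} (hF : memA n q ν F) (hfg : isProj n ν f g)
    (h : ∀ G, memA n p ν G → pairing (dV n ν) G f = pairing (dV n ν) G F) :
    EqOn F g (tube n) := by
  have hp := hpq.lt.le
  have hq := hpq.symm.lt.le
  have hp0 := hpq.pos
  have hq0 := hpq.symm.pos
  have h22 : Real.HolderConjugate 2 2 := Real.HolderConjugate.two_two
  have hpair : ∀ ε : ℝ, 0 < ε → ∀ G, memA n 2 ν G → memA n p ν G →
      pairing (dV n ν) G (tr (ε * I) F) = pairing (dV n ν) G (tr (ε * I) g) := by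
    intro ε hε G hG2 hGp
    have hG2' := memA_tr hn hν one_le_two le_rfl hε hG2
    rw [← pairing_tr hn hν hpq hε hF.1 hG2.1 (hF.memLp hq0) (hGp.memLp hp0),
      ← pairing_tr hn hν h22 hε hfg.1.1 hG2.1 (hfg.1.memLp two_pos) (hG2.memLp two_pos),
      ← h _ (memA_tr hn hν hp le_rfl hε hGp), ← conj_pairing, hfg.pairing_eq hG2', conj_pairing]
  have key : ∀ ε : ℝ, 0 < ε → EqOn (tr (ε * I) F) (tr (ε * I) g) (tube n) := by
    intro ε hε
    have hFt := memA_tr hn hν hq le_rfl hε hF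
    have hgt := memA_tr hn hν one_le_two le_rfl hε hfg.1
    rcases le_total 2 q with h2q | hq2
    · have hgq := memA_tr hn hν one_le_two h2q hε hfg.1
      refine hinj _ _ hFt hgq fun G hG => ?_
      have h1 := (continuous_conj.tendsto _).comp
        (tendsto_pairing_reg hn hν hpq.symm hG (hFt.memLp hq0))
      have h2 := (continuous_conj.tendsto _).comp
        (tendsto_pairing_reg hn hν hpq.symm hG (hgq.memLp hq0))
      rw [conj_pairing] at h1 h2
      refine tendsto_nhds_unique h1 (h2.congr fun k => ?_)
      rw [Function.comp_apply, Function.comp_apply, conj_pairing, conj_pairing,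
        hpair ε hε _ (memA_reg hn hν hp one_le_two k hG) (memA_reg hn hν hp hp k hG)]
    · have hF2 := memA_tr hn hν hq hq2 hε hF
      have hD := hF2.sub two_pos hgt
      have hzero : pairing (dV n ν) (tr (ε * I) F - tr (ε * I) g)
          (tr (ε * I) F - tr (ε * I) g) = 0 := by
        refine tendsto_nhds_unique (tendsto_pairing_reg hn hν h22 hD (hD.memLp two_pos))
          (tendsto_const_nhds.congr fun k => ?_)
        have hR2 := memA_reg hn hν one_le_two one_le_two k hD
        rw [← conj_pairing, pairing_sub_right h22 (hR2.memLp two_pos) (hF2.memLp two_pos)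
          (hgt.memLp two_pos), hpair ε hε _ hR2 (memA_reg hn hν one_le_two hp k hD), sub_self,
          map_zero]
      exact fun z hz => sub_eq_zero.1 (eqOn_zero_of_pairing_self hν hD hzero hz)
  intro z hz
  refine tendsto_nhds_unique (tendsto_tr hF.1 hz) ((tendsto_tr hfg.1.1 hz).congr fun k => ?_)
  exact (key _ (regε_pos k) hz).symm

lemma projBounded_of_duality (hn : 3 ≤ n) {ν : ℝ} (hν : (n : ℝ) / 2 - 1 < ν)
    {p q : ℝ} (hpq : p.HolderConjugate q)
    (hinj : ∀ F₁ F₂, memA n q ν F₁ → memA n q ν F₂ →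
      (∀ G, memA n p ν G → pairing (dV n ν) G F₁ = pairing (dV n ν) G F₂) → EqOn F₁ F₂ (tube n))
    (hsurj : ∀ γ, isBddFunc n p ν γ → ∃ F, memA n q ν F ∧
      ∀ G, memA n p ν G → γ G = pairing (dV n ν) G F) :
    projBounded n p ν := by
  have hsurj' := fun f (hf : MemLp f (.ofReal q) (dV n ν)) => hsurj _ (isBddFunc_pairing hpq hf)
  obtain ⟨C, hC, hbound⟩ := exists_bound_representative hν hpq hinj hsurj'
  refine (projBounded_iff hpq.pos).2 ⟨C, hC, fun f g hf2 hfp hfg => ?_⟩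
  refine eLpNorm_le_of_pairing_le hpq.symm (aestronglyMeasurable_dV hfg.1.1) fun h hh => ?_
  obtain ⟨g', hg'⟩ := exists_isProj hν (hh (.ofReal 2))
  obtain ⟨F, hF, hhF⟩ := hsurj' h (hh _)
  have hFg := eqOn_representative_isProj hn hν hpq hinj hF hg' hhF
  have hb := hbound h F (hh _) hF hhF
  rw [eLpNorm_congr_ae (show F =ᵐ[dV n ν] g' by
    filter_upwards [ae_mem_tube ν] with z hz using hFg hz)] at hb
  have heq : pairing (dV n ν) h g = pairing (dV n ν) g' f := by
    rw [hg'.pairing_eq hfg.1, ← conj_pairing, ← hfg.pairing_eq hg'.1, conj_pairing]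
  rw [heq]
  refine (enorm_pairing_le hpq.symm (aestronglyMeasurable_dV hg'.1.1) hfp.1).trans ?_
  calc _ ≤ C * eLpNorm h (.ofReal q) (dV n ν) * eLpNorm f (.ofReal p) (dV n ν) :=
        mul_le_mul_left hb _
    _ = _ := by ring

end Converse

/-- Theorem: boundedness of `P_ν` on `L^p_ν` ⇔ `A^{p'}_ν ≅ (A^p_ν)^*`.
Let `ν > n/2 − 1` and `1 < p < ∞`, `p' = p/(p−1)`. Then `P_ν` admits a bounded extension to
`L^p_ν` iff the natural map `Φ : F ↦ (G ↦ ∫ G conj F dV_ν)` is a bijection from `A^{p'}_ν`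
onto the continuous linear functionals on `A^p_ν`. -/
theorem bergman_bounded_iff_duality (n : ℕ) [NeZero n] (hn : 3 ≤ n) (ν p : ℝ)
    (hν : (n : ℝ) / 2 - 1 < ν) (hp : 1 < p) :
    projBounded n p ν ↔
      ((∀ F₁ F₂, memA n (p / (p - 1)) ν F₁ → memA n (p / (p - 1)) ν F₂ →
          (∀ G, memA n p ν G →
            ∫ z, G z * (starRingEnd ℂ) (F₁ z) ∂(dV n ν) =
              ∫ z, G z * (starRingEnd ℂ) (F₂ z) ∂(dV n ν)) →
          Set.EqOn F₁ F₂ (tube n)) ∧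
       (∀ γ : ((Fin n → ℂ) → ℂ) → ℂ, isBddFunc n p ν γ →
          ∃ F, memA n (p / (p - 1)) ν F ∧ ∀ G, memA n p ν G →
            γ G = ∫ z, G z * (starRingEnd ℂ) (F z) ∂(dV n ν))) := by
  have hpq : p.HolderConjugate (p / (p - 1)) := Real.HolderConjugate.conjExponent hp
  refine ⟨fun hP => ⟨fun F₁ F₂ h₁ h₂ h z hz => sub_eq_zero.1 ?_, fun γ hγ =>
    exists_representative_of_bounded hn hν hpq hP hγ⟩,
    fun h => projBounded_of_duality hn hν hpq h.1 h.2⟩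
  have hq0 := hpq.symm.pos
  refine eq_zero_of_pairing_eq_zero_of_bounded hn hν hpq hP (h₁.sub hq0 h₂) (fun G hG => ?_) z hz
  rw [pairing_sub_right hpq (hG.memLp hpq.pos) (h₁.memLp hq0) (h₂.memLp hq0)]
  exact sub_eq_zero.2 (h G hG)
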